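/- Let p ≥ 2 and let μ be a Borel probability measure on [0,1] (viewed on the circle) invariant and ergodic under T_p with dim μ > 0. Let m > p be an integer with m ≁ p, and let f(x) = ax + b be a non-singular affine map of ℝ (a ≠ 0) with f([0,1]) ⊆ [0,1]. Then for μ-almost every x, the sequence (1/N)∑_{i=0}^{N-1} δ_{(T_m^i f(x), T_p^i x)} converges weak-* to λ × μ. -/

import Mathlib

open MeasureTheory Filter Set Topology
open scoped ENNReal
set_option linter.unusedSectionVars false
set_option linter.unusedVariables false
set_option linter.unusedSimpArgs false

/-- The (lower) Hausdorff dimension of a measure: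
`dim μ = inf { dim_H A : A Borel, μ(A) > 0 }`. -/
noncomputable def measureDim {X : Type*} [EMetricSpace X] [MeasurableSpace X]
    (μ : Measure X) : ℝ≥0∞ :=
  ⨅ (A : Set X) (_ : MeasurableSet A) (_ : 0 < μ A), dimH A

/-- `T_n x = n x mod 1` as a self-map of `[0,1) ⊆ ℝ`. -/
noncomputable def Tmap (n : ℕ) (x : ℝ) : ℝ := Int.fract (n * x)

/-! ### Conditional expectation on a countable partition -/

/-- Average of `Φ` over the cell of the partition `c` containing `x`. -/
noncomputable def cE (μ : Measure ℝ) (c : ℝ → ℤ) (Φ : ℝ → ℂ) (x : ℝ) : ℂ :=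
  ((μ.real (c ⁻¹' {c x}) : ℝ) : ℂ)⁻¹ * ∫ y in c ⁻¹' {c x}, Φ y ∂μ

section cEsec
variable {μ : Measure ℝ} [IsProbabilityMeasure μ] {c : ℝ → ℤ}

lemma integrable_bdd {Φ : ℝ → ℂ} (hΦ : Measurable Φ) {C : ℝ} (hb : ∀ x, ‖Φ x‖ ≤ C) :
    Integrable Φ μ :=
  Integrable.of_bound hΦ.aestronglyMeasurable C (Eventually.of_forall hb)

lemma integrable_bddR {Φ : ℝ → ℝ} (hΦ : Measurable Φ) {C : ℝ} (hb : ∀ x, ‖Φ x‖ ≤ C) :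
    Integrable Φ μ :=
  Integrable.of_bound hΦ.aestronglyMeasurable C (Eventually.of_forall hb)

lemma cE_norm_le {Φ : ℝ → ℂ} {C : ℝ} (hC : 0 ≤ C) (hb : ∀ x, ‖Φ x‖ ≤ C) (x : ℝ) :
    ‖cE μ c Φ x‖ ≤ C := by
  unfold cE
  rw [norm_mul, norm_inv, Complex.norm_real, Real.norm_of_nonneg measureReal_nonneg]
  have h1 : ‖∫ y in c ⁻¹' {c x}, Φ y ∂μ‖ ≤ C * μ.real (c ⁻¹' {c x}) :=
    norm_setIntegral_le_of_norm_le_const (measure_lt_top _ _) (fun y _ => hb y)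
  rcases eq_or_ne (μ.real (c ⁻¹' {c x})) 0 with h0 | h0
  · simp [h0, hC]
  · calc (μ.real (c ⁻¹' {c x}))⁻¹ * ‖∫ y in c ⁻¹' {c x}, Φ y ∂μ‖
        ≤ (μ.real (c ⁻¹' {c x}))⁻¹ * (C * μ.real (c ⁻¹' {c x})) := by
          gcongr
      _ = C := by field_simp

lemma cE_congr {Φ : ℝ → ℂ} {x y : ℝ} (h : c x = c y) : cE μ c Φ x = cE μ c Φ y := by
  unfold cE; rw [h]

lemma cE_factor (Φ : ℝ → ℂ) : ∃ k : ℤ → ℂ, ∀ x, cE μ c Φ x = k (c x) :=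
  ⟨fun w => ((μ.real (c ⁻¹' {w}) : ℝ) : ℂ)⁻¹ * ∫ y in c ⁻¹' {w}, Φ y ∂μ, fun _ => rfl⟩

lemma measurable_cE (hc : Measurable c) (Φ : ℝ → ℂ) : Measurable (cE μ c Φ) := by
  obtain ⟨k, hk⟩ := cE_factor (μ := μ) (c := c) Φ
  have : cE μ c Φ = k ∘ c := funext hk
  rw [this]
  exact (measurable_of_countable k).comp hc

lemma ae_cell_pos (hc : Measurable c) : ∀ᵐ x ∂μ, 0 < μ.real (c ⁻¹' {c x}) := by
  have h : ∀ w : ℤ, μ.real (c ⁻¹' {w}) = 0 → ∀ᵐ x ∂μ, c x ≠ w := by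
    intro w hw
    have : μ (c ⁻¹' {w}) = 0 := by
      rwa [measureReal_eq_zero_iff] at hw
    rw [ae_iff]
    have e : {a | ¬ c a ≠ w} = c ⁻¹' {w} := by ext; simp
    rw [e]; exact this
  have h2 : ∀ᵐ x ∂μ, ∀ w : ℤ, μ.real (c ⁻¹' {w}) = 0 → c x ≠ w := by
    rw [ae_all_iff]; intro w
    by_cases hw : μ.real (c ⁻¹' {w}) = 0
    · filter_upwards [h w hw] with x hx _ using hx
    · exact Eventually.of_forall fun x h => absurd h hw
  filter_upwards [h2] with x hx
  rcases (measureReal_nonneg (μ := μ) (s := c ⁻¹' {c x})).lt_or_eq with h | h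
  · exact h
  · exact absurd rfl (hx (c x) h.symm)

lemma integral_cells (hc : Measurable c) {f : ℝ → ℂ} (hf : Integrable f μ) :
    ∫ x, f x ∂μ = ∑' w : ℤ, ∫ x in c ⁻¹' {w}, f x ∂μ := by
  have hU : (⋃ w : ℤ, c ⁻¹' {w}) = univ := by ext; simp
  rw [← integral_iUnion (fun w => hc (measurableSet_singleton w)) ?_ ?_, hU, setIntegral_univ]
  · intro a b hab
    simp only [Function.onFun]
    rw [Set.disjoint_left]
    rintro x hx hx'
    exact hab (hx.symm.trans hx')
  · exact hf.integrableOn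

lemma cE_integral_mul (hc : Measurable c) {Φ : ℝ → ℂ} {k : ℤ → ℂ}
    (h1 : Integrable (fun x => k (c x) * cE μ c Φ x) μ)
    (h2 : Integrable (fun x => k (c x) * Φ x) μ) :
    ∫ x, k (c x) * cE μ c Φ x ∂μ = ∫ x, k (c x) * Φ x ∂μ := by
  rw [integral_cells hc h1, integral_cells hc h2]
  congr 1
  ext w
  have hm : MeasurableSet (c ⁻¹' {w}) := hc (measurableSet_singleton w)
  have e1 : ∫ x in c ⁻¹' {w}, k (c x) * cE μ c Φ x ∂μ
      = ∫ x in c ⁻¹' {w}, k w * (((μ.real (c ⁻¹' {w}) : ℝ) : ℂ)⁻¹ * ∫ y in c ⁻¹' {w}, Φ y ∂μ) ∂μ := by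
    apply setIntegral_congr_fun hm
    intro x hx
    have hx' : c x = w := hx
    simp only [cE, hx']
  have e2 : ∫ x in c ⁻¹' {w}, k (c x) * Φ x ∂μ = ∫ x in c ⁻¹' {w}, k w * Φ x ∂μ := by
    apply setIntegral_congr_fun hm
    intro x hx
    have hx' : c x = w := hx
    simp only [hx']
  rw [e1, e2, setIntegral_const, integral_const_mul, Complex.real_smul]
  rcases eq_or_ne (μ.real (c ⁻¹' {w})) 0 with h0 | h0
  · have : μ (c ⁻¹' {w}) = 0 := by rwa [measureReal_eq_zero_iff] at h0
    rw [Measure.restrict_eq_zero.2 this]; simp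
  · have : ((μ.real (c ⁻¹' {w}) : ℝ) : ℂ) ≠ 0 := by exact_mod_cast h0
    field_simp

/-- version for bounded functions -/
lemma cE_integral_mul' (hc : Measurable c) {Φ : ℝ → ℂ} (hΦ : Measurable Φ) {C : ℝ} (hC : 0 ≤ C)
    (hb : ∀ x, ‖Φ x‖ ≤ C) {k : ℤ → ℂ} {D : ℝ} (hk : ∀ x, ‖k (c x)‖ ≤ D) :
    ∫ x, k (c x) * cE μ c Φ x ∂μ = ∫ x, k (c x) * Φ x ∂μ := by
  have hkm : Measurable (fun x => k (c x)) := (measurable_of_countable k).comp hc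
  have hD : 0 ≤ D := (norm_nonneg _).trans (hk 0)
  apply cE_integral_mul hc
  · apply integrable_bdd (hkm.mul (measurable_cE hc Φ)) (C := D * C)
    intro x; simp only [Pi.mul_apply, norm_mul]; gcongr
    · exact hk x
    · exact cE_norm_le hC hb x
  · apply integrable_bdd (hkm.mul hΦ) (C := D * C)
    intro x; simp only [Pi.mul_apply, norm_mul]; gcongr
    · exact hk x
    · exact hb x

lemma cE_pull (hc : Measurable c) {Φ : ℝ → ℂ} {k : ℝ → ℂ}
    (hk : ∀ x y, c x = c y → k x = k y) (x : ℝ) :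
    cE μ c (fun y => k y * Φ y) x = k x * cE μ c Φ x := by
  unfold cE
  have e2 : ∫ y in c ⁻¹' {c x}, k y * Φ y ∂μ = ∫ y in c ⁻¹' {c x}, k x * Φ y ∂μ := by
    apply setIntegral_congr_fun (hc (measurableSet_singleton _))
    intro y hy
    have hy' : c y = c x := hy
    simp only [hk y x hy']
  rw [e2, integral_const_mul]; ring

lemma cE_comp (hc : Measurable c) {T : ℝ → ℝ} (hT : MeasurePreserving T μ μ) {Φ : ℝ → ℂ}
    (hΦ : Measurable Φ) (x : ℝ) :
    cE μ (fun y => c (T y)) (fun y => Φ (T y)) x = cE μ c Φ (T x) := by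
  unfold cE
  have hm : MeasurableSet (c ⁻¹' {c (T x)}) := hc (measurableSet_singleton _)
  have h0 : (fun y => c (T y)) ⁻¹' {c (T x)} = T ⁻¹' (c ⁻¹' {c (T x)}) := rfl
  have h1 : μ.real (T ⁻¹' (c ⁻¹' {c (T x)})) = μ.real (c ⁻¹' {c (T x)}) :=
    hT.measureReal_preimage hm.nullMeasurableSet
  have h2 : ∫ y in T ⁻¹' (c ⁻¹' {c (T x)}), Φ (T y) ∂μ = ∫ y in c ⁻¹' {c (T x)}, Φ y ∂μ := by
    conv_rhs => rw [← hT.map_eq]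
    rw [setIntegral_map hm hΦ.aestronglyMeasurable hT.measurable.aemeasurable]
  rw [h0, h1, h2]

lemma cE_sub_norm_le {Φ Ψ : ℝ → ℂ} (hΦ : Integrable Φ μ) (hΨ : Integrable Ψ μ) {δ : ℝ}
    (hδ : 0 ≤ δ) (h : ∀ y, ‖Φ y - Ψ y‖ ≤ δ) (x : ℝ) :
    ‖cE μ c Φ x - cE μ c Ψ x‖ ≤ δ := by
  have : cE μ c Φ x - cE μ c Ψ x = cE μ c (fun y => Φ y - Ψ y) x := by
    unfold cE
    rw [integral_sub hΦ.integrableOn hΨ.integrableOn]; ring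
  rw [this]
  exact cE_norm_le hδ h x

lemma cE_osc (hc : Measurable c) {Φ : ℝ → ℂ} (hΦ : Integrable Φ μ) {x : ℝ}
    (hx : 0 < μ.real (c ⁻¹' {c x})) (z : ℂ) {δ : ℝ}
    (h : ∀ y, c y = c x → ‖Φ y - z‖ ≤ δ) : ‖cE μ c Φ x - z‖ ≤ δ := by
  have hm : MeasurableSet (c ⁻¹' {c x}) := hc (measurableSet_singleton _)
  have hne : ((μ.real (c ⁻¹' {c x}) : ℝ) : ℂ) ≠ 0 := by exact_mod_cast hx.ne'
  have : cE μ c Φ x - z = ((μ.real (c ⁻¹' {c x}) : ℝ) : ℂ)⁻¹ * ∫ y in c ⁻¹' {c x}, (Φ y - z) ∂μ := by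
    unfold cE
    rw [integral_sub hΦ.integrableOn (integrable_const z).integrableOn, setIntegral_const,
      Complex.real_smul]
    field_simp
  rw [this, norm_mul, norm_inv, Complex.norm_real, Real.norm_of_nonneg measureReal_nonneg]
  have h1 : ‖∫ y in c ⁻¹' {c x}, (Φ y - z) ∂μ‖ ≤ δ * μ.real (c ⁻¹' {c x}) :=
    norm_setIntegral_le_of_norm_le_const (measure_lt_top _ _) (fun y hy => h y hy)
  calc (μ.real (c ⁻¹' {c x}))⁻¹ * ‖∫ y in c ⁻¹' {c x}, (Φ y - z) ∂μ‖
        ≤ (μ.real (c ⁻¹' {c x}))⁻¹ * (δ * μ.real (c ⁻¹' {c x})) := by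
          gcongr
      _ = δ := by field_simp

/-- A function constant on the cells of a partition factors through it. -/
lemma factor_of_const {α : Type*} [Nonempty α] {c' : ℝ → ℤ} {k : ℝ → α}
    (hk : ∀ x y, c' x = c' y → k x = k y) : ∃ g : ℤ → α, ∀ x, k x = g (c' x) := by
  have : Function.FactorsThrough k c' := fun x y h => hk x y h
  obtain ⟨g, hg⟩ := (Function.factorsThrough_iff k).1 this
  exact ⟨g, fun x => congrFun hg x⟩

/-- orthogonality with functions constant on cells -/
lemma cE_orth (hc : Measurable c) {Φ : ℝ → ℂ} (hΦ : Measurable Φ) {C : ℝ} (hC : 0 ≤ C)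
    (hb : ∀ x, ‖Φ x‖ ≤ C) {k : ℝ → ℂ} (hk : ∀ x y, c x = c y → k x = k y) {D : ℝ}
    (hkD : ∀ x, ‖k x‖ ≤ D) :
    ∫ x, k x * cE μ c Φ x ∂μ = ∫ x, k x * Φ x ∂μ := by
  obtain ⟨g, hg⟩ := factor_of_const hk
  simp_rw [hg]
  exact cE_integral_mul' hc hΦ hC hb (D := D) (fun x => by rw [← hg]; exact hkD x)

lemma measurable_of_const (hc : Measurable c) {k : ℝ → ℂ}
    (hk : ∀ x y, c x = c y → k x = k y) : Measurable k := by
  obtain ⟨g, hg⟩ := factor_of_const hk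
  have : k = g ∘ c := funext hg
  rw [this]; exact (measurable_of_countable g).comp hc

lemma cE_pyth {c' : ℝ → ℤ} (hc : Measurable c) (hc' : Measurable c')
    (href : ∀ x y, c' x = c' y → c x = c y) {Φ : ℝ → ℂ} (hΦ : Measurable Φ)
    (hb : ∀ x, ‖Φ x‖ ≤ 1) :
    ∫ x, ‖cE μ c' Φ x - cE μ c Φ x‖ ^ 2 ∂μ
      = ∫ x, ‖cE μ c' Φ x‖ ^ 2 ∂μ - ∫ x, ‖cE μ c Φ x‖ ^ 2 ∂μ := by
  have hu := fun x => cE_norm_le (μ := μ) (c := c) zero_le_one hb x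
  have hu' := fun x => cE_norm_le (μ := μ) (c := c') zero_le_one hb x
  have mu := measurable_cE (μ := μ) hc Φ
  have mu' := measurable_cE (μ := μ) hc' Φ
  set u := cE μ c Φ
  set u' := cE μ c' Φ
  have mconj : Measurable (fun x => (starRingEnd ℂ) (u x)) := Complex.continuous_conj.measurable.comp mu
  -- the two correlations agree
  have key : ∫ x, (starRingEnd ℂ) (u x) * u' x ∂μ = ∫ x, (starRingEnd ℂ) (u x) * u x ∂μ := by
    rw [cE_orth hc' hΦ zero_le_one hb (k := fun x => (starRingEnd ℂ) (u x)) (D := 1)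
      (fun x y h => by show _ = _; simp only [u]; rw [cE_congr (href x y h)])
      (fun x => by simpa using hu x)]
    rw [cE_orth hc hΦ zero_le_one hb (k := fun x => (starRingEnd ℂ) (u x)) (D := 1)
      (fun x y h => by show _ = _; simp only [u]; rw [cE_congr h])
      (fun x => by simpa using hu x)]
  have hre : ∫ x, ((starRingEnd ℂ) (u x) * u' x).re ∂μ = ∫ x, ‖u x‖ ^ 2 ∂μ := by
    have i1 : Integrable (fun x => (starRingEnd ℂ) (u x) * u' x) μ := by
      apply integrable_bdd (mconj.mul mu') (C := 1 * 1)
      intro x; simp only [Pi.mul_apply, norm_mul]; gcongr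
      · simpa using hu x
      · exact hu' x
    have i2 : Integrable (fun x => (starRingEnd ℂ) (u x) * u x) μ := by
      apply integrable_bdd (mconj.mul mu) (C := 1 * 1)
      intro x; simp only [Pi.mul_apply, norm_mul]; gcongr
      · simpa using hu x
      · exact hu x
    have e1 := integral_re i1
    have e2 := integral_re i2
    simp only [RCLike.re_eq_complex_re] at e1 e2
    rw [e1, key, ← e2]
    congr 1; ext x
    rw [← Complex.normSq_eq_conj_mul_self, Complex.ofReal_re, Complex.normSq_eq_norm_sq]
  have hpt : ∀ x, ‖u' x - u x‖ ^ 2 = ‖u' x‖ ^ 2 + ‖u x‖ ^ 2 - 2 * ((starRingEnd ℂ) (u x) * u' x).re := by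
    intro x
    rw [← Complex.normSq_eq_norm_sq, ← Complex.normSq_eq_norm_sq, ← Complex.normSq_eq_norm_sq,
      Complex.normSq_sub]
    simp [Complex.mul_re]; ring
  simp_rw [hpt]
  have j1 : Integrable (fun x => ‖u' x‖ ^ 2) μ := by
    apply integrable_bddR (mu'.norm.pow_const 2) (C := 1)
    intro x; rw [norm_pow, norm_norm]; exact pow_le_one₀ (norm_nonneg _) (hu' x)
  have j2 : Integrable (fun x => ‖u x‖ ^ 2) μ := by
    apply integrable_bddR (mu.norm.pow_const 2) (C := 1)
    intro x; rw [norm_pow, norm_norm]; exact pow_le_one₀ (norm_nonneg _) (hu x)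
  have j3 : Integrable (fun x => 2 * ((starRingEnd ℂ) (u x) * u' x).re) μ := by
    apply Integrable.const_mul
    have i1 : Integrable (fun x => (starRingEnd ℂ) (u x) * u' x) μ := by
      apply integrable_bdd (mconj.mul mu') (C := 1 * 1)
      intro x; simp only [Pi.mul_apply, norm_mul]; gcongr
      · simpa using hu x
      · exact hu' x
    exact i1.re
  have j12 : Integrable (fun x => ‖u' x‖ ^ 2 + ‖u x‖ ^ 2) μ := j1.add j2
  rw [integral_sub j12 j3, integral_add j1 j2, integral_const_mul, hre]
  ring

lemma cE_sq_mono {c' : ℝ → ℤ} (hc : Measurable c) (hc' : Measurable c')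
    (href : ∀ x y, c' x = c' y → c x = c y) {Φ : ℝ → ℂ} (hΦ : Measurable Φ)
    (hb : ∀ x, ‖Φ x‖ ≤ 1) :
    ∫ x, ‖cE μ c Φ x‖ ^ 2 ∂μ ≤ ∫ x, ‖cE μ c' Φ x‖ ^ 2 ∂μ := by
  have := cE_pyth (μ := μ) hc hc' href hΦ hb
  have h0 : 0 ≤ ∫ x, ‖cE μ c' Φ x - cE μ c Φ x‖ ^ 2 ∂μ :=
    integral_nonneg fun x => by positivity
  linarith

end cEsec


/-! ### Exponentials -/

/-- `e(t) = exp(2 π i t)` -/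
noncomputable def ee (t : ℝ) : ℂ := Complex.exp (((2 * Real.pi * t : ℝ) : ℂ) * Complex.I)

lemma ee_norm (t : ℝ) : ‖ee t‖ = 1 := Complex.norm_exp_ofReal_mul_I _

lemma ee_add (s t : ℝ) : ee (s + t) = ee s * ee t := by
  unfold ee; rw [← Complex.exp_add]; congr 1; push_cast; ring

lemma ee_zero : ee 0 = 1 := by simp [ee]

lemma ee_int (n : ℤ) : ee n = 1 := by
  unfold ee
  rw [Complex.exp_eq_one_iff]
  exact ⟨n, by push_cast; ring⟩

lemma ee_neg (t : ℝ) : ee (-t) = (starRingEnd ℂ) (ee t) := by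
  unfold ee
  rw [← Complex.exp_conj]; congr 1
  rw [map_mul, Complex.conj_ofReal, Complex.conj_I]; push_cast; ring

lemma ee_continuous : Continuous ee := by
  unfold ee; fun_prop

lemma ee_measurable : Measurable ee := ee_continuous.measurable

lemma ee_lip (s t : ℝ) : ‖ee s - ee t‖ ≤ 2 * Real.pi * |s - t| := by
  have : ee s - ee t = ee t * (ee (s - t) - 1) := by
    rw [mul_sub, ← ee_add]; simp
  rw [this, norm_mul, ee_norm, one_mul]
  have h := Real.norm_exp_I_mul_ofReal_sub_one_le (x := 2 * Real.pi * (s - t))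
  unfold ee
  rw [mul_comm, ]
  refine h.trans ?_
  rw [norm_mul, Real.norm_of_nonneg (by positivity), Real.norm_eq_abs]

lemma integral_comp_mp {E : Type*} [NormedAddCommGroup E] [NormedSpace ℝ E] [MeasurableSpace E]
    [BorelSpace E] [SecondCountableTopology E] {μ : Measure ℝ}
    {T : ℝ → ℝ} (hT : MeasurePreserving T μ μ) {f : ℝ → E} (hf : Measurable f) :
    ∫ x, f (T x) ∂μ = ∫ x, f x ∂μ := by
  conv_rhs => rw [← hT.map_eq]
  rw [integral_map hT.measurable.aemeasurable]
  exact hf.aestronglyMeasurable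

/-! ### Symbolic coding -/

/-- `T^n` applied to the fractional part -/
noncomputable def tn (p n : ℕ) (x : ℝ) : ℝ := Int.fract ((p:ℝ) ^ n * x)

/-- The index of the `p`-adic interval of level `n`. -/
noncomputable def cc (p n : ℕ) (x : ℝ) : ℤ := ⌊(p:ℝ) ^ n * Int.fract x⌋

section sym
variable {p : ℕ}

lemma fract_nat_mul_fract (k : ℕ) (x : ℝ) : Int.fract ((k:ℝ) * Int.fract x) = Int.fract ((k:ℝ) * x) := by
  rw [Int.fract_eq_fract]
  refine ⟨-(k * ⌊x⌋), ?_⟩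
  have := Int.self_sub_floor x
  rw [← this]; push_cast; ring

lemma fract_pow_mul_fract (n : ℕ) (x : ℝ) :
    Int.fract ((p:ℝ) ^ n * Int.fract x) = tn p n x := by
  have := fract_nat_mul_fract (p ^ n) x
  push_cast at this; exact this

lemma tn_tn (a b : ℕ) (x : ℝ) : tn p b (tn p a x) = tn p (a + b) x := by
  have := fract_nat_mul_fract (p ^ b) ((p:ℝ) ^ a * x)
  push_cast at this
  unfold tn; rw [this]; congr 1; ring

lemma tn_nonneg (n : ℕ) (x : ℝ) : 0 ≤ tn p n x := Int.fract_nonneg _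
lemma tn_lt_one (n : ℕ) (x : ℝ) : tn p n x < 1 := Int.fract_lt_one _
lemma tn_abs_le (n : ℕ) (x : ℝ) : |tn p n x| ≤ 1 := by
  rw [abs_of_nonneg (tn_nonneg _ _)]; exact (tn_lt_one n x).le
lemma tn_zero (x : ℝ) : tn p 0 x = Int.fract x := by simp [tn]
lemma fract_tn (n : ℕ) (x : ℝ) : Int.fract (tn p n x) = tn p n x := by simp [tn]
lemma tn_fract (n : ℕ) (x : ℝ) : tn p n (Int.fract x) = tn p n x := by
  rw [← tn_zero (p := p), tn_tn]; simp
lemma cc_fract (n : ℕ) (x : ℝ) : cc p n (Int.fract x) = cc p n x := by simp [cc]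

lemma Tmap_iter (n : ℕ) {x : ℝ} (hx : Int.fract x = x) : (Tmap p)^[n] x = tn p n x := by
  induction n with
  | zero => simp [tn, hx]
  | succ n ih =>
    rw [Function.iterate_succ_apply', ih]
    have : Tmap p = tn p 1 := by ext; simp [Tmap, tn]
    rw [this, tn_tn]

lemma Tmap_iter_succ (n : ℕ) (x : ℝ) : (Tmap p)^[n+1] x = tn p (n+1) x := by
  induction n with
  | zero => simp [Tmap, tn]
  | succ n ih =>
    rw [Function.iterate_succ_apply', ih]
    have : Tmap p = tn p 1 := by ext; simp [Tmap, tn]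
    rw [this, tn_tn]

lemma tn_measurable (n : ℕ) : Measurable (tn p n) :=
  measurable_fract.comp (measurable_const_mul _)

lemma cc_measurable (n : ℕ) : Measurable (cc p n) :=
  Int.measurable_floor.comp (measurable_fract.const_mul _)

lemma cc_add_tn (n : ℕ) (x : ℝ) : (p:ℝ) ^ n * Int.fract x = cc p n x + tn p n x := by
  rw [← fract_pow_mul_fract]; exact (Int.floor_add_fract _).symm

lemma cc_nonneg (n : ℕ) (x : ℝ) : 0 ≤ cc p n x :=
  Int.floor_nonneg.2 (mul_nonneg (by positivity) (Int.fract_nonneg _))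

lemma cc_lt (hp : 2 ≤ p) (n : ℕ) (x : ℝ) : cc p n x < (p:ℤ) ^ n := by
  unfold cc
  rw [Int.floor_lt]; push_cast
  have : (0:ℝ) < (p:ℝ) ^ n := by positivity
  nlinarith [Int.fract_lt_one x]

lemma cc_add (j L : ℕ) (x : ℝ) :
    cc p (j + L) x = (p:ℤ) ^ L * cc p j x + cc p L (tn p j x) := by
  have h1 := cc_add_tn (p := p) (j + L) x
  have h2 := cc_add_tn (p := p) j x
  have h3 := cc_add_tn (p := p) L (tn p j x)
  rw [tn_tn, fract_tn] at h3
  have : ((cc p (j + L) x : ℤ) : ℝ) = (((p:ℤ) ^ L * cc p j x + cc p L (tn p j x) : ℤ) : ℝ) := by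
    push_cast
    have h4 : (p:ℝ) ^ (j + L) * Int.fract x = (p:ℝ) ^ L * ((p:ℝ) ^ j * Int.fract x) := by ring
    rw [h4, h2] at h1
    linarith
  exact_mod_cast this

lemma cc_split (hp : 2 ≤ p) {j L : ℕ} {x y : ℝ} (h : cc p (j + L) x = cc p (j + L) y) :
    cc p j x = cc p j y ∧ cc p L (tn p j x) = cc p L (tn p j y) := by
  rw [cc_add, cc_add] at h
  have h1 := cc_nonneg (p := p) L (tn p j x)
  have h2 := cc_nonneg (p := p) L (tn p j y)
  have h3 := cc_lt hp L (tn p j x)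
  have h4 := cc_lt hp L (tn p j y)
  have hP : (0:ℤ) < (p:ℤ) ^ L := by positivity
  have e : cc p j x = cc p j y := by
    rcases lt_trichotomy (cc p j x) (cc p j y) with hl | hl | hl
    · nlinarith
    · exact hl
    · nlinarith
  refine ⟨e, ?_⟩
  rw [e] at h; linarith

lemma cc_split_of_le (hp : 2 ≤ p) {n n' : ℕ} (hn : n ≤ n') {x y : ℝ}
    (h : cc p n' x = cc p n' y) : cc p n x = cc p n y := by
  obtain ⟨k, rfl⟩ := Nat.exists_eq_add_of_le hn
  exact (cc_split hp h).1

lemma cc_close (hp : 2 ≤ p) {L : ℕ} {x y : ℝ} (h : cc p L x = cc p L y) :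
    |Int.fract x - Int.fract y| ≤ ((p:ℝ) ^ L)⁻¹ := by
  have hP : (0:ℝ) < (p:ℝ) ^ L := by positivity
  have h1 := cc_add_tn (p := p) L x
  have h2 := cc_add_tn (p := p) L y
  rw [h] at h1
  have : (p:ℝ) ^ L * (Int.fract x - Int.fract y) = tn p L x - tn p L y := by linarith
  have e : Int.fract x - Int.fract y = ((p:ℝ) ^ L)⁻¹ * (tn p L x - tn p L y) := by
    rw [← this]; field_simp
  rw [e, abs_mul, abs_of_pos (by positivity)]
  have : |tn p L x - tn p L y| ≤ 1 := by
    rw [abs_le]; constructor <;>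
    linarith [tn_nonneg (p := p) L x, tn_nonneg (p := p) L y, tn_lt_one (p := p) L x, tn_lt_one (p := p) L y]
  exact mul_le_of_le_one_right (by positivity) this

lemma tn_close (hp : 2 ≤ p) {j L : ℕ} {x y : ℝ} (h : cc p (j + L) x = cc p (j + L) y) :
    |tn p j x - tn p j y| ≤ ((p:ℝ) ^ L)⁻¹ := by
  have := cc_close hp (cc_split hp h).2
  rwa [fract_tn, fract_tn] at this

variable {μ : Measure ℝ} [IsProbabilityMeasure μ]

/-- The energy of `Φ ∘ T^n` conditioned on level `n` cells. -/
noncomputable def al (μ : Measure ℝ) (p n : ℕ) (Φ : ℝ → ℂ) : ℝ :=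
  ∫ x, ‖cE μ (cc p n) (fun y => Φ (tn p n y)) x‖ ^ 2 ∂μ

lemma sq_norm_integrable {u : ℝ → ℂ} (hu : Measurable u) (hb : ∀ x, ‖u x‖ ≤ 1) :
    Integrable (fun x => ‖u x‖ ^ 2) μ := by
  apply integrable_bddR (hu.norm.pow_const 2) (C := 1)
  intro x; rw [norm_pow, norm_norm]; exact pow_le_one₀ (norm_nonneg _) (hb x)

lemma al_nonneg (n : ℕ) (Φ : ℝ → ℂ) : 0 ≤ al μ p n Φ := integral_nonneg fun x => by positivity

lemma al_le_one (n : ℕ) {Φ : ℝ → ℂ} (hΦ : Measurable Φ) (hb : ∀ x, ‖Φ x‖ ≤ 1) :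
    al μ p n Φ ≤ 1 := by
  have hu := fun x => cE_norm_le (μ := μ) (c := cc p n) zero_le_one (fun y => hb (tn p n y)) x
  calc al μ p n Φ ≤ ∫ x, (1:ℝ) ∂μ := by
        apply integral_mono (sq_norm_integrable (measurable_cE (cc_measurable n) _) hu)
          (integrable_const _)
        intro x; exact pow_le_one₀ (norm_nonneg _) (hu x)
    _ = 1 := by simp

lemma al_diff (hp : 2 ≤ p) (hT : ∀ n, MeasurePreserving (tn p n) μ μ) (k L : ℕ) {Φ : ℝ → ℂ}
    (hΦ : Measurable Φ) (hb : ∀ x, ‖Φ x‖ ≤ 1) :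
    ∫ x, ‖cE μ (cc p (k + L)) (fun y => Φ (tn p (k + L) y)) x
      - cE μ (cc p L) (fun y => Φ (tn p L y)) (tn p k x)‖ ^ 2 ∂μ = al μ p (k + L) Φ - al μ p L Φ := by
  have hm : Measurable (fun y => cc p L (tn p k y)) := (cc_measurable L).comp (tn_measurable k)
  have h1 := cE_pyth (μ := μ) (c := fun y => cc p L (tn p k y)) (c' := cc p (k + L)) hm
    (cc_measurable _) (fun x y h => (cc_split hp h).2) (Φ := fun y => Φ (tn p (k + L) y))
    (hΦ.comp (tn_measurable _)) (fun x => hb _)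
  have h2 : ∀ x, cE μ (fun y => cc p L (tn p k y)) (fun y => Φ (tn p (k + L) y)) x
      = cE μ (cc p L) (fun y => Φ (tn p L y)) (tn p k x) := by
    intro x
    have := cE_comp (μ := μ) (cc_measurable (p := p) L) (hT k) (Φ := fun y => Φ (tn p L y))
      (hΦ.comp (tn_measurable _)) x
    simp only [tn_tn] at this
    exact this
  simp only [h2] at h1
  rw [h1]
  unfold al
  congr 1
  have hmm : Measurable (fun x => ‖cE μ (cc p L) (fun y => Φ (tn p L y)) x‖ ^ 2) :=
    (measurable_cE (cc_measurable L) _).norm.pow_const 2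
  exact integral_comp_mp (hT k) hmm

lemma al_mono (hp : 2 ≤ p) (hT : ∀ n, MeasurePreserving (tn p n) μ μ) {Φ : ℝ → ℂ}
    (hΦ : Measurable Φ) (hb : ∀ x, ‖Φ x‖ ≤ 1) : Monotone (fun n => al μ p n Φ) := by
  intro L n h
  obtain ⟨k, rfl⟩ := Nat.exists_eq_add_of_le' h
  have h1 := al_diff hp hT k L hΦ hb
  have h0 : 0 ≤ ∫ x, ‖cE μ (cc p (k + L)) (fun y => Φ (tn p (k + L) y)) x
      - cE μ (cc p L) (fun y => Φ (tn p L y)) (tn p k x)‖ ^ 2 ∂μ :=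
    integral_nonneg fun x => by positivity
  simp only; linarith

/-- phase removal -/
lemma phase (hp : 2 ≤ p) (n : ℕ) (β : ℝ) (x : ℝ) :
    ‖cE μ (cc p n) (fun y => ee (β * Int.fract y)) x‖
      = ‖cE μ (cc p n) (fun y => ee (β / (p:ℝ) ^ n * tn p n y)) x‖ := by
  have hP : (0:ℝ) < (p:ℝ) ^ n := by positivity
  have h1 : (fun y => ee (β * Int.fract y)) =
      fun y => ee (β / (p:ℝ) ^ n * cc p n y) * ee (β / (p:ℝ) ^ n * tn p n y) := by
    ext y
    rw [← ee_add, ← mul_add, ← cc_add_tn]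
    congr 1; field_simp
  rw [h1, cE_pull (cc_measurable n) (k := fun y => ee (β / (p:ℝ) ^ n * cc p n y))
    (fun x y h => by simp only [h]), norm_mul, ee_norm, one_mul]

end sym


/-- covering lemma -/
lemma covering_aux (v s : ℕ → ℝ) (hv : ∀ i, 0 ≤ v i) (hs1 : ∀ i, s i ≤ 1)
    {ε : ℝ} (hε : 0 ≤ ε) (N1 : ℕ)
    (h : ∀ j, s j ≤ 0 ∨ ∃ N, 1 ≤ N ∧ N ≤ N1 ∧ ε * N ≤ ∑ i ∈ Finset.range N, v (j + i)) (J : ℕ) :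
    ∀ n j, J - j = n → ε * ∑ i ∈ Finset.Ico j J, s i ≤ ∑ i ∈ Finset.Ico j (J + N1), v i := by
  intro n
  induction n using Nat.strong_induction_on with
  | _ n ih =>
  intro j hj
  by_cases hjJ : J ≤ j
  · rw [Finset.Ico_eq_empty_of_le hjJ]; simp
    exact Finset.sum_nonneg fun i _ => hv i
  push Not at hjJ
  rcases h j with h0 | ⟨N, hN1, hN, hS⟩
  · have := ih (J - (j+1)) (by omega) (j+1) rfl
    rw [Finset.sum_eq_sum_Ico_succ_bot hjJ, Finset.sum_eq_sum_Ico_succ_bot (by omega : j < J + N1)]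
    nlinarith [hv j]
  · have h1 : ∑ i ∈ Finset.range N, v (j + i) = ∑ i ∈ Finset.Ico j (j + N), v i := by
      rw [Finset.sum_Ico_eq_sum_range]; simp
    by_cases hNJ : j + N ≤ J
    · have := ih (J - (j+N)) (by omega) (j+N) rfl
      rw [← Finset.sum_Ico_consecutive _ (by omega : j ≤ j + N) hNJ,
        ← Finset.sum_Ico_consecutive _ (by omega : j ≤ j + N) (by omega : j + N ≤ J + N1)]
      have h2 : ∑ i ∈ Finset.Ico j (j + N), s i ≤ N := by
        calc ∑ i ∈ Finset.Ico j (j + N), s i ≤ ∑ i ∈ Finset.Ico j (j + N), (1:ℝ) :=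
              Finset.sum_le_sum fun i _ => hs1 i
          _ = N := by simp
      rw [h1] at hS
      nlinarith
    · push Not at hNJ
      rw [← Finset.sum_Ico_consecutive _ (by omega : j ≤ j + N) (by omega : j + N ≤ J + N1)]
      have h2 : ∑ i ∈ Finset.Ico j J, s i ≤ N := by
        calc ∑ i ∈ Finset.Ico j J, s i ≤ ∑ i ∈ Finset.Ico j J, (1:ℝ) :=
              Finset.sum_le_sum fun i _ => hs1 i
          _ = ((J - j : ℕ) : ℝ) := by simp
          _ ≤ N := by exact_mod_cast (by omega)
      have h3 : 0 ≤ ∑ i ∈ Finset.Ico (j+N) (J + N1), v i := Finset.sum_nonneg fun i _ => hv i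
      rw [h1] at hS
      nlinarith

lemma covering (v s : ℕ → ℝ) (hv : ∀ i, 0 ≤ v i) (hs1 : ∀ i, s i ≤ 1)
    {ε : ℝ} (hε : 0 ≤ ε) (N1 : ℕ)
    (h : ∀ j, s j ≤ 0 ∨ ∃ N, 1 ≤ N ∧ N ≤ N1 ∧ ε * N ≤ ∑ i ∈ Finset.range N, v (j + i)) (J : ℕ) :
    ε * ∑ i ∈ Finset.range J, s i ≤ ∑ i ∈ Finset.range (J + N1), v i := by
  have := covering_aux v s hv hs1 hε N1 h J J 0 (by simp)
  simpa [Nat.Ico_zero_eq_range] using this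

section birkhoff
variable {μ : Measure ℝ} [IsProbabilityMeasure μ] {T : ℝ → ℝ}

/-- maximal-type inequality -/
lemma maximal_ineq (hT : MeasurePreserving T μ μ) {g : ℝ → ℝ} (hg : Measurable g) {C : ℝ}
    (h0 : ∀ x, 0 ≤ g x) (h1 : ∀ x, g x ≤ C) {c : ℝ} (hc : 0 ≤ c)
    (hfull : ∀ᵐ x ∂μ, ∃ N : ℕ, 1 ≤ N ∧ c * N ≤ ∑ i ∈ Finset.range N, g (T^[i] x)) :
    c ≤ ∫ x, g x ∂μ := by
  set I := ∫ x, g x ∂μ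
  have hI0 : 0 ≤ I := integral_nonneg h0
  let S : ℕ → Set ℝ := fun N1 => ⋃ N ∈ Finset.Icc 1 N1, {x | c * N ≤ ∑ i ∈ Finset.range N, g (T^[i] x)}
  have hgm : ∀ i, Measurable (fun x => g (T^[i] x)) := fun i => hg.comp (hT.measurable.iterate i)
  have hSm : ∀ N1, MeasurableSet (S N1) := by
    intro N1
    refine Finset.measurableSet_biUnion _ fun N _ => ?_
    exact measurableSet_le measurable_const (Finset.measurable_sum _ fun i _ => hgm i)
  have hmono : Monotone S := by
    intro a b hab
    refine biUnion_subset_biUnion_left ?_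
    intro N hN
    simp only [Finset.mem_coe, Finset.mem_Icc, SetLike.mem_coe] at hN ⊢
    exact ⟨hN.1, hN.2.trans hab⟩
  have key : ∀ N1, c * μ.real (S N1) ≤ I := by
    intro N1
    have hJ : ∀ J : ℕ, c * (J * μ.real (S N1)) ≤ (J + N1) * I := by
      intro J
      have hpt : ∀ x, c * ∑ i ∈ Finset.range J, (S N1).indicator (fun _ => (1:ℝ)) (T^[i] x)
          ≤ ∑ i ∈ Finset.range (J + N1), g (T^[i] x) := by
        intro x
        refine covering (fun i => g (T^[i] x)) _ (fun i => h0 _) ?_ hc N1 ?_ J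
        · intro i; by_cases h : T^[i] x ∈ S N1 <;> simp [h]
        · intro j
          by_cases hj : T^[j] x ∈ S N1
          · right
            simp only [S, mem_iUnion, Finset.mem_Icc, mem_ofPred_eq] at hj
            obtain ⟨N, hN, hN'⟩ := hj
            refine ⟨N, hN.1, hN.2, hN'.trans (le_of_eq ?_)⟩
            apply Finset.sum_congr rfl; intro i _
            rw [← Function.iterate_add_apply, add_comm i j]
          · left; simp [hj]
      have hintg : ∀ i, Integrable (fun x => g (T^[i] x)) μ := fun i =>
        integrable_bddR (hgm i) (C := C) (fun x => by rw [Real.norm_of_nonneg (h0 _)]; exact h1 _)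
      have hSi : Measurable ((S N1).indicator (fun _ => (1:ℝ))) := measurable_const.indicator (hSm N1)
      have hintE : ∀ i, Integrable (fun x => (S N1).indicator (fun _ => (1:ℝ)) (T^[i] x)) μ := fun i =>
        integrable_bddR (hSi.comp (hT.measurable.iterate i)) (C := 1) (fun x => by
          by_cases h : T^[i] x ∈ S N1 <;> simp [h])
      have hmi := integral_mono ((integrable_finsetSum _ fun i _ => hintE i).const_mul c)
        (integrable_finsetSum _ fun i _ => hintg i) hpt
      rw [integral_const_mul, integral_finsetSum _ (fun i _ => hintE i),
        integral_finsetSum _ (fun i _ => hintg i)] at hmi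
      have e1 : ∀ i, ∫ x, (S N1).indicator (fun _ => (1:ℝ)) (T^[i] x) ∂μ = μ.real (S N1) := by
        intro i
        rw [integral_comp_mp (hT.iterate i) hSi, integral_indicator (hSm N1)]; simp
      have e2 : ∀ i, ∫ x, g (T^[i] x) ∂μ = I := fun i => integral_comp_mp (hT.iterate i) hg
      simp only [e1, e2, Finset.sum_const, Finset.card_range, nsmul_eq_mul] at hmi
      push_cast at hmi; exact hmi
    by_contra hlt
    push Not at hlt
    obtain ⟨J, hJ'⟩ := exists_nat_gt (N1 * I / (c * μ.real (S N1) - I))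
    rw [div_lt_iff₀ (by linarith)] at hJ'
    nlinarith [hJ J]
  have htend := tendsto_measure_iUnion_atTop (μ := μ) hmono
  have hU : μ (⋃ n, S n) = 1 := by
    rw [prob_compl_eq_zero_iff (MeasurableSet.iUnion hSm) |>.symm]
    have : ∀ᵐ x ∂μ, x ∈ ⋃ n, S n := by
      filter_upwards [hfull] with x ⟨N, hN, hx⟩
      simp only [S, mem_iUnion, Finset.mem_Icc, mem_ofPred_eq]
      exact ⟨N, N, ⟨hN, le_rfl⟩, hx⟩
    exact this
  rw [hU] at htend
  have htr : Tendsto (fun n => μ.real (S n)) atTop (𝓝 1) := by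
    have := (ENNReal.tendsto_toReal ENNReal.one_ne_top).comp htend
    simpa [Measure.real, Function.comp_def] using this
  have := htr.const_mul c
  rw [mul_one] at this
  exact le_of_tendsto' this key

lemma birkhoff_upper (hT : Ergodic T μ) {g : ℝ → ℝ} (hg : Measurable g)
    (h0 : ∀ x, 0 ≤ g x) (h1 : ∀ x, g x ≤ 1) {c : ℝ} (hc : ∫ x, g x ∂μ < c) :
    ∀ᵐ x ∂μ, ∀ᶠ N : ℕ in atTop, ∑ i ∈ Finset.range N, g (T^[i] x) ≤ c * N := by
  have hTm := hT.toMeasurePreserving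
  have hgm : ∀ i, Measurable (fun x => g (T^[i] x)) := fun i => hg.comp (hTm.measurable.iterate i)
  set Sg : ℕ → ℝ → ℝ := fun N x => ∑ i ∈ Finset.range N, g (T^[i] x) with hSg
  have hSgT : ∀ N x, |Sg N (T x) - Sg N x| ≤ 1 := by
    intro N x
    have e : Sg N (T x) - Sg N x = g (T^[N] x) - g x := by
      have a1 : ∑ i ∈ Finset.range (N+1), g (T^[i] x) = Sg N x + g (T^[N] x) :=
        Finset.sum_range_succ _ _
      have a2 : ∑ i ∈ Finset.range (N+1), g (T^[i] x) = Sg N (T x) + g x := by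
        rw [Finset.sum_range_succ']; rfl
      linarith
    rw [e, abs_le]; constructor <;> linarith [h0 x, h1 x, h0 (T^[N] x), h1 (T^[N] x)]
  let E : Set ℝ := {x | ∀ k : ℕ, ∀ n : ℕ, ∃ N, n ≤ N ∧ (c - 1 / ((k:ℝ)+1)) * N < Sg N x}
  have hEm : MeasurableSet E := by
    have : E = ⋂ k : ℕ, ⋂ n : ℕ, ⋃ N : ℕ, ⋃ _ : n ≤ N, {x | (c - 1 / ((k:ℝ)+1)) * N < Sg N x} := by
      ext x; simp [E]
    rw [this]
    refine MeasurableSet.iInter fun k => MeasurableSet.iInter fun n => MeasurableSet.iUnion fun N =>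
      MeasurableSet.iUnion fun _ => ?_
    exact measurableSet_lt measurable_const (Finset.measurable_sum _ fun i _ => hgm i)
  have hslack : ∀ x y : ℝ, (∀ N, Sg N x ≤ Sg N y + 1) → x ∈ E → y ∈ E := by
    intro x y hxy hx k n
    have hk : (0:ℝ) < 1 / ((k:ℝ)+1) - 1 / ((k:ℝ)+2) := by
      rw [sub_pos]; apply one_div_lt_one_div_of_lt <;> [positivity; linarith]
    obtain ⟨M, hM⟩ := exists_nat_gt (1 / (1 / ((k:ℝ)+1) - 1 / ((k:ℝ)+2)))
    obtain ⟨N, hN, hlt⟩ := hx (k+1) (max n M)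
    refine ⟨N, (le_max_left _ _).trans hN, ?_⟩
    have hNM : (M:ℝ) ≤ N := by exact_mod_cast (le_max_right _ _).trans hN
    rw [div_lt_iff₀ hk] at hM
    have e : ((k+1 : ℕ) : ℝ) + 1 = (k:ℝ) + 2 := by push_cast; ring
    rw [e] at hlt
    nlinarith [hxy N]
  have hEinv : T ⁻¹' E = E := by
    ext x
    constructor
    · exact hslack (T x) x fun N => by linarith [(abs_le.1 (hSgT N x)).2]
    · exact hslack x (T x) fun N => by linarith [(abs_le.1 (hSgT N x)).1]
  have hE0 : μ E = 0 := by
    rcases hT.toPreErgodic.prob_eq_zero_or_one hEm hEinv with h | h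
    · exact h
    exfalso
    have hae : ∀ᵐ x ∂μ, x ∈ E := by
      rw [← prob_compl_eq_zero_iff hEm] at h; exact h
    obtain ⟨k, hk⟩ := exists_nat_one_div_lt (sub_pos.2 hc)
    have hI0 : 0 ≤ ∫ x, g x ∂μ := integral_nonneg h0
    have : c - 1 / ((k:ℝ) + 1) ≤ ∫ x, g x ∂μ := by
      refine maximal_ineq hTm hg h0 h1 (by linarith) ?_
      filter_upwards [hae] with x hx
      obtain ⟨N, hN, hlt⟩ := hx k 1
      exact ⟨N, hN, hlt.le⟩
    linarith
  have hae : ∀ᵐ x ∂μ, x ∉ E := measure_eq_zero_iff_ae_notMem.1 hE0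
  filter_upwards [hae] with x hx
  simp only [E, mem_ofPred_eq] at hx
  push Not at hx
  obtain ⟨k, n, hx⟩ := hx
  filter_upwards [eventually_ge_atTop n] with N hN
  have := hx N hN
  have hk : 0 ≤ 1 / ((k:ℝ)+1) := by positivity
  have hN0 : (0:ℝ) ≤ N := by positivity
  show Sg N x ≤ c * N
  nlinarith

lemma birkhoff01 (hT : Ergodic T μ) {g : ℝ → ℝ} (hg : Measurable g)
    (h0 : ∀ x, 0 ≤ g x) (h1 : ∀ x, g x ≤ 1) :
    ∀ᵐ x ∂μ, Tendsto (fun N : ℕ => (1 / N : ℝ) * ∑ i ∈ Finset.range N, g (T^[i] x)) atTop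
      (𝓝 (∫ x, g x ∂μ)) := by
  have hgi : Integrable g μ := integrable_bddR hg (C := 1)
    (fun x => by rw [Real.norm_of_nonneg (h0 _)]; exact h1 _)
  have hu : ∀ᵐ x ∂μ, ∀ k : ℕ, ∀ᶠ N : ℕ in atTop,
      ∑ i ∈ Finset.range N, g (T^[i] x) ≤ (∫ x, g x ∂μ + 1 / ((k:ℝ)+1)) * N := by
    rw [ae_all_iff]; intro k
    exact birkhoff_upper hT hg h0 h1 (by have : 0 < 1 / ((k:ℝ)+1) := by positivity
                                         linarith)
  have hl : ∀ᵐ x ∂μ, ∀ k : ℕ, ∀ᶠ N : ℕ in atTop,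
      ∑ i ∈ Finset.range N, (1 - g (T^[i] x)) ≤ (∫ x, (1 - g x) ∂μ + 1 / ((k:ℝ)+1)) * N := by
    rw [ae_all_iff]; intro k
    exact birkhoff_upper hT (g := fun x => 1 - g x) (measurable_const.sub hg) (fun x => by linarith [h1 x])
      (fun x => by linarith [h0 x]) (by have : 0 < 1 / ((k:ℝ)+1) := by positivity
                                        linarith)
  rw [integral_sub (integrable_const _) hgi] at hl
  simp only [integral_const, probReal_univ, smul_eq_mul, mul_one, one_mul] at hl
  filter_upwards [hu, hl] with x hxu hxl
  rw [Metric.tendsto_atTop']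
  intro ε hε
  obtain ⟨k, hk⟩ := exists_nat_one_div_lt hε
  obtain ⟨M, hM⟩ := eventually_atTop.1 ((hxu k).and (hxl k))
  refine ⟨max M 1, fun N hN => ?_⟩
  have hN0 : (0:ℝ) < N := by
    have : 1 < N := (le_max_right M 1).trans_lt hN
    exact_mod_cast (by omega)
  obtain ⟨a1, a2⟩ := hM N ((le_max_left _ _).trans hN.le)
  rw [Finset.sum_sub_distrib] at a2
  simp only [Finset.sum_const, Finset.card_range, nsmul_eq_mul, mul_one] at a2
  rw [Real.dist_eq, abs_lt]
  set I := ∫ x, g x ∂μ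
  set Sx := ∑ i ∈ Finset.range N, g (T^[i] x)
  have e : 1 / (N:ℝ) * Sx - I = (Sx - I * N) / N := by field_simp
  rw [e, lt_div_iff₀ hN0, div_lt_iff₀ hN0]
  constructor <;> nlinarith

end birkhoff


section stepD

/-- measure of the level `n` cell of `x` -/
noncomputable def mc (μ : Measure ℝ) (p n : ℕ) (x : ℝ) : ℝ := μ.real (cc p n ⁻¹' {cc p n x})
/-- conditional probability of the next digit -/
noncomputable def Jf (μ : Measure ℝ) (p n : ℕ) (x : ℝ) : ℝ := mc μ p (n+1) x / mc μ p n x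
/-- indicator of first digit `d` -/
noncomputable def Pd (p d : ℕ) (y : ℝ) : ℂ := if cc p 1 y = d then 1 else 0
/-- conditional probability that the next digit is `d` -/
noncomputable def ud (μ : Measure ℝ) (p n d : ℕ) (x : ℝ) : ℂ :=
  cE μ (cc p n) (fun y => Pd p d (tn p n y)) x

variable {p : ℕ} {μ : Measure ℝ} [IsProbabilityMeasure μ]

lemma Pd_measurable (d : ℕ) : Measurable (Pd p d) := by
  unfold Pd
  exact Measurable.ite (cc_measurable 1 (measurableSet_singleton _)) measurable_const measurable_const

lemma Pd_norm_le (d : ℕ) (y : ℝ) : ‖Pd p d y‖ ≤ 1 := by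
  unfold Pd; split_ifs <;> simp

lemma ud_norm_le (n d : ℕ) (x : ℝ) : ‖ud μ p n d x‖ ≤ 1 :=
  cE_norm_le zero_le_one (fun y => Pd_norm_le d _) x

lemma ud_measurable (n d : ℕ) : Measurable (ud μ p n d) := measurable_cE (cc_measurable n) _

lemma ud_eq (n d : ℕ) (x : ℝ) : ud μ p n d x =
    ((μ.real ((cc p n ⁻¹' {cc p n x}) ∩ {y | cc p 1 (tn p n y) = d}) / mc μ p n x : ℝ) : ℂ) := by
  have hm : MeasurableSet {y | cc p 1 (tn p n y) = d} :=
    ((cc_measurable 1).comp (tn_measurable n)) (measurableSet_singleton _)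
  unfold ud cE mc
  have : (fun y => Pd p d (tn p n y)) = {y | cc p 1 (tn p n y) = d}.indicator (fun _ => (1:ℂ)) := by
    ext y; by_cases h : cc p 1 (tn p n y) = d <;> simp [Pd, h]
  rw [this, integral_indicator hm, Measure.restrict_restrict hm, setIntegral_const, inter_comm]
  simp; ring

lemma cc_succ_iff (hp : 2 ≤ p) (n : ℕ) (x y : ℝ) : cc p (n+1) y = cc p (n+1) x ↔
    cc p n y = cc p n x ∧ cc p 1 (tn p n y) = cc p 1 (tn p n x) := by
  constructor
  · intro h; exact cc_split hp h
  · rintro ⟨h1, h2⟩; rw [cc_add, cc_add, h1, h2]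

lemma Jf_eq (hp : 2 ≤ p) (n : ℕ) (x : ℝ) :
    ((Jf μ p n x : ℝ) : ℂ) = ∑ d ∈ Finset.range p, Pd p d (tn p n x) * ud μ p n d x := by
  have h1 := cc_nonneg (p := p) 1 (tn p n x)
  have h2 := cc_lt hp 1 (tn p n x)
  set d0 := (cc p 1 (tn p n x)).toNat with hd0
  have hd : cc p 1 (tn p n x) = d0 := (Int.toNat_of_nonneg h1).symm
  have hlt : d0 < p := by zify; rw [← hd]; simpa using h2
  rw [Finset.sum_eq_single_of_mem d0 (Finset.mem_range.2 hlt)]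
  · rw [ud_eq]
    simp only [Pd, hd, if_true, one_mul]
    unfold Jf
    congr 2
    unfold mc
    congr 1
    ext y
    simp only [mem_preimage, mem_singleton_iff, mem_inter_iff, mem_ofPred_eq]
    rw [cc_succ_iff hp, hd]
  · intro d _ hne
    simp only [Pd, hd]
    rw [if_neg, zero_mul]
    intro h; exact hne (by exact_mod_cast h.symm)

lemma mc_nonneg (n : ℕ) (x : ℝ) : 0 ≤ mc μ p n x := measureReal_nonneg

lemma mc_congr {n : ℕ} {x y : ℝ} (h : cc p n x = cc p n y) : mc μ p n x = mc μ p n y := by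
  unfold mc; rw [h]

lemma mc_mono (hp : 2 ≤ p) (n : ℕ) (x : ℝ) : mc μ p (n+1) x ≤ mc μ p n x := by
  apply measureReal_mono _ (measure_ne_top _ _)
  intro y hy
  exact (cc_split hp hy).1

lemma mc_zero (x : ℝ) : mc μ p 0 x = 1 := by
  unfold mc
  have : (cc p 0 ⁻¹' {cc p 0 x}) = univ := by
    ext y; simp [cc]
  rw [this]; simp

lemma Jf_nonneg (n : ℕ) (x : ℝ) : 0 ≤ Jf μ p n x := div_nonneg (mc_nonneg _ _) (mc_nonneg _ _)

lemma Jf_le_one (hp : 2 ≤ p) (n : ℕ) (x : ℝ) : Jf μ p n x ≤ 1 :=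
  div_le_one_of_le₀ (mc_mono hp n x) (mc_nonneg _ _)

lemma Jf_congr (hp : 2 ≤ p) {n : ℕ} {x y : ℝ} (h : cc p (n+1) x = cc p (n+1) y) :
    Jf μ p n x = Jf μ p n y := by
  unfold Jf; rw [mc_congr h, mc_congr (cc_split hp h).1]

/-- functions of the cell are measurable and bounded -/
lemma cell_fun {α : Type*} [NormedAddCommGroup α] [MeasurableSpace α] (hp : 2 ≤ p) {n : ℕ} {k : ℝ → α}
    (hk : ∀ x y, cc p n x = cc p n y → k x = k y) :
    Measurable k ∧ ∃ D, ∀ x, ‖k x‖ ≤ D := by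
  obtain ⟨g, hg⟩ := factor_of_const hk
  constructor
  · have : k = g ∘ cc p n := funext hg
    rw [this]; exact (measurable_of_countable g).comp (cc_measurable n)
  · refine ⟨∑ w ∈ Finset.Ico (0:ℤ) ((p:ℤ)^n), ‖g w‖, fun x => ?_⟩
    rw [hg]
    exact Finset.single_le_sum (f := fun w => ‖g w‖) (fun _ _ => norm_nonneg _)
      (Finset.mem_Ico.2 ⟨cc_nonneg n x, cc_lt hp n x⟩)

lemma cell_integrable (hp : 2 ≤ p) {n : ℕ} {k : ℝ → ℝ}
    (hk : ∀ x y, cc p n x = cc p n y → k x = k y) : Integrable k μ := by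
  obtain ⟨h1, D, h2⟩ := cell_fun hp hk
  exact integrable_bddR h1 h2

lemma Jf_measurable (hp : 2 ≤ p) (n : ℕ) : Measurable (Jf μ p n) :=
  (cell_fun hp (fun _ _ h => Jf_congr hp h)).1

lemma Jf_integrable (hp : 2 ≤ p) (n : ℕ) : Integrable (Jf μ p n) μ :=
  cell_integrable hp (fun _ _ h => Jf_congr hp h)

lemma ud_conj (n d : ℕ) (x : ℝ) : (starRingEnd ℂ) (ud μ p n d x) = ud μ p n d x := by
  rw [ud_eq, Complex.conj_ofReal]

lemma Jf_integral (hp : 2 ≤ p) (n : ℕ) :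
    ∫ x, Jf μ p n x ∂μ = ∑ d ∈ Finset.range p, al μ p n (Pd p d) := by
  have h : ((∫ x, Jf μ p n x ∂μ : ℝ) : ℂ) = ((∑ d ∈ Finset.range p, al μ p n (Pd p d) : ℝ) : ℂ) := by
    rw [← integral_complex_ofReal]
    simp_rw [Jf_eq hp]
    have hi : ∀ d, Integrable (fun x => Pd p d (tn p n x) * ud μ p n d x) μ := by
      intro d
      apply integrable_bdd (((Pd_measurable d).comp (tn_measurable n)).mul (ud_measurable n d)) (C := 1 * 1)
      intro x; simp only [Pi.mul_apply, norm_mul]; gcongr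
      · exact Pd_norm_le d _
      · exact ud_norm_le n d x
    rw [integral_finsetSum _ (fun d _ => hi d)]
    push_cast
    apply Finset.sum_congr rfl
    intro d _
    have e1 : ∫ x, Pd p d (tn p n x) * ud μ p n d x ∂μ = ∫ x, ud μ p n d x * Pd p d (tn p n x) ∂μ := by
      congr 1; ext x; ring
    rw [e1, ← cE_orth (Φ := fun x => Pd p d (tn p n x)) (c := cc p n) (cc_measurable n) ((Pd_measurable d).comp (tn_measurable n)) zero_le_one
      (fun x => Pd_norm_le d _) (k := ud μ p n d) (fun x y h => cE_congr h) (D := 1) (ud_norm_le n d)]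
    unfold al
    rw [← integral_complex_ofReal]
    congr 1; ext x
    have : (ud μ p n d x) * (ud μ p n d x) = ((‖ud μ p n d x‖ ^ 2 : ℝ) : ℂ) := by
      rw [← Complex.normSq_eq_norm_sq, Complex.normSq_eq_conj_mul_self, ud_conj]
    exact this
  exact_mod_cast h

lemma Jf_integral_mono (hp : 2 ≤ p) (hT : ∀ n, MeasurePreserving (tn p n) μ μ) :
    Monotone (fun n => ∫ x, Jf μ p n x ∂μ) := by
  intro a b hab
  simp only [Jf_integral hp]
  exact Finset.sum_le_sum fun d _ => al_mono hp hT (Pd_measurable d) (Pd_norm_le d) hab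

lemma Jf_integral_le_one (hp : 2 ≤ p) (n : ℕ) : ∫ x, Jf μ p n x ∂μ ≤ 1 := by
  calc ∫ x, Jf μ p n x ∂μ ≤ ∫ x, (1:ℝ) ∂μ :=
        integral_mono (Jf_integrable hp n) (integrable_const _) (fun x => Jf_le_one hp n x)
    _ = 1 := by simp

lemma Jf_inv_eq (hp : 2 ≤ p) (n : ℕ) (x : ℝ) :
    (((Jf μ p n x)⁻¹ : ℝ) : ℂ) = ∑ d ∈ Finset.range p, Pd p d (tn p n x) * (ud μ p n d x)⁻¹ := by
  have h := Jf_eq (μ := μ) hp n x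
  have h1 := cc_nonneg (p := p) 1 (tn p n x)
  have h2 := cc_lt hp 1 (tn p n x)
  set d0 := (cc p 1 (tn p n x)).toNat with hd0
  have hd : cc p 1 (tn p n x) = d0 := (Int.toNat_of_nonneg h1).symm
  have hlt : d0 < p := by zify; rw [← hd]; simpa using h2
  have hz : ∀ d ∈ Finset.range p, d ≠ d0 → Pd p d (tn p n x) = 0 := by
    intro d _ hne
    simp only [Pd, hd]
    rw [if_neg]
    intro h; exact hne (by exact_mod_cast h.symm)
  have h1' : Pd p d0 (tn p n x) = 1 := by simp [Pd, hd]
  rw [Finset.sum_eq_single_of_mem d0 (Finset.mem_range.2 hlt) (fun d hd hne => by rw [hz d hd hne, zero_mul])]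
    at h ⊢
  rw [h1', one_mul] at h ⊢
  push_cast; rw [h]

lemma Jf_inv_integral (hp : 2 ≤ p) (n : ℕ) : ∫ x, (Jf μ p n x)⁻¹ ∂μ ≤ p := by
  have hk : ∀ d x y, cc p n x = cc p n y → (ud μ p n d x)⁻¹ = (ud μ p n d y)⁻¹ := by
    intro d x y h
    have : ud μ p n d x = ud μ p n d y := cE_congr h
    rw [this]
  have h : ((∫ x, (Jf μ p n x)⁻¹ ∂μ : ℝ) : ℂ) = ∑ d ∈ Finset.range p,
      ∫ x, (ud μ p n d x)⁻¹ * ud μ p n d x ∂μ := by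
    rw [← integral_complex_ofReal]
    simp_rw [Jf_inv_eq hp]
    rw [integral_finsetSum]
    · apply Finset.sum_congr rfl
      intro d _
      obtain ⟨hm, D, hD⟩ := cell_fun hp (hk d)
      have e1 : ∫ x, Pd p d (tn p n x) * (ud μ p n d x)⁻¹ ∂μ
          = ∫ x, (ud μ p n d x)⁻¹ * Pd p d (tn p n x) ∂μ := by
        congr 1; ext x; ring
      rw [e1, ← cE_orth (Φ := fun x => Pd p d (tn p n x)) (c := cc p n) (cc_measurable n) ((Pd_measurable d).comp (tn_measurable n)) zero_le_one
        (fun x => Pd_norm_le d _) (k := fun x => (ud μ p n d x)⁻¹) (hk d) (D := D) hD]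
      rfl
    · intro d _
      obtain ⟨hm, D, hD⟩ := cell_fun hp (hk d)
      apply integrable_bdd (((Pd_measurable d).comp (tn_measurable n)).mul hm) (C := 1 * D)
      intro x; simp only [Pi.mul_apply, norm_mul]; gcongr
      · exact Pd_norm_le d _
      · exact hD x
  have hn : ‖((∫ x, (Jf μ p n x)⁻¹ ∂μ : ℝ) : ℂ)‖ ≤ p := by
    rw [h]
    calc _ ≤ ∑ d ∈ Finset.range p, ‖∫ x, (ud μ p n d x)⁻¹ * ud μ p n d x ∂μ‖ := norm_sum_le _ _
      _ ≤ ∑ d ∈ Finset.range p, (1:ℝ) := by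
        apply Finset.sum_le_sum; intro d _
        have := norm_integral_le_of_norm_le_const (μ := μ) (C := 1)
          (f := fun x => (ud μ p n d x)⁻¹ * ud μ p n d x) (Eventually.of_forall fun x => by
          by_cases h0 : ud μ p n d x = 0
          · simp [h0]
          · rw [inv_mul_cancel₀ h0]; simp)
        simpa using this
      _ = p := by simp
  rw [Complex.norm_real] at hn
  exact (le_abs_self _).trans hn

lemma neg_log_le {J l : ℝ} (hJ : 0 < J) (hJ1 : J ≤ 1) (hl : 0 < l) (hl1 : l ≤ 1) :
    - Real.log J ≤ l * J⁻¹ + (1 - J) / l := by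
  rcases le_or_gt l J with h | h
  · have h1 : - Real.log J ≤ J⁻¹ - 1 := by
      rw [← Real.log_inv]; exact Real.log_le_sub_one_of_pos (by positivity)
    have h2 : J⁻¹ - 1 ≤ (1 - J) / l := by
      have : J⁻¹ - 1 = (1 - J) / J := by field_simp
      rw [this]
      gcongr
    have : 0 ≤ l * J⁻¹ := by positivity
    linarith
  · have h1 : Real.log (l / J) ≤ l / J - 1 := Real.log_le_sub_one_of_pos (by positivity)
    have h2 : Real.log l⁻¹ ≤ l⁻¹ - 1 := Real.log_le_sub_one_of_pos (by positivity)
    rw [Real.log_div hl.ne' hJ.ne'] at h1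
    rw [Real.log_inv] at h2
    have h3 : (1 - J) / l = l⁻¹ - J / l := by field_simp
    have h4 : J / l ≤ 1 := by rw [div_le_one hl]; exact h.le
    have h5 : l / J = l * J⁻¹ := rfl
    rw [h3, ← h5]; linarith

lemma ae_mc_pos : ∀ᵐ x ∂μ, ∀ n, 0 < mc μ p n x := by
  rw [ae_all_iff]; intro n; exact ae_cell_pos (cc_measurable n)

lemma log_mc_integrable (hp : 2 ≤ p) (n : ℕ) : Integrable (fun x => - Real.log (mc μ p n x)) μ :=
  cell_integrable hp (n := n) fun x y h => by rw [mc_congr h]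

lemma log_mc_integral_le (hp : 2 ≤ p) {l : ℝ} (hl : 0 < l) (hl1 : l ≤ 1) (n : ℕ) :
    ∫ x, - Real.log (mc μ p n x) ∂μ
      ≤ ∑ j ∈ Finset.range n, (l * p + (1 - ∫ x, Jf μ p j x ∂μ) / l) := by
  have hinv : ∀ j, Integrable (fun x => (Jf μ p j x)⁻¹) μ := fun j =>
    cell_integrable hp (n := j+1) fun x y h => by rw [Jf_congr hp h]
  have hterm : ∀ j, Integrable (fun x => l * (Jf μ p j x)⁻¹ + (1 - Jf μ p j x) / l) μ := fun j =>
    ((hinv j).const_mul l).add (((integrable_const _).sub (Jf_integrable hp j)).div_const l)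
  calc ∫ x, - Real.log (mc μ p n x) ∂μ
      ≤ ∫ x, ∑ j ∈ Finset.range n, (l * (Jf μ p j x)⁻¹ + (1 - Jf μ p j x) / l) ∂μ := by
        apply integral_mono_ae (log_mc_integrable hp n) (integrable_finsetSum _ fun j _ => hterm j)
        filter_upwards [ae_mc_pos (μ := μ) (p := p)] with x hx
        induction n with
        | zero => simp [mc_zero]
        | succ n ih =>
          rw [Finset.sum_range_succ]
          have hJ : 0 < Jf μ p n x := div_pos (hx _) (hx _)
          have e : mc μ p (n+1) x = mc μ p n x * Jf μ p n x := by
            unfold Jf; field_simp [(hx n).ne']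
          have := neg_log_le hJ (Jf_le_one hp n x) hl hl1
          rw [e, Real.log_mul (hx n).ne' hJ.ne']
          linarith
    _ = ∑ j ∈ Finset.range n, (l * ∫ x, (Jf μ p j x)⁻¹ ∂μ + (1 - ∫ x, Jf μ p j x ∂μ) / l) := by
        rw [integral_finsetSum _ fun j _ => hterm j]
        apply Finset.sum_congr rfl; intro j _
        have hs : Integrable (fun x => (1 - Jf μ p j x) / l) μ :=
          ((integrable_const _).sub (Jf_integrable hp j)).div_const l
        rw [integral_add ((hinv j).const_mul l) hs, integral_const_mul,
          integral_div, integral_sub (integrable_const _) (Jf_integrable hp j)]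
        simp
    _ ≤ _ := by
        apply Finset.sum_le_sum; intro j _
        gcongr
        exact Jf_inv_integral hp j

lemma cells_real_sum_le (n : ℕ) (W : Finset ℤ) : ∑ w ∈ W, μ.real (cc p n ⁻¹' {w}) ≤ 1 := by
  rw [← measureReal_biUnion_finset]
  · exact measureReal_le_one
  · intro a _ b _ hab
    simp only [Function.onFun]
    rw [Set.disjoint_left]
    rintro x hx hx'
    exact hab (hx.symm.trans hx')
  · intro w _; exact cc_measurable n (measurableSet_singleton w)

/-- a set covered by few cells at infinitely many scales has dimension zero -/
lemma dimH_zero (hp : 2 ≤ p) {A : Set ℝ} {n : ℕ → ℕ} (hn : Tendsto n atTop atTop) {s : ℕ → ℝ}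
    (hs : Tendsto s atTop (𝓝 0)) (hA : A ⊆ Ico 0 1)
    (hAk : ∀ k, ∀ x ∈ A, Real.exp (-(s k * n k)) ≤ mc μ p (n k) x) : dimH A = 0 := by
  have hp1 : (1:ℝ) < p := by exact_mod_cast hp
  have hlog : 0 < Real.log p := Real.log_pos hp1
  suffices h : ∀ d : NNReal, 0 < d → dimH A ≤ d by
    apply le_antisymm _ bot_le
    apply ENNReal.le_of_forall_pos_le_add
    intro ε hε _
    simpa using h ε hε
  intro d hd
  apply dimH_le_of_hausdorffMeasure_ne_top
  let W : ℕ → Finset ℤ := fun k => (Finset.Ico (0:ℤ) ((p:ℤ)^(n k))).filter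
    (fun w => Real.exp (-(s k * n k)) ≤ μ.real (cc p (n k) ⁻¹' {w}))
  have hWcard : ∀ k, ((W k).card : ℝ) ≤ Real.exp (s k * n k) := by
    intro k
    have h1 : ((W k).card : ℝ) * Real.exp (-(s k * n k)) ≤ 1 := by
      calc ((W k).card : ℝ) * Real.exp (-(s k * n k)) = ∑ w ∈ W k, Real.exp (-(s k * n k)) := by simp
        _ ≤ ∑ w ∈ W k, μ.real (cc p (n k) ⁻¹' {w}) :=
          Finset.sum_le_sum fun w hw => (Finset.mem_filter.1 hw).2
        _ ≤ 1 := cells_real_sum_le _ _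
    rw [Real.exp_neg] at h1
    have := Real.exp_pos (s k * n k)
    rwa [← div_eq_mul_inv, div_le_one this] at h1
  let t : ∀ k, (W k) → Set ℝ := fun k w => cc p (n k) ⁻¹' {w.1} ∩ Ico 0 1
  have hdiam : ∀ k w, Metric.ediam (t k w) ≤ ENNReal.ofReal (((p:ℝ) ^ (n k))⁻¹) := by
    intro k w
    apply Metric.ediam_le
    intro x hx y hy
    rw [edist_dist, Real.dist_eq]
    apply ENNReal.ofReal_le_ofReal
    have := cc_close hp (L := n k) (x := x) (y := y) (hx.1.trans hy.1.symm)
    rwa [Int.fract_eq_self.2 ⟨hx.2.1, hx.2.2⟩, Int.fract_eq_self.2 ⟨hy.2.1, hy.2.2⟩] at this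
  have hr : Tendsto (fun k => ENNReal.ofReal (((p:ℝ) ^ (n k))⁻¹)) atTop (𝓝 0) := by
    have h1 : Tendsto (fun k => ((p:ℝ) ^ (n k))⁻¹) atTop (𝓝 0) :=
      ((tendsto_pow_atTop_atTop_of_one_lt hp1).comp hn).inv_tendsto_atTop
    have := (ENNReal.continuous_ofReal.tendsto 0).comp h1
    rw [ENNReal.ofReal_zero] at this
    exact this
  have hH := Measure.hausdorffMeasure_le_liminf_sum (d:ℝ) A (l := atTop) _ hr t
    (Eventually.of_forall hdiam) (Eventually.of_forall fun k x hx => by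
      rw [mem_iUnion]
      refine ⟨⟨cc p (n k) x, ?_⟩, rfl, hA hx⟩
      exact Finset.mem_filter.2 ⟨Finset.mem_Ico.2 ⟨cc_nonneg _ x, cc_lt hp _ x⟩, hAk k x hx⟩)
  refine ne_top_of_le_ne_top ENNReal.one_ne_top (hH.trans ?_)
  apply liminf_le_of_frequently_le'
  apply Eventually.frequently
  have hd' : (0:ℝ) < d := hd
  have hev : ∀ᶠ k in atTop, s k < d * Real.log p :=
    hs.eventually (gt_mem_nhds (by positivity))
  filter_upwards [hev] with k hk
  calc ∑ w : W k, Metric.ediam (t k w) ^ (d:ℝ)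
      ≤ ∑ w : W k, ENNReal.ofReal (((p:ℝ) ^ (n k))⁻¹) ^ (d:ℝ) := by
        apply Finset.sum_le_sum; intro w _
        exact ENNReal.rpow_le_rpow (hdiam k w) hd'.le
    _ = ENNReal.ofReal (((W k).card : ℝ) * (((p:ℝ) ^ (n k))⁻¹) ^ (d:ℝ)) := by
        rw [ENNReal.ofReal_rpow_of_nonneg (by positivity) hd'.le, ENNReal.ofReal_mul (by positivity)]
        simp
    _ ≤ 1 := by
        rw [ENNReal.ofReal_le_one]
        have e : (((p:ℝ) ^ (n k))⁻¹) ^ (d:ℝ) = Real.exp (-(n k * (d * Real.log p))) := by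
          rw [Real.rpow_def_of_pos (by positivity), Real.log_inv, Real.log_pow]
          congr 1; ring
        rw [e]
        calc _ ≤ Real.exp (s k * n k) * Real.exp (-(n k * (d * Real.log p))) := by
              gcongr; exact hWcard k
          _ ≤ 1 := by
            rw [← Real.exp_add, Real.exp_le_one_iff]
            have : (0:ℝ) ≤ n k := by positivity
            nlinarith

lemma stepD (hp : 2 ≤ p) (hT : ∀ n, MeasurePreserving (tn p n) μ μ) (hsupp : μ (Ico (0:ℝ) 1)ᶜ = 0)
    (hdim : 0 < measureDim μ) : ∃ η : ℝ, 0 < η ∧ ∀ n, ∫ x, Jf μ p n x ∂μ ≤ 1 - 2 * η := by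
  by_contra hcon
  push Not at hcon
  have hp0 : (0:ℝ) < p := by positivity
  -- entropy is zero
  have hsmall : ∀ δ : ℝ, 0 < δ → ∃ n0 : ℕ, ∀ n ≥ n0, ∫ x, - Real.log (mc μ p n x) ∂μ ≤ δ * n := by
    intro δ hδ
    set l : ℝ := min 1 (δ / (2 * (p + 1))) with hl
    have hl0 : 0 < l := by rw [hl]; positivity
    have hl1 : l ≤ 1 := min_le_left _ _
    have hl2 : l * (p + 1) ≤ δ / 2 := by
      have : l ≤ δ / (2 * (p + 1)) := min_le_right _ _
      calc l * (p + 1) ≤ δ / (2 * (p + 1)) * (p + 1) := by gcongr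
        _ = δ / 2 := by field_simp
    obtain ⟨j0, hj0⟩ := hcon (l ^ 2 / 2) (by positivity)
    have hj : ∀ j ≥ j0, 1 - ∫ x, Jf μ p j x ∂μ ≤ l ^ 2 := by
      intro j hj
      have := Jf_integral_mono hp hT hj
      simp only at this
      linarith
    have hbd : ∀ n, ∫ x, - Real.log (mc μ p n x) ∂μ ≤ δ / 2 * n + j0 * (1 / l) := by
      intro n
      refine (log_mc_integral_le hp hl0 hl1 n).trans ?_
      calc ∑ j ∈ Finset.range n, (l * p + (1 - ∫ x, Jf μ p j x ∂μ) / l)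
          ≤ ∑ j ∈ Finset.range n, (δ / 2 + (if j < j0 then 1 / l else 0)) := by
            apply Finset.sum_le_sum; intro j _
            split_ifs with h
            · have : 0 ≤ ∫ x, Jf μ p j x ∂μ := integral_nonneg fun x => Jf_nonneg _ _
              have h2 : (1 - ∫ x, Jf μ p j x ∂μ) / l ≤ 1 / l := by gcongr; linarith
              nlinarith
            · have h2 : (1 - ∫ x, Jf μ p j x ∂μ) / l ≤ l := by
                rw [div_le_iff₀ hl0]; nlinarith [hj j (not_lt.1 h)]
              linarith
        _ ≤ δ / 2 * n + j0 * (1 / l) := by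
            rw [Finset.sum_add_distrib, ← Finset.sum_filter]
            simp only [Finset.sum_const, Finset.card_range, nsmul_eq_mul]
            have : (((Finset.range n).filter (fun j => j < j0)).card : ℝ) ≤ j0 := by
              have h3 : ((Finset.range n).filter (fun j => j < j0)) ⊆ Finset.range j0 := by
                intro j; simp
              have := Finset.card_le_card h3
              rw [Finset.card_range] at this
              exact_mod_cast this
            have h4 : (((Finset.range n).filter (fun j => j < j0)).card : ℝ) * (1 / l) ≤ j0 * (1 / l) := by
              gcongr
            linarith
    obtain ⟨n0, hn0⟩ := exists_nat_gt (j0 * (1 / l) / (δ / 2))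
    refine ⟨n0, fun n hn => (hbd n).trans ?_⟩
    rw [div_lt_iff₀ (by positivity)] at hn0
    have : (n0:ℝ) ≤ n := by exact_mod_cast hn
    nlinarith
  have hchoose : ∀ k : ℕ, ∃ n : ℕ, k ≤ n ∧ 1 ≤ n ∧ ∫ x, - Real.log (mc μ p n x) ∂μ ≤ (1/16)^(k+1) * n := by
    intro k
    obtain ⟨n0, h⟩ := hsmall ((1/16)^(k+1)) (by positivity)
    exact ⟨max n0 (k+1), (by omega), (by omega), h _ (le_max_left _ _)⟩
  choose n hnk hn1 hn using hchoose
  let B : ℕ → Set ℝ := fun k => {x | (1/4:ℝ)^(k+1) * n k ≤ - Real.log (mc μ p (n k) x)}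
  have hBm : ∀ k, MeasurableSet (B k) := by
    intro k
    have : Measurable (fun x => - Real.log (mc μ p (n k) x)) :=
      (cell_fun hp (n := n k) fun x y h => by rw [mc_congr h]).1
    exact measurableSet_le measurable_const this
  have hB : ∀ k, μ (B k) ≤ ENNReal.ofReal ((1/4)^(k+1)) := by
    intro k
    have hnn : 0 ≤ᵐ[μ] fun x => - Real.log (mc μ p (n k) x) := Eventually.of_forall fun x => by
      have := Real.log_nonpos (mc_nonneg (n k) x) (measureReal_le_one (μ := μ) (s := cc p (n k) ⁻¹' {cc p (n k) x}))
      simp only [Pi.zero_apply]; linarith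
    have := mul_meas_ge_le_integral_of_nonneg hnn (log_mc_integrable hp (n k)) ((1/4:ℝ)^(k+1) * n k)
    have hn0 : (0:ℝ) < n k := by exact_mod_cast hn1 k
    have h2 : (1/4:ℝ)^(k+1) * n k * μ.real (B k) ≤ (1/4:ℝ)^(k+1) * n k * (1/4)^(k+1) := by
      refine (this.trans (hn k)).trans (le_of_eq ?_)
      have : (1/16:ℝ)^(k+1) = (1/4)^(k+1) * (1/4)^(k+1) := by rw [← mul_pow]; norm_num
      rw [this]; ring
    have h3 : μ.real (B k) ≤ (1/4)^(k+1) := le_of_mul_le_mul_left h2 (by positivity)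
    rw [← ENNReal.ofReal_toReal (measure_ne_top μ (B k))]
    exact ENNReal.ofReal_le_ofReal h3
  let Bad : Set ℝ := ⋃ k, B k
  have hBad : μ Bad ≤ ENNReal.ofReal (1/3) := by
    refine (measure_iUnion_le B).trans ?_
    refine (ENNReal.tsum_le_tsum hB).trans ?_
    have hs : HasSum (fun k : ℕ => (1/4:ℝ)^(k+1)) (1/3) := by
      have := (hasSum_geometric_of_lt_one (r := (1/4:ℝ)) (by norm_num) (by norm_num)).mul_left (1/4)
      have e1 : (fun k : ℕ => (1/4:ℝ)^(k+1)) = fun i : ℕ => 1 / 4 * (1 / 4 : ℝ) ^ i := by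
        ext k; ring
      have e2 : (1 / 3 : ℝ) = 1 / 4 * (1 - 1 / 4)⁻¹ := by norm_num
      rw [e1, e2]; exact this
    rw [← ENNReal.ofReal_tsum_of_nonneg (fun k => by positivity) hs.summable, hs.tsum_eq]
  have hpos0 : MeasurableSet {x | ∀ k, 0 < mc μ p (n k) x} := by
    have : {x | ∀ k, 0 < mc μ p (n k) x} = ⋂ k, {x | 0 < mc μ p (n k) x} := by ext; simp
    rw [this]
    exact MeasurableSet.iInter fun k => measurableSet_lt measurable_const
      (cell_fun hp (n := n k) fun x y h => mc_congr h).1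
  let A : Set ℝ := (Ico 0 1 ∩ {x | ∀ k, 0 < mc μ p (n k) x}) \ Bad
  have hAm : MeasurableSet A := (measurableSet_Ico.inter hpos0).diff (MeasurableSet.iUnion hBm)
  have hApos : 0 < μ A := by
    have h1 : μ (Ico 0 1 ∩ {x | ∀ k, 0 < mc μ p (n k) x}) = 1 := by
      rw [← prob_compl_eq_zero_iff (measurableSet_Ico.inter hpos0)]
      have : ∀ᵐ x ∂μ, x ∈ (Ico 0 1 ∩ {x | ∀ k, 0 < mc μ p (n k) x}) := by
        filter_upwards [ae_mc_pos (μ := μ) (p := p), show ∀ᵐ x ∂μ, x ∈ Ico (0:ℝ) 1 from hsupp] with x hx hx'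
        exact ⟨hx', fun k => hx _⟩
      exact this
    have h2 := le_measure_sdiff (μ := μ) (s₁ := Ico 0 1 ∩ {x | ∀ k, 0 < mc μ p (n k) x}) (s₂ := Bad)
    rw [h1] at h2
    refine lt_of_lt_of_le ?_ h2
    rw [tsub_pos_iff_lt]
    refine hBad.trans_lt ?_
    rw [ENNReal.ofReal_lt_one]; norm_num
  have hA0 : dimH A = 0 := by
    refine dimH_zero (μ := μ) hp (n := n) (s := fun k => (1/4:ℝ)^(k+1)) ?_ ?_ ?_ ?_
    · exact tendsto_atTop_mono hnk tendsto_id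
    · exact (tendsto_pow_atTop_nhds_zero_of_lt_one (by norm_num) (by norm_num)).comp (tendsto_add_atTop_nat 1)
    · intro x hx; exact hx.1.1
    · intro k x hx
      have h1 : x ∉ B k := fun h => hx.2 (mem_iUnion.2 ⟨k, h⟩)
      have h1 : - Real.log (mc μ p (n k) x) < (1/4:ℝ)^(k+1) * n k := not_le.1 h1
      rw [← Real.le_log_iff_exp_le (hx.1.2 k)]
      linarith
  have : measureDim μ ≤ dimH A := iInf_le_of_le A (iInf_le_of_le hAm (iInf_le _ hApos))
  rw [hA0] at this
  exact absurd hdim (not_lt.2 this)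

end stepD


section stepC1
variable {p : ℕ} {μ : Measure ℝ} [IsProbabilityMeasure μ]

/-- ratio of cell measures -/
noncomputable def qf (μ : Measure ℝ) (p n l : ℕ) (x : ℝ) : ℝ := mc μ p (n+l) x / mc μ p n x

lemma mc_anti (hp : 2 ≤ p) {n n' : ℕ} (h : n ≤ n') (x : ℝ) : mc μ p n' x ≤ mc μ p n x :=
  antitone_nat_of_succ_le (f := fun n => mc μ p n x) (fun n => mc_mono hp n x) h

lemma qf_nonneg (n l : ℕ) (x : ℝ) : 0 ≤ qf μ p n l x := div_nonneg (mc_nonneg _ _) (mc_nonneg _ _)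

lemma qf_le_one (hp : 2 ≤ p) (n l : ℕ) (x : ℝ) : qf μ p n l x ≤ 1 :=
  div_le_one_of_le₀ (mc_anti hp (by omega) x) (mc_nonneg _ _)

lemma qf_congr (hp : 2 ≤ p) {n l : ℕ} {x y : ℝ} (h : cc p (n+l) x = cc p (n+l) y) :
    qf μ p n l x = qf μ p n l y := by
  unfold qf; rw [mc_congr h, mc_congr (cc_split hp h).1]

lemma qf_measurable (hp : 2 ≤ p) (n l : ℕ) : Measurable (qf μ p n l) :=
  (cell_fun hp (fun _ _ h => qf_congr hp h)).1

lemma qf_integrable (hp : 2 ≤ p) (n l : ℕ) : Integrable (qf μ p n l) μ :=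
  cell_integrable hp (fun _ _ h => qf_congr hp h)

lemma qf_prod {x : ℝ} (hx : ∀ n, 0 < mc μ p n x) (n l : ℕ) :
    qf μ p n l x = ∏ k ∈ Finset.range l, Jf μ p (n + k) x := by
  induction l with
  | zero => simp [qf, (hx n).ne']
  | succ l ih =>
    rw [Finset.prod_range_succ, ← ih]
    unfold qf Jf
    have h1 := (hx n).ne'
    have h2 := (hx (n+l)).ne'
    field_simp
    rw [add_assoc]

/-- AM-GM -/
lemma prod_le_avg_pow (l : ℕ) (hl : 1 ≤ l) (z : ℕ → ℝ) (hz : ∀ i, 0 ≤ z i) :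
    ∏ k ∈ Finset.range l, z k ≤ ((∑ k ∈ Finset.range l, z k) / l) ^ l := by
  have hl0 : (0:ℝ) < l := by exact_mod_cast hl
  have h := Real.geom_mean_le_arith_mean (Finset.range l) (fun _ => (1:ℝ)) z (fun _ _ => zero_le_one)
    (by simp; omega) (fun i _ => hz i)
  simp only [Real.rpow_one, Finset.sum_const, Finset.card_range, nsmul_eq_mul, mul_one, one_mul] at h
  have h0 : 0 ≤ ∏ k ∈ Finset.range l, z k := Finset.prod_nonneg fun i _ => hz i
  calc ∏ k ∈ Finset.range l, z k = ((∏ k ∈ Finset.range l, z k) ^ ((l:ℝ)⁻¹)) ^ l := by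
        rw [← Real.rpow_natCast, ← Real.rpow_mul h0, inv_mul_cancel₀ hl0.ne', Real.rpow_one]
    _ ≤ _ := pow_le_pow_left₀ (Real.rpow_nonneg h0 _) h _

lemma L1_of_L2 {f : ℝ → ℂ} (hf : Measurable f) {C : ℝ} (hb : ∀ x, ‖f x‖ ≤ C) {ε : ℝ} (hε : 0 < ε)
    (h : ∫ x, ‖f x‖ ^ 2 ∂μ ≤ ε ^ 2) : ∫ x, ‖f x‖ ∂μ ≤ ε := by
  have hi : Integrable (fun x => ‖f x‖) μ := (integrable_bdd hf hb).norm
  have hi2 : Integrable (fun x => ‖f x‖ ^ 2) μ := by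
    apply integrable_bddR (hf.norm.pow_const 2) (C := C ^ 2)
    intro x; rw [norm_pow, norm_norm]; gcongr; exact hb x
  have hpt : ∀ x, ‖f x‖ ≤ ε / 2 + ‖f x‖ ^ 2 / (2 * ε) := by
    intro x
    have : ε / 2 + ‖f x‖ ^ 2 / (2 * ε) - ‖f x‖ = (‖f x‖ - ε) ^ 2 / (2 * ε) := by field_simp; ring
    have h2 : 0 ≤ (‖f x‖ - ε) ^ 2 / (2 * ε) := by positivity
    linarith
  calc ∫ x, ‖f x‖ ∂μ ≤ ∫ x, (ε / 2 + ‖f x‖ ^ 2 / (2 * ε)) ∂μ :=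
        integral_mono hi ((integrable_const _).add (hi2.div_const _)) hpt
    _ = ε / 2 + (∫ x, ‖f x‖ ^ 2 ∂μ) / (2 * ε) := by
        have hs : Integrable (fun x => ‖f x‖ ^ 2 / (2 * ε)) μ := hi2.div_const _
        have hs2 : ∫ x, ‖f x‖ ^ 2 / (2 * ε) ∂μ = (∫ x, ‖f x‖ ^ 2 ∂μ) / (2 * ε) := integral_div _ _
        rw [integral_add (integrable_const _) hs, hs2]; simp
    _ ≤ ε / 2 + ε ^ 2 / (2 * ε) := by gcongr
    _ = ε := by field_simp; ring

lemma Jf_approx (hp : 2 ≤ p) (hT : ∀ n, MeasurePreserving (tn p n) μ μ) {ε : ℝ} (hε : 0 < ε) :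
    ∃ L, ∀ k, ∫ x, |Jf μ p (k + L) x - Jf μ p L (tn p k x)| ∂μ ≤ ε := by
  have hp0 : (0:ℝ) < p := by positivity
  have h1 : ∀ d, ∃ L, ∀ n ≥ L, ∀ n' ≥ L, al μ p n (Pd p d) - al μ p n' (Pd p d) ≤ (ε / p) ^ 2 := by
    intro d
    have hmono := al_mono hp hT (Pd_measurable (p := p) d) (Pd_norm_le d)
    have hbdd : BddAbove (range fun n => al μ p n (Pd p d)) :=
      ⟨1, by rintro _ ⟨n, rfl⟩; exact al_le_one n (Pd_measurable d) (Pd_norm_le d)⟩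
    have ht := tendsto_atTop_ciSup hmono hbdd
    have hc := ht.cauchySeq
    obtain ⟨L, hL⟩ := Metric.cauchySeq_iff.1 hc ((ε / p) ^ 2) (by positivity)
    refine ⟨L, fun n hn n' hn' => ?_⟩
    have := hL n hn n' hn'
    rw [Real.dist_eq] at this
    exact (le_abs_self _).trans this.le
  choose Lf hLf using h1
  set L := (Finset.range p).sup Lf
  refine ⟨L, fun k => ?_⟩
  set w : ℕ → ℝ → ℂ := fun d x => ud μ p (k + L) d x - ud μ p L d (tn p k x) with hw
  have hwm : ∀ d, Measurable (w d) := fun d =>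
    (ud_measurable _ d).sub ((ud_measurable L d).comp (tn_measurable k))
  have hwb : ∀ d x, ‖w d x‖ ≤ 2 := fun d x => (norm_sub_le _ _).trans
    (by linarith [ud_norm_le (μ := μ) (p := p) (k+L) d x, ud_norm_le (μ := μ) (p := p) L d (tn p k x)])
  have hpt : ∀ x, |Jf μ p (k + L) x - Jf μ p L (tn p k x)| ≤ ∑ d ∈ Finset.range p, ‖w d x‖ := by
    intro x
    have e : ((Jf μ p (k + L) x - Jf μ p L (tn p k x) : ℝ) : ℂ)
        = ∑ d ∈ Finset.range p, Pd p d (tn p (k + L) x) * w d x := by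
      push_cast
      rw [Jf_eq hp, Jf_eq hp, ← Finset.sum_sub_distrib]
      apply Finset.sum_congr rfl; intro d _
      rw [tn_tn, ← mul_sub]
    rw [← Real.norm_eq_abs, ← Complex.norm_real, e]
    refine (norm_sum_le _ _).trans (Finset.sum_le_sum fun d _ => ?_)
    rw [norm_mul]
    exact mul_le_of_le_one_left (norm_nonneg _) (Pd_norm_le _ _)
  have hwi : ∀ d, Integrable (fun x => ‖w d x‖) μ := fun d => (integrable_bdd (hwm d) (hwb d)).norm
  have hJi : Integrable (fun x => |Jf μ p (k + L) x - Jf μ p L (tn p k x)|) μ :=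
    ((Jf_integrable hp _).sub ((hT k).integrable_comp_of_integrable (Jf_integrable hp L))).abs
  calc _ ≤ ∫ x, ∑ d ∈ Finset.range p, ‖w d x‖ ∂μ :=
        integral_mono hJi (integrable_finsetSum _ fun d _ => hwi d) hpt
    _ = ∑ d ∈ Finset.range p, ∫ x, ‖w d x‖ ∂μ := integral_finsetSum _ fun d _ => hwi d
    _ ≤ ∑ d ∈ Finset.range p, ε / p := by
        apply Finset.sum_le_sum; intro d hd
        apply L1_of_L2 (hwm d) (hwb d) (by positivity)
        have := al_diff hp hT k L (Pd_measurable (p := p) d) (Pd_norm_le d)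
        have hLd : Lf d ≤ L := Finset.le_sup hd
        exact this.le.trans (hLf d _ (by omega) _ hLd)
    _ = ε := by simp; field_simp

lemma birkhoff_L1 (herg : Ergodic (Tmap p) μ) (hfr : ∀ᵐ x ∂μ, Int.fract x = x) {g : ℝ → ℝ}
    (hg : Measurable g) (h0 : ∀ x, 0 ≤ g x) (h1 : ∀ x, g x ≤ 1) :
    Tendsto (fun l : ℕ => ∫ x, |(1 / l : ℝ) * ∑ k ∈ Finset.range l, g (tn p k x) - ∫ y, g y ∂μ| ∂μ)
      atTop (𝓝 0) := by
  have hm : ∀ l : ℕ, Measurable fun x => (1 / l : ℝ) * ∑ k ∈ Finset.range l, g (tn p k x) := fun l =>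
    (Finset.measurable_sum _ fun k _ => hg.comp (tn_measurable k)).const_mul _
  have h := tendsto_integral_of_dominated_convergence (μ := μ) (f := fun _ => (0:ℝ))
    (F := fun (l : ℕ) x => |(1 / l : ℝ) * ∑ k ∈ Finset.range l, g (tn p k x) - ∫ y, g y ∂μ|)
    (fun _ => 2) (fun l => ((hm l).sub measurable_const).abs.aestronglyMeasurable)
    (integrable_const _) ?_ ?_
  · simpa using h
  · intro l
    refine Eventually.of_forall fun x => ?_
    have a1 : 0 ≤ ∫ y, g y ∂μ := integral_nonneg h0
    have a2 : ∫ y, g y ∂μ ≤ 1 := by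
      calc ∫ y, g y ∂μ ≤ ∫ y, (1:ℝ) ∂μ := integral_mono (integrable_bddR hg (C := 1)
            (fun x => by rw [Real.norm_of_nonneg (h0 _)]; exact h1 _)) (integrable_const _) h1
        _ = 1 := by simp
    have b1 : 0 ≤ (1 / l : ℝ) * ∑ k ∈ Finset.range l, g (tn p k x) :=
      mul_nonneg (by positivity) (Finset.sum_nonneg fun _ _ => h0 _)
    have b2 : (1 / l : ℝ) * ∑ k ∈ Finset.range l, g (tn p k x) ≤ 1 := by
      have : ∑ k ∈ Finset.range l, g (tn p k x) ≤ l := by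
        calc _ ≤ ∑ k ∈ Finset.range l, (1:ℝ) := Finset.sum_le_sum fun _ _ => h1 _
          _ = l := by simp
      rw [one_div_mul_eq_div]; exact div_le_one_of_le₀ this (by positivity)
    rw [Real.norm_eq_abs, abs_abs, abs_le]; constructor <;> linarith
  · filter_upwards [birkhoff01 herg hg h0 h1, hfr] with x hx hx'
    simp only [Tmap_iter _ hx'] at hx
    have := (hx.sub_const (∫ y, g y ∂μ)).abs
    simpa using this

lemma stepC1 (hp : 2 ≤ p) (hT : ∀ n, MeasurePreserving (tn p n) μ μ) (herg : Ergodic (Tmap p) μ)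
    (hfr : ∀ᵐ x ∂μ, Int.fract x = x) {η : ℝ} (hη : 0 < η)
    (hJ : ∀ n, ∫ x, Jf μ p n x ∂μ ≤ 1 - 2 * η) {κ : ℝ} (hκ : 0 < κ) :
    ∃ l L, ∀ n ≥ L, ∫ x, qf μ p n l x ∂μ ≤ κ := by
  have hη1 : η < 1 := by
    have : 0 ≤ ∫ x, Jf μ p 0 x ∂μ := integral_nonneg fun x => Jf_nonneg _ _
    linarith [hJ 0]
  set ε := κ * η / 4 with hε
  have hε0 : 0 < ε := by positivity
  obtain ⟨L, hL⟩ := Jf_approx hp hT hε0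
  have hB := birkhoff_L1 herg hfr (Jf_measurable (μ := μ) hp L) (Jf_nonneg L) (Jf_le_one hp L)
  have hpow : Tendsto (fun l : ℕ => (1 - η) ^ l) atTop (𝓝 0) :=
    tendsto_pow_atTop_nhds_zero_of_lt_one (by linarith) (by linarith)
  obtain ⟨l, ⟨hl1, hl2⟩, hl3⟩ := (((hB.eventually (gt_mem_nhds hε0)).and
    (hpow.eventually (gt_mem_nhds (show (0:ℝ) < κ / 2 by positivity)))).and (eventually_ge_atTop 1)).exists
  have hl0 : (0:ℝ) < l := by exact_mod_cast hl3
  refine ⟨l, L, fun n hn => ?_⟩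
  obtain ⟨k, rfl⟩ := Nat.exists_eq_add_of_le' hn
  set c := ∫ x, Jf μ p L x ∂μ
  set X : ℝ → ℝ := fun x => (∑ i ∈ Finset.range l, Jf μ p (k + L + i) x) / l
  set Y : ℝ → ℝ := fun x => (1 / l : ℝ) * ∑ i ∈ Finset.range l, Jf μ p L (tn p i x)
  have hXi : Integrable X μ := (integrable_finsetSum _ fun i _ => Jf_integrable hp _).div_const _
  have hJc : ∀ i, Integrable (fun x => Jf μ p L (tn p i x)) μ := fun i =>
    (hT i).integrable_comp_of_integrable (Jf_integrable hp L)
  have hYm : Measurable Y := (Finset.measurable_sum _ fun i _ =>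
    (Jf_measurable hp L).comp (tn_measurable i)).const_mul _
  have hYi : Integrable Y μ := (integrable_finsetSum _ fun i _ => hJc i).const_mul _
  have hYki : Integrable (fun x => Y (tn p k x)) μ := (hT k).integrable_comp_of_integrable hYi
  have hdi : ∀ i, Integrable (fun x => |Jf μ p (k + L + i) x - Jf μ p L (tn p (k + i) x)|) μ := fun i =>
    ((Jf_integrable hp _).sub (hJc _)).abs
  -- X close to Y ∘ T^k
  have hXY : ∫ x, |X x - Y (tn p k x)| ∂μ ≤ ε := by
    calc ∫ x, |X x - Y (tn p k x)| ∂μ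
        ≤ ∫ x, (1 / l : ℝ) * ∑ i ∈ Finset.range l, |Jf μ p (k + L + i) x - Jf μ p L (tn p (k + i) x)| ∂μ := by
          apply integral_mono (hXi.sub hYki).abs ((integrable_finsetSum _ fun i _ => hdi i).const_mul _)
          intro x
          have e : X x - Y (tn p k x) = (1 / l : ℝ) * ∑ i ∈ Finset.range l,
              (Jf μ p (k + L + i) x - Jf μ p L (tn p (k + i) x)) := by
            simp only [X, Y, tn_tn, Finset.sum_sub_distrib]; ring
          show |X x - Y (tn p k x)| ≤ _
          rw [e, abs_mul, abs_of_nonneg (by positivity)]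
          refine mul_le_mul_of_nonneg_left ?_ (by positivity)
          exact Finset.abs_sum_le_sum_abs _ _
      _ = (1 / l : ℝ) * ∑ i ∈ Finset.range l, ∫ x, |Jf μ p (k + L + i) x - Jf μ p L (tn p (k + i) x)| ∂μ := by
          rw [integral_const_mul, integral_finsetSum _ fun i _ => hdi i]
      _ ≤ (1 / l : ℝ) * ∑ i ∈ Finset.range l, ε := by
          gcongr with i _
          have := hL (k + i)
          rwa [show k + i + L = k + L + i by ring] at this
      _ = ε := by simp; field_simp
  have hYc : ∫ x, |Y (tn p k x) - c| ∂μ ≤ ε := by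
    rw [integral_comp_mp (hT k) (f := fun x => |Y x - c|) (hYm.sub measurable_const).abs]
    exact hl1.le
  have hXc : ∫ x, |X x - c| ∂μ ≤ 2 * ε := by
    calc ∫ x, |X x - c| ∂μ ≤ ∫ x, (|X x - Y (tn p k x)| + |Y (tn p k x) - c|) ∂μ := by
          apply integral_mono (hXi.sub (integrable_const _)).abs
            ((hXi.sub hYki).abs.add (hYki.sub (integrable_const _)).abs)
          intro x; exact abs_sub_le _ _ _
      _ = ∫ x, |X x - Y (tn p k x)| ∂μ + ∫ x, |Y (tn p k x) - c| ∂μ :=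
          integral_add (hXi.sub hYki).abs (hYki.sub (integrable_const _)).abs
      _ ≤ 2 * ε := by linarith
  have hi3 : Integrable (fun x => (1 - η) ^ l + |X x - c| / η) μ :=
    (integrable_const _).add ((hXi.sub (integrable_const _)).abs.div_const _)
  calc ∫ x, qf μ p (k + L) l x ∂μ ≤ ∫ x, ((1 - η) ^ l + |X x - c| / η) ∂μ := by
        apply integral_mono_ae (qf_integrable hp _ _) hi3
        filter_upwards [ae_mc_pos (μ := μ) (p := p)] with x hx
        rw [qf_prod hx]
        have h1 := prod_le_avg_pow l hl3 (fun i => Jf μ p (k + L + i) x) (fun i => Jf_nonneg _ _)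
        refine h1.trans ?_
        have hX0 : 0 ≤ X x := div_nonneg (Finset.sum_nonneg fun _ _ => Jf_nonneg _ _) hl0.le
        have hX1 : X x ≤ 1 := by
          apply div_le_one_of_le₀ _ hl0.le
          calc _ ≤ ∑ i ∈ Finset.range l, (1:ℝ) := Finset.sum_le_sum fun _ _ => Jf_le_one hp _ _
            _ = l := by simp
        show X x ^ l ≤ _
        have hp1 : 0 ≤ (1 - η) ^ l := pow_nonneg (by linarith) _
        rcases le_or_gt (X x) (1 - η) with h | h
        · have : X x ^ l ≤ (1 - η) ^ l := pow_le_pow_left₀ hX0 h _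
          have h3 : 0 ≤ |X x - c| / η := by positivity
          linarith
        · have : X x ^ l ≤ 1 := pow_le_one₀ hX0 hX1
          have h3 : 1 ≤ |X x - c| / η := by
            rw [le_div_iff₀ hη, one_mul]
            refine le_trans ?_ (le_abs_self _)
            have := hJ L
            linarith
          linarith
    _ = (1 - η) ^ l + (∫ x, |X x - c| ∂μ) / η := by
        have hs : Integrable (fun x => |X x - c| / η) μ := (hXi.sub (integrable_const _)).abs.div_const _
        have hs2 : ∫ x, |X x - c| / η ∂μ = (∫ x, |X x - c| ∂μ) / η := integral_div _ _
        rw [integral_add (integrable_const _) hs, hs2]; simp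
    _ ≤ κ / 2 + 2 * ε / η := by gcongr
    _ = κ := by rw [hε]; field_simp; ring

end stepC1


section stepC2a
variable {ν : Measure ℝ} [IsFiniteMeasure ν]

lemma integral_fin_fun {w : ℝ → ℤ} (hw : Measurable w) {P : ℤ} (h0 : ∀ y, 0 ≤ w y) (hP : ∀ y, w y < P)
    (g : ℤ → ℝ) :
    Integrable (fun y => g (w y)) ν ∧
    ∫ y, g (w y) ∂ν = ∑ j ∈ Finset.Ico 0 P, ν.real (w ⁻¹' {j}) * g j := by
  have hm : ∀ j : ℤ, MeasurableSet (w ⁻¹' {j}) := fun j => hw (measurableSet_singleton j)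
  have e : (fun y => g (w y)) = fun y => ∑ j ∈ Finset.Ico 0 P, (w ⁻¹' {j}).indicator (fun _ => g j) y := by
    funext y
    rw [Finset.sum_eq_single (w y)]
    · simp
    · intro j _ hj
      rw [indicator_of_notMem]
      simpa using fun h => hj h.symm
    · intro h
      exact absurd (Finset.mem_Ico.2 ⟨h0 y, hP y⟩) h
  have hi : ∀ j ∈ Finset.Ico 0 P, Integrable (fun y => (w ⁻¹' {j}).indicator (fun _ => g j) y) ν := fun j _ =>
    (integrable_const _).indicator (hm j)
  constructor
  · rw [e]; exact integrable_finsetSum _ hi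
  · rw [e, integral_finsetSum _ hi]
    apply Finset.sum_congr rfl; intro j _
    rw [integral_indicator (hm j)]; simp [Measure.real]

lemma near_lemma {w : ℝ → ℤ} (hw : Measurable w) {P : ℤ} (h0 : ∀ y, 0 ≤ w y) (hP : ∀ y, w y < P) (d : ℤ) :
    ∫ y, ν.real (w ⁻¹' {w y + d}) ∂ν ≤ ∫ y, ν.real (w ⁻¹' {w y}) ∂ν := by
  rw [(integral_fin_fun hw h0 hP (fun j => ν.real (w ⁻¹' {j + d}))).2,
    (integral_fin_fun hw h0 hP (fun j => ν.real (w ⁻¹' {j}))).2]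
  have hz : ∀ j, j ∉ Finset.Ico 0 P → ν.real (w ⁻¹' {j}) = 0 := by
    intro j hj
    have : w ⁻¹' {j} = ∅ := by
      ext y; simp only [mem_preimage, mem_singleton_iff, mem_empty_iff_false, iff_false]
      rintro rfl; exact hj (Finset.mem_Ico.2 ⟨h0 y, hP y⟩)
    rw [this]; simp
  set G : ℤ → ℝ := fun j => ν.real (w ⁻¹' {j})
  have h1 : ∑ j ∈ Finset.Ico 0 P, G (j + d) ^ 2 ≤ ∑ j ∈ Finset.Ico 0 P, G j ^ 2 := by
    have e1 : ∑ j ∈ Finset.Ico 0 P, G (j + d) ^ 2 = ∑ j ∈ (Finset.Ico 0 P).image (· + d), G j ^ 2 := by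
      rw [Finset.sum_image]; intro a _ b _ h; simpa using h
    rw [e1, ← Finset.sum_filter_add_sum_filter_not _ (fun j => j ∈ Finset.Ico 0 P)]
    have e2 : ∑ j ∈ ((Finset.Ico 0 P).image (· + d)).filter (fun j => ¬ j ∈ Finset.Ico 0 P), G j ^ 2 = 0 := by
      apply Finset.sum_eq_zero; intro j hj
      rw [Finset.mem_filter] at hj
      simp only [G]; rw [hz j hj.2]; ring
    rw [e2, add_zero]
    apply Finset.sum_le_sum_of_subset_of_nonneg
    · intro j hj; exact (Finset.mem_filter.1 hj).2
    · intros; positivity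
  calc ∑ j ∈ Finset.Ico 0 P, G j * G (j + d) ≤ ∑ j ∈ Finset.Ico 0 P, (G j ^ 2 + G (j + d) ^ 2) / 2 := by
        apply Finset.sum_le_sum; intro j _; nlinarith [sq_nonneg (G j - G (j + d))]
    _ = (∑ j ∈ Finset.Ico 0 P, G j ^ 2 + ∑ j ∈ Finset.Ico 0 P, G (j + d) ^ 2) / 2 := by
        rw [← Finset.sum_add_distrib, Finset.sum_div]
    _ ≤ ∑ j ∈ Finset.Ico 0 P, G j ^ 2 := by linarith
    _ = ∑ j ∈ Finset.Ico 0 P, G j * G j := by simp only [sq]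

lemma kernel_lemma {w : ℝ → ℤ} (hw : Measurable w) {P : ℤ} (h0 : ∀ y, 0 ≤ w y) (hP : ∀ y, w y < P)
    {φ : ℝ → ℝ} (hφ : Measurable φ) (H : ℕ) (hH : 1 ≤ H) (ξ : ℕ → ℝ) {κ : ℝ} (hκ : 0 ≤ κ)
    (hK : ∀ y y', 2 ≤ |w y' - w y| → ‖(1 / H : ℂ) * ∑ h ∈ Finset.range H, ee (ξ h * (φ y - φ y'))‖ ≤ κ) :
    (1 / H : ℝ) * ∑ h ∈ Finset.range H, ‖∫ y, ee (ξ h * φ y) ∂ν‖ ^ 2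
      ≤ κ * ν.real univ ^ 2 + 3 * ∫ y, ν.real (w ⁻¹' {w y}) ∂ν := by
  have hH0 : (0:ℝ) < H := by exact_mod_cast hH
  have hm : ∀ j : ℤ, MeasurableSet (w ⁻¹' {j}) := fun j => hw (measurableSet_singleton j)
  have hem : ∀ c : ℝ, Measurable fun y => ee (c * φ y) := fun c => ee_measurable.comp (hφ.const_mul c)
  have hei : ∀ c : ℝ, Integrable (fun y => ee (c * φ y)) ν := fun c =>
    Integrable.of_bound (hem c).aestronglyMeasurable 1 (Eventually.of_forall fun y => (ee_norm _).le)
  have hei' : ∀ c : ℝ, Integrable (fun y => (starRingEnd ℂ) (ee (c * φ y))) ν := fun c => by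
    have := hei (-c)
    refine this.congr (Eventually.of_forall fun y => ?_)
    show ee (-c * φ y) = _
    rw [neg_mul, ee_neg]
  set z : ℕ → ℂ := fun h => ∫ y, ee (ξ h * φ y) ∂ν
  set I : ℝ → ℂ := fun y => (1 / H : ℂ) * ∑ h ∈ Finset.range H, ee (ξ h * φ y) * (starRingEnd ℂ) (z h)
  have hIi : Integrable I ν :=
    (integrable_finsetSum _ fun h _ => (hei (ξ h)).mul_const _).const_mul _
  have e1 : (((1 / H : ℝ) * ∑ h ∈ Finset.range H, ‖z h‖ ^ 2 : ℝ) : ℂ) = ∫ y, I y ∂ν := by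
    simp only [I]
    rw [integral_const_mul, integral_finsetSum _ fun h _ => (hei (ξ h)).mul_const _]
    push_cast
    congr 1
    apply Finset.sum_congr rfl; intro h _
    rw [integral_mul_const, ← Complex.ofReal_pow, ← Complex.normSq_eq_norm_sq, ← Complex.mul_conj]
  have e2 : ∀ y, I y = ∫ y', (1 / H : ℂ) * ∑ h ∈ Finset.range H, ee (ξ h * (φ y - φ y')) ∂ν := by
    intro y
    have : ∀ y', (1 / H : ℂ) * ∑ h ∈ Finset.range H, ee (ξ h * (φ y - φ y'))
        = (1 / H : ℂ) * ∑ h ∈ Finset.range H, ee (ξ h * φ y) * (starRingEnd ℂ) (ee (ξ h * φ y')) := by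
      intro y'
      congr 1; apply Finset.sum_congr rfl; intro h _
      rw [← ee_neg, ← ee_add]; congr 1; ring
    simp only [this]
    rw [integral_const_mul, integral_finsetSum _ fun h _ => (hei' (ξ h)).const_mul _]
    simp only [I]
    congr 1; apply Finset.sum_congr rfl; intro h _
    rw [integral_const_mul, integral_conj]
  set G : ℤ → ℝ := fun j => ν.real (w ⁻¹' {j})
  have hGi : ∀ d, Integrable (fun y => G (w y + d)) ν := fun d =>
    (integral_fin_fun hw h0 hP (fun j => G (j + d))).1
  have hK1 : ∀ y y', ‖(1 / H : ℂ) * ∑ h ∈ Finset.range H, ee (ξ h * (φ y - φ y'))‖ ≤ 1 := by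
    intro y y'
    rw [norm_mul]
    have : ‖∑ h ∈ Finset.range H, ee (ξ h * (φ y - φ y'))‖ ≤ H := by
      refine (norm_sum_le _ _).trans ?_
      simp [ee_norm]
    rw [norm_div, norm_one, Complex.norm_natCast, one_div_mul_eq_div]
    exact div_le_one_of_le₀ this hH0.le
  have e3 : ∀ y, ‖I y‖ ≤ κ * ν.real univ + (G (w y + (-1)) + G (w y + 0) + G (w y + 1)) := by
    intro y
    rw [e2 y]
    have hii : ∀ j : ℤ, Integrable (fun y' => (w ⁻¹' {j}).indicator (fun _ => (1:ℝ)) y') ν := fun j =>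
      (integrable_const _).indicator (hm j)
    have hintg : Integrable (fun y' => κ + ((w ⁻¹' {w y + (-1)}).indicator (fun _ => (1:ℝ)) y'
        + (w ⁻¹' {w y + 0}).indicator (fun _ => (1:ℝ)) y' + (w ⁻¹' {w y + 1}).indicator (fun _ => (1:ℝ)) y')) ν :=
      (integrable_const _).add (((hii _).add (hii _)).add (hii _))
    refine (norm_integral_le_of_norm_le hintg (Eventually.of_forall fun y' => ?_)).trans (le_of_eq ?_)
    · by_cases hh : 2 ≤ |w y' - w y|
      · refine (hK y y' hh).trans ?_
        have : ∀ j : ℤ, 0 ≤ (w ⁻¹' {j}).indicator (fun _ => (1:ℝ)) y' := fun j =>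
          indicator_nonneg (fun _ _ => zero_le_one) _
        linarith [this (w y + (-1)), this (w y + 0), this (w y + 1)]
      · refine (hK1 y y').trans ?_
        have hpos : ∀ j : ℤ, 0 ≤ (w ⁻¹' {j}).indicator (fun _ => (1:ℝ)) y' := fun j =>
          indicator_nonneg (fun _ _ => zero_le_one) _
        have hone : ∀ j : ℤ, w y' = j → (w ⁻¹' {j}).indicator (fun _ => (1:ℝ)) y' = 1 := fun j hj => by
          rw [indicator_of_mem]; exact hj
        have : w y' = w y + (-1) ∨ w y' = w y + 0 ∨ w y' = w y + 1 := by
          rw [not_le, abs_lt] at hh; omega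
        rcases this with h | h | h
        · rw [hone _ h]; linarith [hpos (w y + 0), hpos (w y + 1)]
        · rw [hone _ h]; linarith [hpos (w y + (-1)), hpos (w y + 1)]
        · rw [hone _ h]; linarith [hpos (w y + (-1)), hpos (w y + 0)]
    · have hone : ∀ j : ℤ, ∫ y', (w ⁻¹' {j}).indicator (fun _ => (1:ℝ)) y' ∂ν = G j := fun j => by
        rw [integral_indicator (hm j)]; simp [G, Measure.real]
      have hs2 : Integrable (fun y' => (w ⁻¹' {w y + (-1)}).indicator (fun _ => (1:ℝ)) y'
        + (w ⁻¹' {w y + 0}).indicator (fun _ => (1:ℝ)) y') ν := (hii _).add (hii _)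
      have hs3 : Integrable (fun y' => (w ⁻¹' {w y + (-1)}).indicator (fun _ => (1:ℝ)) y'
        + (w ⁻¹' {w y + 0}).indicator (fun _ => (1:ℝ)) y' + (w ⁻¹' {w y + 1}).indicator (fun _ => (1:ℝ)) y') ν :=
          hs2.add (hii _)
      rw [integral_add (integrable_const _) hs3, integral_add hs2 (hii _), integral_add (hii _) (hii _),
        hone, hone, hone]
      simp [mul_comm]
  have hs2 : Integrable (fun y => G (w y + (-1)) + G (w y + 0)) ν := (hGi _).add (hGi _)
  have hs3 : Integrable (fun y => G (w y + (-1)) + G (w y + 0) + G (w y + 1)) ν := hs2.add (hGi _)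
  have hs4 : Integrable (fun y => κ * ν.real univ + (G (w y + (-1)) + G (w y + 0) + G (w y + 1))) ν :=
    (integrable_const _).add hs3
  have e4 := norm_integral_le_of_norm_le hs4 (Eventually.of_forall e3)
  rw [← e1, Complex.norm_real, integral_add (integrable_const _) hs3, integral_add hs2 (hGi _),
    integral_add (hGi _) (hGi _)] at e4
  have n1 := near_lemma (ν := ν) hw h0 hP (-1)
  have n2 := near_lemma (ν := ν) hw h0 hP 0
  have n3 := near_lemma (ν := ν) hw h0 hP 1
  have n4 := (Real.le_norm_self _).trans e4
  simp only [integral_const, smul_eq_mul] at n4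
  simp only [G, z] at *
  have : ν.real univ * (κ * ν.real univ) = κ * ν.real univ ^ 2 := by ring
  linarith

end stepC2a

section stepC2
variable {p : ℕ} {μ : Measure ℝ} [IsProbabilityMeasure μ]

lemma stepC2_pt (hp : 2 ≤ p) (n l : ℕ) (H : ℕ) (hH : 1 ≤ H) (ξ : ℕ → ℝ) {κ : ℝ} (hκ : 0 ≤ κ)
    (hK : ∀ d : ℝ, ((p:ℝ) ^ l)⁻¹ ≤ |d| → |d| ≤ 1 →
      ‖(1 / H : ℂ) * ∑ h ∈ Finset.range H, ee (ξ h * d)‖ ≤ κ) {x : ℝ} (hx : 0 < mc μ p n x) :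
    (1 / H : ℝ) * ∑ h ∈ Finset.range H, ‖cE μ (cc p n) (fun y => ee (ξ h * tn p n y)) x‖ ^ 2
      ≤ κ + 3 * (cE μ (cc p n) (fun y => (qf μ p n l y : ℂ)) x).re := by
  have hp0 : (0:ℝ) < p := by positivity
  set C := cc p n ⁻¹' {cc p n x} with hC
  have hCm : MeasurableSet C := cc_measurable n (measurableSet_singleton _)
  have hk := kernel_lemma (ν := μ.restrict C) (w := fun y => cc p l (tn p n y))
    ((cc_measurable l).comp (tn_measurable n)) (P := (p:ℤ) ^ l) (fun y => cc_nonneg _ _)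
    (fun y => cc_lt hp _ _) (tn_measurable (p := p) n) H hH ξ hκ ?_
  · have e0 : (μ.restrict C).real univ = mc μ p n x := by simp [mc, Measure.real, hC]
    have e1 : ∫ y in C, (μ.restrict C).real ((fun y => cc p l (tn p n y)) ⁻¹' {cc p l (tn p n y)}) ∂μ
        = mc μ p n x * ∫ y in C, qf μ p n l y ∂μ := by
      rw [← integral_const_mul]
      apply setIntegral_congr_fun hCm
      intro y hy
      have hy' : cc p n y = cc p n x := hy
      have hmm : mc μ p n y = mc μ p n x := mc_congr hy'
      show _ = mc μ p n x * (mc μ p (n+l) y / mc μ p n y)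
      rw [hmm, mul_div_cancel₀ _ hx.ne']
      unfold mc
      show (μ.restrict C).real ((fun y => cc p l (tn p n y)) ⁻¹' {cc p l (tn p n y)}) = _
      have hms : MeasurableSet ((fun y => cc p l (tn p n y)) ⁻¹' {cc p l (tn p n y)}) := (((cc_measurable l).comp (tn_measurable n)) (measurableSet_singleton _))
      rw [measureReal_restrict_apply hms]
      congr 1
      ext t
      simp only [mem_inter_iff, mem_preimage, mem_singleton_iff, hC]
      constructor
      · rintro ⟨h1, h2⟩
        rw [cc_add, cc_add, h1, h2, hy']
      · intro h
        have := cc_split hp h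
        exact ⟨this.2, this.1.trans hy'⟩
    rw [e0, e1] at hk
    have e2 : ∀ h, ‖cE μ (cc p n) (fun y => ee (ξ h * tn p n y)) x‖ ^ 2
        = ‖∫ y in C, ee (ξ h * tn p n y) ∂μ‖ ^ 2 / mc μ p n x ^ 2 := by
      intro h
      unfold cE
      rw [norm_mul, norm_inv, Complex.norm_real, Real.norm_of_nonneg measureReal_nonneg, mul_pow]
      unfold mc
      field_simp
      rfl
    have e3 : (cE μ (cc p n) (fun y => (qf μ p n l y : ℂ)) x).re
        = (∫ y in C, qf μ p n l y ∂μ) / mc μ p n x := by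
      unfold cE
      rw [integral_complex_ofReal, ← Complex.ofReal_inv, ← Complex.ofReal_mul, Complex.ofReal_re]
      unfold mc; rw [div_eq_inv_mul]
    simp only [e2, e3]
    rw [← Finset.sum_div, ← mul_div_assoc, div_le_iff₀ (by positivity)]
    refine hk.trans (le_of_eq ?_)
    field_simp
  · intro y y' hyy
    apply hK
    · have hy := cc_add_tn (p := p) l (tn p n y)
      have hy' := cc_add_tn (p := p) l (tn p n y')
      rw [fract_tn] at hy hy'
      set W := cc p l (tn p n y) with hW
      set W' := cc p l (tn p n y') with hW'
      have hpl : (0:ℝ) < (p:ℝ) ^ l := by positivity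
      have a1 := tn_nonneg (p := p) l (tn p n y)
      have a2 := tn_nonneg (p := p) l (tn p n y')
      have a3 := tn_lt_one (p := p) l (tn p n y)
      have a4 := tn_lt_one (p := p) l (tn p n y')
      have : (1:ℝ) ≤ (p:ℝ) ^ l * |tn p n y - tn p n y'| := by
        rw [← abs_of_pos hpl, ← abs_mul, mul_sub, hy, hy']
        rcases le_abs.1 hyy with h | h
        · have : (2:ℝ) ≤ (W':ℝ) - W := by exact_mod_cast h
          rw [le_abs]; right; linarith
        · have : (2:ℝ) ≤ -((W':ℝ) - W) := by exact_mod_cast h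
          rw [le_abs]; left; linarith
      rw [inv_le_iff_one_le_mul₀' hpl]; exact this
    · have a1 := tn_nonneg (p := p) n y
      have a2 := tn_nonneg (p := p) n y'
      have a3 := tn_lt_one (p := p) n y
      have a4 := tn_lt_one (p := p) n y'
      rw [abs_le]; constructor <;> linarith

lemma stepC2 (hp : 2 ≤ p) (n l : ℕ) (H : ℕ) (hH : 1 ≤ H) (ξ : ℕ → ℝ) {κ : ℝ} (hκ : 0 ≤ κ)
    (hK : ∀ d : ℝ, ((p:ℝ) ^ l)⁻¹ ≤ |d| → |d| ≤ 1 →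
      ‖(1 / H : ℂ) * ∑ h ∈ Finset.range H, ee (ξ h * d)‖ ≤ κ) :
    (1 / H : ℝ) * ∑ h ∈ Finset.range H, al μ p n (fun y => ee (ξ h * y))
      ≤ κ + 3 * ∫ x, qf μ p n l x ∂μ := by
  have hem : ∀ h, Measurable fun y => ee (ξ h * tn p n y) := fun h =>
    ee_measurable.comp ((tn_measurable n).const_mul _)
  have hi : ∀ h, Integrable (fun x => ‖cE μ (cc p n) (fun y => ee (ξ h * tn p n y)) x‖ ^ 2) μ := fun h =>
    sq_norm_integrable (measurable_cE (cc_measurable n) _)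
      (cE_norm_le zero_le_one fun y => (ee_norm _).le)
  have hqm : Measurable fun y => (qf μ p n l y : ℂ) := Complex.measurable_ofReal.comp (qf_measurable hp n l)
  have hqb : ∀ y, ‖(qf μ p n l y : ℂ)‖ ≤ 1 := fun y => by
    rw [Complex.norm_real, Real.norm_of_nonneg (qf_nonneg _ _ _)]; exact qf_le_one hp _ _ _
  have hci : Integrable (fun x => cE μ (cc p n) (fun y => (qf μ p n l y : ℂ)) x) μ :=
    integrable_bdd (measurable_cE (cc_measurable n) _) (cE_norm_le zero_le_one hqb)
  have hre : ∫ x, (cE μ (cc p n) (fun y => (qf μ p n l y : ℂ)) x).re ∂μ = ∫ x, qf μ p n l x ∂μ := by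
    have h1 := integral_re hci
    simp only [RCLike.re_eq_complex_re] at h1
    rw [h1]
    have h2 := cE_orth (μ := μ) (cc_measurable (p := p) n) hqm zero_le_one hqb (k := fun _ => 1)
      (fun _ _ _ => rfl) (D := 1) (by simp)
    simp only [one_mul] at h2
    rw [h2, integral_complex_ofReal, Complex.ofReal_re]
  have hci2 : Integrable (fun x => 3 * (cE μ (cc p n) (fun y => (qf μ p n l y : ℂ)) x).re) μ :=
    hci.re.const_mul 3
  calc (1 / H : ℝ) * ∑ h ∈ Finset.range H, al μ p n (fun y => ee (ξ h * y))
      = ∫ x, (1 / H : ℝ) * ∑ h ∈ Finset.range H, ‖cE μ (cc p n) (fun y => ee (ξ h * tn p n y)) x‖ ^ 2 ∂μ := by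
        rw [integral_const_mul, integral_finsetSum _ fun h _ => hi h]; rfl
    _ ≤ ∫ x, (κ + 3 * (cE μ (cc p n) (fun y => (qf μ p n l y : ℂ)) x).re) ∂μ := by
        apply integral_mono_ae ((integrable_finsetSum _ fun h _ => hi h).const_mul _)
          ((integrable_const _).add hci2)
        filter_upwards [ae_mc_pos (μ := μ) (p := p)] with x hx
        exact stepC2_pt hp n l H hH ξ hκ hK (hx n)
    _ = κ + 3 * ∫ x, qf μ p n l x ∂μ := by
        rw [integral_add (integrable_const _) hci2, integral_const_mul, hre]; simp

end stepC2


lemma abel_bound (E : ℕ → ℂ) (hE : ∀ n, ‖E n‖ ≤ 1) (c : ℕ → ℝ) (hc : ∀ n, 0 ≤ c n)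
    (ha : ∀ n, c (n+1) ≤ c n) (n : ℕ) :
    ‖∑ h ∈ Finset.range n, (E (h+1) - E h) * c h‖ ≤ 2 * c 0 := by
  have key : ‖∑ h ∈ Finset.range n, (E (h+1) - E h) * c h - E n * c n‖ ≤ 2 * c 0 - c n := by
    induction n with
    | zero =>
      simp only [Finset.range_zero, Finset.sum_empty, zero_sub, norm_neg, norm_mul, Complex.norm_real,
        Real.norm_of_nonneg (hc 0)]
      nlinarith [hE 0, hc 0]
    | succ n ih =>
      have e : ∑ h ∈ Finset.range (n+1), (E (h+1) - E h) * c h - E (n+1) * c (n+1)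
          = (∑ h ∈ Finset.range n, (E (h+1) - E h) * c h - E n * c n) + E (n+1) * ((c n - c (n+1) : ℝ) : ℂ) := by
        rw [Finset.sum_range_succ]; push_cast; ring
      rw [e]
      refine (norm_add_le _ _).trans ?_
      have : ‖E (n+1) * ((c n - c (n+1) : ℝ) : ℂ)‖ ≤ c n - c (n+1) := by
        rw [norm_mul, Complex.norm_real, Real.norm_of_nonneg (by linarith [ha n])]
        nlinarith [hE (n+1), ha n]
      linarith
  have h2 : ‖E n * c n‖ ≤ c n := by
    rw [norm_mul, Complex.norm_real, Real.norm_of_nonneg (hc n)]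
    nlinarith [hE n, hc n]
  calc _ = ‖(∑ h ∈ Finset.range n, (E (h+1) - E h) * c h - E n * c n) + E n * c n‖ := by rw [sub_add_cancel]
    _ ≤ _ := (norm_add_le _ _).trans (by linarith)

lemma ee_taylor (a Δ : ℝ) (hΔ : 0 < Δ) (h1 : 2 * Real.pi * Δ ≤ 1) :
    ‖ee a - (ee (a + Δ) - ee a) * ((1 / Δ : ℝ) : ℂ) * (1 / (2 * Real.pi * Complex.I))‖ ≤ 2 * Real.pi * Δ := by
  have hpi := Real.pi_pos
  set z : ℂ := ((2 * Real.pi * Δ : ℝ) : ℂ) * Complex.I with hz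
  have hzn : ‖z‖ = 2 * Real.pi * Δ := by
    rw [hz, norm_mul, Complex.norm_I, mul_one, Complex.norm_real, Real.norm_of_nonneg (by positivity)]
  have hb := Complex.norm_exp_sub_one_sub_id_le (x := z) (by rw [hzn]; exact h1)
  have hz0 : z ≠ 0 := by
    rw [← norm_ne_zero_iff, hzn]; positivity
  have e1 : ee a - (ee (a + Δ) - ee a) * ((1 / Δ : ℝ) : ℂ) * (1 / (2 * Real.pi * Complex.I))
      = - ee a * (Complex.exp z - 1 - z) / z := by
    rw [ee_add]
    have : ee Δ = Complex.exp z := rfl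
    rw [this]
    have hD : (Δ : ℂ) ≠ 0 := by exact_mod_cast hΔ.ne'
    have hpc : (Real.pi : ℂ) ≠ 0 := by exact_mod_cast hpi.ne'
    have hzz : z = 2 * Real.pi * Δ * Complex.I := by rw [hz]; push_cast; ring
    rw [eq_div_iff hz0]
    have : ((1 / Δ : ℝ) : ℂ) * (1 / (2 * Real.pi * Complex.I)) * z = 1 := by
      rw [hzz]; push_cast; field_simp [Complex.I_ne_zero]
    calc (ee a - (ee a * Complex.exp z - ee a) * ((1 / Δ : ℝ) : ℂ) * (1 / (2 * Real.pi * Complex.I))) * z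
        = ee a * z - (ee a * Complex.exp z - ee a) * (((1 / Δ : ℝ) : ℂ) * (1 / (2 * Real.pi * Complex.I)) * z) := by ring
      _ = _ := by rw [this]; ring
  rw [e1, norm_div, norm_mul, norm_neg, ee_norm, one_mul, hzn, div_le_iff₀ (by positivity)]
  rw [hzn] at hb
  linarith

lemma kernel_bound {p : ℕ} (hp : 2 ≤ p) {H : ℕ} (hH : 1 ≤ H) {q Λ : ℝ} (hq : 1 + Real.log p / H ≤ q)
    (hqH : q ^ H = p) (hq2 : q - 1 ≤ p / H) (hΛ : 0 < Λ) (hs : 2 * Real.pi * Λ * p ^ 2 / H ≤ 1) :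
    ‖(1 / H : ℂ) * ∑ h ∈ Finset.range H, ee (Λ * q ^ h)‖
      ≤ 1 / (Λ * Real.log p) + 2 * Real.pi * Λ * p ^ 2 / H := by
  have hpi := Real.pi_pos
  have hH0 : (0:ℝ) < H := by exact_mod_cast hH
  have hp1 : (1:ℝ) < p := by exact_mod_cast (by omega : 1 < p)
  have hlog : 0 < Real.log p := Real.log_pos hp1
  have hq1 : 1 < q := by have : 0 < Real.log p / H := by positivity
                         linarith
  set Δ : ℕ → ℝ := fun h => Λ * q ^ h * (q - 1) with hΔ
  have hq0 : 0 < q - 1 := by linarith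
  have hqp : 0 < q := by linarith
  have hΔ0 : ∀ h, 0 < Δ h := fun h => by simp only [hΔ]; positivity
  have hΔb : ∀ h ∈ Finset.range H, 2 * Real.pi * Δ h ≤ 2 * Real.pi * Λ * p ^ 2 / H := by
    intro h hh
    have : q ^ h ≤ p := by
      rw [← hqH]; exact pow_le_pow_right₀ hq1.le (Finset.mem_range.1 hh).le
    have h3 : Δ h ≤ Λ * p * (p / H) := by
      simp only [hΔ]; gcongr
    calc 2 * Real.pi * Δ h ≤ 2 * Real.pi * (Λ * p * (p / H)) := by gcongr
      _ = _ := by field_simp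
  set E : ℕ → ℂ := fun h => ee (Λ * q ^ h)
  have hEs : ∀ h, E (h+1) = ee (Λ * q ^ h + Δ h) := by
    intro h; simp only [E, hΔ]; congr 1; ring
  have hab := abel_bound E (fun n => (ee_norm _).le) (fun h => 1 / Δ h) (fun h => by have := hΔ0 h; positivity)
    (fun h => by
      apply one_div_le_one_div_of_le (hΔ0 h)
      simp only [hΔ]
      have : q ^ h ≤ q ^ (h+1) := pow_le_pow_right₀ hq1.le (by omega)
      gcongr) H
  set I2 : ℂ := 1 / (2 * Real.pi * Complex.I) with hI2
  have hI2n : ‖I2‖ = 1 / (2 * Real.pi) := by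
    rw [hI2, norm_div, norm_mul, norm_mul, Complex.norm_I, norm_one, Complex.norm_real,
      Real.norm_of_nonneg hpi.le]; simp
  have e : ∑ h ∈ Finset.range H, E h = (∑ h ∈ Finset.range H, (E (h+1) - E h) * ((1 / Δ h : ℝ) : ℂ)) * I2
      + ∑ h ∈ Finset.range H, (E h - (E (h+1) - E h) * ((1 / Δ h : ℝ) : ℂ) * I2) := by
    rw [Finset.sum_mul, ← Finset.sum_add_distrib]
    apply Finset.sum_congr rfl; intro h _; ring
  have hb2 : ‖∑ h ∈ Finset.range H, (E h - (E (h+1) - E h) * ((1 / Δ h : ℝ) : ℂ) * I2)‖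
      ≤ H * (2 * Real.pi * Λ * p ^ 2 / H) := by
    refine (norm_sum_le _ _).trans ?_
    calc _ ≤ ∑ h ∈ Finset.range H, 2 * Real.pi * Λ * p ^ 2 / H := by
          apply Finset.sum_le_sum; intro h hh
          rw [hEs]
          exact (ee_taylor _ _ (hΔ0 h) ((hΔb h hh).trans hs)).trans (hΔb h hh)
      _ = _ := by simp
  have hb1 : ‖(∑ h ∈ Finset.range H, (E (h+1) - E h) * ((1 / Δ h : ℝ) : ℂ)) * I2‖ ≤ H * (1 / (Λ * Real.log p)) := by
    rw [norm_mul, hI2n]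
    calc _ ≤ 2 * (1 / Δ 0) * (1 / (2 * Real.pi)) := by gcongr
      _ = 1 / Δ 0 * (1 / Real.pi) := by field_simp
      _ ≤ 1 / (Λ * (Real.log p / H)) * 1 := by
          apply mul_le_mul _ _ (by positivity) (by positivity)
          · apply one_div_le_one_div_of_le (by positivity)
            simp only [hΔ, pow_zero, mul_one]
            gcongr; linarith
          · rw [div_le_one hpi]; linarith [Real.pi_gt_three]
      _ = _ := by field_simp
  rw [norm_mul, norm_div, norm_one, Complex.norm_natCast]
  show 1 / (H:ℝ) * ‖∑ h ∈ Finset.range H, E h‖ ≤ _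
  rw [one_div_mul_eq_div, div_le_iff₀ hH0, e]
  refine (norm_add_le _ _).trans ?_
  linarith

section stepC
variable {p : ℕ} {μ : Measure ℝ} [IsProbabilityMeasure μ]

lemma periodic_sum (φ : ℝ → ℝ) (H : ℕ) (hH : 1 ≤ H) (s : ℝ) :
    ∑ h ∈ Finset.range H, φ (Int.fract (s + h / H)) =
      ∑ h ∈ Finset.range H, φ (Int.fract (H * s) / H + h / H) := by
  have hH0 : (0:ℝ) < H := by exact_mod_cast hH
  set F : ℝ → ℝ := fun s => ∑ h ∈ Finset.range H, φ (Int.fract (s + h / H)) with hF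
  have hper : Function.Periodic F (1 / H) := by
    intro t
    have h1 := Finset.sum_range_succ (fun h : ℕ => φ (Int.fract (t + h / H))) H
    have h2 := Finset.sum_range_succ' (fun h : ℕ => φ (Int.fract (t + h / H))) H
    have h3 : Int.fract (t + (H:ℝ) / H) = Int.fract (t + ((0:ℕ):ℝ) / H) := by
      rw [div_self hH0.ne', Int.fract_add_one]; simp
    rw [h3] at h1
    have h4 : F (t + 1 / H) = ∑ h ∈ Finset.range H, φ (Int.fract (t + ((h+1 : ℕ) : ℝ) / H)) := by
      simp only [hF]
      apply Finset.sum_congr rfl; intro h _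
      congr 2; push_cast; field_simp; ring
    rw [h4]; simp only [hF]; linarith
  have h5 := hper.sub_zsmul_eq ⌊(H:ℝ) * s⌋ (x := s)
  have h6 : s - ⌊(H:ℝ) * s⌋ • (1 / (H:ℝ)) = Int.fract (H * s) / H := by
    rw [zsmul_eq_mul, Int.fract]; field_simp
  rw [h6] at h5
  show F s = _
  rw [← h5]
  simp only [hF]
  apply Finset.sum_congr rfl; intro h hh
  congr 1
  rw [Int.fract_eq_self]
  have hh' : (h:ℝ) + 1 ≤ H := by exact_mod_cast Finset.mem_range.1 hh
  have a := Int.fract_nonneg ((H:ℝ) * s)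
  have b := Int.fract_lt_one ((H:ℝ) * s)
  rw [← add_div]
  exact ⟨by positivity, by rw [div_lt_one hH0]; linarith⟩

lemma stepC (hp : 2 ≤ p) (hT : ∀ n, MeasurePreserving (tn p n) μ μ) (herg : Ergodic (Tmap p) μ)
    (hfr : ∀ᵐ x ∂μ, Int.fract x = x) {η : ℝ} (hη : 0 < η)
    (hJ : ∀ n, ∫ x, Jf μ p n x ∂μ ≤ 1 - 2 * η) {κ : ℝ} (hκ : 0 < κ) :
    ∃ r H : ℕ, 1 ≤ r ∧ 1 ≤ H ∧ ∀ (n : ℕ) (s : ℝ), (1 / H : ℝ) * ∑ h ∈ Finset.range H,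
      al μ p n (fun y => ee ((p:ℝ) ^ ((r:ℝ) + Int.fract (s + h / H)) * y)) ≤ κ := by
  have hpi := Real.pi_pos
  have hp1 : (1:ℝ) < p := by exact_mod_cast (by omega : 1 < p)
  have hp0 : (0:ℝ) < p := by linarith
  have hlog : 0 < Real.log p := Real.log_pos hp1
  obtain ⟨l, L, hl⟩ := stepC1 hp hT herg hfr hη hJ (show 0 < κ / 6 by positivity)
  obtain ⟨r0, hr0⟩ := pow_unbounded_of_one_lt (4 / (κ * Real.log p)) hp1
  set r := r0 + l + 1 with hr
  obtain ⟨H, hHb⟩ := exists_nat_gt (2 * Real.pi * p ^ (r+1) * p ^ 2 * (1 + 4 / κ))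
  have hHpos : (0:ℝ) < H := lt_of_le_of_lt (by positivity) hHb
  have hH : 1 ≤ H := by exact_mod_cast hHpos
  refine ⟨r, H, by omega, hH, fun n s => ?_⟩
  have hem : ∀ c : ℝ, Measurable fun y : ℝ => ee (c * y) := fun c =>
    ee_measurable.comp (measurable_id.const_mul c)
  have hper := periodic_sum (fun t => al μ p n (fun y => ee ((p:ℝ) ^ ((r:ℝ) + t) * y))) H hH s
  rw [hper]
  set s' := Int.fract ((H:ℝ) * s) / H with hs'
  have hs0 : 0 ≤ s' := div_nonneg (Int.fract_nonneg _) hHpos.le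
  have hs1 : s' ≤ 1 := by
    rw [hs', div_le_one hHpos]
    have : (1:ℝ) ≤ H := by exact_mod_cast hH
    linarith [Int.fract_lt_one ((H:ℝ) * s)]
  set q : ℝ := (p:ℝ) ^ ((1:ℝ) / H) with hq
  have hqpow : ∀ h : ℕ, q ^ h = (p:ℝ) ^ ((h:ℝ) / H) := fun h => by
    rw [hq, ← Real.rpow_natCast, ← Real.rpow_mul hp0.le]; congr 1; field_simp
  have hqH : q ^ H = p := by rw [hqpow, div_self hHpos.ne', Real.rpow_one]
  have hq1 : 1 + Real.log p / H ≤ q := by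
    rw [hq, Real.rpow_def_of_pos hp0]
    have := Real.add_one_le_exp (Real.log p * (1 / H))
    calc _ = Real.log p * (1 / H) + 1 := by ring
      _ ≤ _ := this
  have hq2 : q - 1 ≤ p / H := by
    have hq0 : 1 ≤ q := by have : 0 ≤ Real.log p / H := by positivity
                           linarith
    have := one_add_mul_le_pow (a := q - 1) (by linarith) H
    rw [add_sub_cancel, hqH] at this
    rw [le_div_iff₀ hHpos]; linarith
  set A : ℝ := (p:ℝ) ^ ((r:ℝ) + s') with hA
  have hA0 : 0 < A := Real.rpow_pos_of_pos hp0 _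
  have hAl : (p:ℝ) ^ r ≤ A := by
    rw [hA, ← Real.rpow_natCast]; exact Real.rpow_le_rpow_of_exponent_le hp1.le (by linarith)
  have hAu : A ≤ (p:ℝ) ^ (r+1) := by
    rw [hA, ← Real.rpow_natCast]; exact Real.rpow_le_rpow_of_exponent_le hp1.le (by push_cast; linarith)
  have hξ : ∀ h : ℕ, (p:ℝ) ^ ((r:ℝ) + (s' + h / H)) = A * q ^ h := fun h => by
    rw [hqpow, hA, ← Real.rpow_add hp0]; congr 1; ring
  have hsmall : ∀ Λ : ℝ, 0 < Λ → Λ ≤ A → 2 * Real.pi * Λ * p ^ 2 / H * (1 + 4 / κ) ≤ 1 := by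
    intro Λ h0 h1
    rw [div_mul_eq_mul_div, div_le_one hHpos]
    refine le_trans ?_ hHb.le
    gcongr
    exact h1.trans hAu
  have hKpos : ∀ d : ℝ, 0 < d → ((p:ℝ) ^ l)⁻¹ ≤ d → d ≤ 1 →
      ‖(1 / H : ℂ) * ∑ h ∈ Finset.range H, ee (A * q ^ h * d)‖ ≤ κ / 2 := by
    intro d hd0 hd1 hd2
    have hΛA : A * d ≤ A := by nlinarith
    have hsm := hsmall (A * d) (by positivity) hΛA
    have hX : 0 ≤ 2 * Real.pi * (A * d) * p ^ 2 / H := by positivity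
    have hk4 : 0 < 4 / κ := by positivity
    have hs1' : 2 * Real.pi * (A * d) * p ^ 2 / H ≤ 1 := by nlinarith
    have hs2' : 2 * Real.pi * (A * d) * p ^ 2 / H ≤ κ / 4 := by
      have : 2 * Real.pi * (A * d) * p ^ 2 / H * (4 / κ) ≤ 1 := by nlinarith
      calc _ = 2 * Real.pi * (A * d) * p ^ 2 / H * (4 / κ) * (κ / 4) := by field_simp
        _ ≤ 1 * (κ / 4) := by gcongr
        _ = _ := one_mul _
    have hb := kernel_bound hp hH hq1 hqH hq2 (show 0 < A * d by positivity) hs1'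
    have hΛl : 4 / (κ * Real.log p) ≤ A * d := by
      calc 4 / (κ * Real.log p) ≤ (p:ℝ) ^ r0 := hr0.le
        _ ≤ (p:ℝ) ^ (r0 + 1) := pow_le_pow_right₀ hp1.le (by omega)
        _ = (p:ℝ) ^ r * ((p:ℝ) ^ l)⁻¹ := by
            rw [hr, show r0 + l + 1 = (r0 + 1) + l by ring, pow_add _ (r0+1) l]; field_simp
        _ ≤ A * d := by gcongr
    have h3 : 1 / (A * d * Real.log p) ≤ κ / 4 := by
      rw [div_le_iff₀ (by positivity)]
      rw [div_le_iff₀ (by positivity)] at hΛl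
      linarith
    have e : ∀ h : ℕ, A * q ^ h * d = A * d * q ^ h := fun h => by ring
    simp only [e]
    linarith
  have hK : ∀ d : ℝ, ((p:ℝ) ^ l)⁻¹ ≤ |d| → |d| ≤ 1 →
      ‖(1 / H : ℂ) * ∑ h ∈ Finset.range H, ee ((fun h : ℕ => A * q ^ h) h * d)‖ ≤ κ / 2 := by
    intro d hd1 hd2
    have hd0 : 0 < |d| := lt_of_lt_of_le (by positivity) hd1
    rcases abs_choice d with h | h
    · rw [h] at hd0 hd1 hd2
      exact hKpos d hd0 hd1 hd2
    · rw [h] at hd0 hd1 hd2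
      have := hKpos (-d) hd0 hd1 hd2
      have e : (1 / H : ℂ) * ∑ h ∈ Finset.range H, ee ((fun h : ℕ => A * q ^ h) h * d)
          = (starRingEnd ℂ) ((1 / H : ℂ) * ∑ h ∈ Finset.range H, ee (A * q ^ h * -d)) := by
        rw [map_mul, map_sum]
        congr 1
        · simp
        · apply Finset.sum_congr rfl; intro h _
          rw [← ee_neg]; congr 1; ring
      rw [e, Complex.norm_conj]; exact this
  have hC2 := stepC2 (μ := μ) hp (max n L) l H hH (fun h => A * q ^ h) (by positivity) hK
  have hq3 := hl (max n L) (le_max_right _ _)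
  simp only [hξ]
  have hmono : (1 / H : ℝ) * ∑ h ∈ Finset.range H, al μ p n (fun y => ee (A * q ^ h * y))
      ≤ (1 / H : ℝ) * ∑ h ∈ Finset.range H, al μ p (max n L) (fun y => ee (A * q ^ h * y)) := by
    apply mul_le_mul_of_nonneg_left _ (by positivity)
    apply Finset.sum_le_sum; intro h _
    exact al_mono hp hT (hem _) (fun y => (ee_norm _).le) (le_max_left n L)
  linarith

end stepC


section LLN
variable {μ : Measure ℝ} [IsProbabilityMeasure μ]

lemma cheb {X : ℝ → ℂ} (hX : Measurable X) {B : ℝ} (hB : ∀ x, ‖X x‖ ≤ B) {V t : ℝ} (ht : 0 < t)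
    (hV : ∫ x, ‖X x‖ ^ 2 ∂μ ≤ V) : μ.real {x | t < ‖X x‖} ≤ V / t ^ 2 := by
  have hi : Integrable (fun x => ‖X x‖ ^ 2) μ := by
    apply integrable_bddR (hX.norm.pow_const 2) (C := B ^ 2)
    intro x; rw [norm_pow, norm_norm]; gcongr; exact hB x
  have h := mul_meas_ge_le_integral_of_nonneg (μ := μ) (f := fun x => ‖X x‖ ^ 2)
    (Eventually.of_forall fun x => by positivity) hi (t ^ 2)
  rw [le_div_iff₀ (by positivity)]
  have hs : μ.real {x | t < ‖X x‖} ≤ μ.real {x | t ^ 2 ≤ ‖X x‖ ^ 2} := by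
    apply measureReal_mono _ (measure_ne_top _ _)
    intro x hx
    simp only [mem_ofPred_eq] at hx ⊢
    gcongr
  calc μ.real {x | t < ‖X x‖} * t ^ 2 ≤ μ.real {x | t ^ 2 ≤ ‖X x‖ ^ 2} * t ^ 2 := by gcongr
    _ ≤ _ := by rw [mul_comm]; exact h.trans hV

/-- number `N0` depends only on `C, ε, η` -/
lemma LLN_fin (C : ℝ) (hC : 0 ≤ C) {ε η : ℝ} (hε : 0 < ε) (hη : 0 < η) :
    ∃ N0 : ℕ, ∀ (D : ℕ → ℝ → ℂ), (∀ i, Measurable (D i)) → (∀ i x, ‖D i x‖ ≤ 2) →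
      (∀ N : ℕ, ∫ x, ‖∑ i ∈ Finset.range N, D i x‖ ^ 2 ∂μ ≤ C * N) → ∀ N1 : ℕ,
      μ.real {x | ∃ N, N0 ≤ N ∧ N ≤ N1 ∧ ε * N < ‖∑ i ∈ Finset.range N, D i x‖} ≤ η := by
  obtain ⟨l0, hl0⟩ := exists_nat_gt (8 / ε + 8 * C / (ε ^ 2 * η) + 2)
  have h8 : 0 < 8 / ε := by positivity
  have hCη : 0 ≤ 8 * C / (ε ^ 2 * η) := by positivity
  have hl2 : (2:ℝ) < l0 := by linarith
  have hl2' : 2 < l0 := by exact_mod_cast hl2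
  refine ⟨l0 ^ 2, fun D hD hD2 hV N1 => ?_⟩
  set X : ℕ → ℝ → ℂ := fun N x => ∑ i ∈ Finset.range N, D i x
  have hXm : ∀ N, Measurable (X N) := fun N => Finset.measurable_sum _ fun i _ => hD i
  have hXb : ∀ N x, ‖X N x‖ ≤ 2 * N := fun N x => by
    refine (norm_sum_le _ _).trans ?_
    calc _ ≤ ∑ i ∈ Finset.range N, (2:ℝ) := Finset.sum_le_sum fun i _ => hD2 i x
      _ = _ := by simp [mul_comm]
  have hsub : {x | ∃ N, l0 ^ 2 ≤ N ∧ N ≤ N1 ∧ ε * N < ‖∑ i ∈ Finset.range N, D i x‖}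
      ⊆ ⋃ l ∈ Finset.Ioc (l0 - 1) (N1 + l0), {x | ε / 2 * (l:ℝ) ^ 2 < ‖X (l ^ 2) x‖} := by
    rintro x ⟨N, hN0, hN1, hx⟩
    simp only [mem_iUnion, exists_prop]
    set l := Nat.sqrt N with hl
    have hll : l ^ 2 ≤ N := by rw [sq]; exact Nat.sqrt_le N
    have hlu : N ≤ l ^ 2 + 2 * l := by have := Nat.sqrt_le_add N; rw [← hl] at this; nlinarith
    have hl0l : l0 ≤ l := by rw [hl, Nat.le_sqrt, ← sq]; exact hN0
    refine ⟨l, Finset.mem_Ioc.2 ⟨by omega, (Nat.sqrt_le_self N).trans (by omega)⟩, ?_⟩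
    show ε / 2 * (l:ℝ) ^ 2 < ‖X (l ^ 2) x‖
    have hdiff : ‖X N x - X (l ^ 2) x‖ ≤ 2 * (2 * l) := by
      have e : X N x - X (l ^ 2) x = ∑ i ∈ Finset.Ico (l ^ 2) N, D i x := by
        rw [Finset.sum_Ico_eq_sub _ hll]
      rw [e]
      refine (norm_sum_le _ _).trans ?_
      calc _ ≤ ∑ i ∈ Finset.Ico (l ^ 2) N, (2:ℝ) := Finset.sum_le_sum fun i _ => hD2 i x
        _ = ((N - l ^ 2 : ℕ) : ℝ) * 2 := by simp
        _ ≤ ((2 * l : ℕ) : ℝ) * 2 := by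
            have : N - l ^ 2 ≤ 2 * l := by omega
            gcongr
        _ = _ := by push_cast; ring
    have h1 : ‖X N x‖ ≤ ‖X N x - X (l ^ 2) x‖ + ‖X (l ^ 2) x‖ := by
      have := norm_add_le (X N x - X (l ^ 2) x) (X (l ^ 2) x); rwa [sub_add_cancel] at this
    have h2 : ε * (l:ℝ) ^ 2 ≤ ε * N := by
      have : ((l:ℝ)) ^ 2 ≤ N := by exact_mod_cast hll
      gcongr
    have h3 : 8 ≤ ε * l := by
      have : 8 / ε ≤ l := by
        have : (l0:ℝ) ≤ l := by exact_mod_cast hl0l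
        linarith
      rw [div_le_iff₀ hε] at this; linarith
    have hlp : (0:ℝ) ≤ l := by positivity
    have hx' : ε * N < ‖X N x‖ := hx
    nlinarith
  have hl1 : (0:ℝ) < l0 - 1 := by linarith
  calc μ.real {x | ∃ N, l0 ^ 2 ≤ N ∧ N ≤ N1 ∧ ε * N < ‖∑ i ∈ Finset.range N, D i x‖}
      ≤ μ.real (⋃ l ∈ Finset.Ioc (l0 - 1) (N1 + l0), {x | ε / 2 * (l:ℝ) ^ 2 < ‖X (l ^ 2) x‖}) :=
        measureReal_mono hsub (measure_ne_top _ _)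
    _ ≤ ∑ l ∈ Finset.Ioc (l0 - 1) (N1 + l0), μ.real {x | ε / 2 * (l:ℝ) ^ 2 < ‖X (l ^ 2) x‖} :=
        measureReal_biUnion_finset_le _ _
    _ ≤ ∑ l ∈ Finset.Ioc (l0 - 1) (N1 + l0), 4 * C / ε ^ 2 * ((l:ℝ) ^ 2)⁻¹ := by
        apply Finset.sum_le_sum; intro l hl
        have hl' := Finset.mem_Ioc.1 hl
        have hlp : (0:ℝ) < l := by exact_mod_cast (by omega : 0 < l)
        have := cheb (μ := μ) (hXm (l ^ 2)) (hXb (l ^ 2)) (t := ε / 2 * (l:ℝ) ^ 2) (by positivity) (hV (l ^ 2))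
        refine this.trans (le_of_eq ?_)
        push_cast
        field_simp
        norm_num
    _ = 4 * C / ε ^ 2 * ∑ l ∈ Finset.Ioc (l0 - 1) (N1 + l0), ((l:ℝ) ^ 2)⁻¹ := by rw [Finset.mul_sum]
    _ ≤ 4 * C / ε ^ 2 * (((l0 - 1 : ℕ) : ℝ)⁻¹ - ((N1 + l0 : ℕ) : ℝ)⁻¹) := by
        gcongr
        exact sum_Ioc_inv_sq_le_sub (by omega) (by omega)
    _ ≤ 4 * C / ε ^ 2 * ((l0 - 1 : ℕ) : ℝ)⁻¹ := by
        gcongr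
        have : 0 ≤ ((N1 + l0 : ℕ) : ℝ)⁻¹ := by positivity
        linarith
    _ ≤ η := by
        rw [Nat.cast_sub (by omega), Nat.cast_one, ← div_eq_mul_inv, div_le_iff₀ hl1]
        have h4 : 8 * C / (ε ^ 2 * η) ≤ l0 - 1 := by linarith
        rw [div_le_iff₀ (by positivity)] at h4
        rw [div_le_iff₀ (by positivity)]
        nlinarith
end LLN

section stepA
variable {p : ℕ} {μ : Measure ℝ} [IsProbabilityMeasure μ]

lemma corr_bound (hp : 2 ≤ p) {Z : ℕ → ℝ → ℂ} (hZ : ∀ i, Measurable (Z i)) (hZ1 : ∀ i x, ‖Z i x‖ ≤ 1)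
    {n : ℕ → ℕ} {i j : ℕ} (hn : n i ≤ n j) {δ : ℝ} (hδ : 0 ≤ δ)
    (hosc : ∀ x y, cc p (n j) x = cc p (n j) y → ‖Z i x - Z i y‖ ≤ δ) :
    ‖∫ x, (Z i x - cE μ (cc p (n i)) (Z i) x) * (starRingEnd ℂ) (Z j x - cE μ (cc p (n j)) (Z j) x) ∂μ‖
      ≤ 2 * δ := by
  set Di : ℝ → ℂ := fun x => Z i x - cE μ (cc p (n i)) (Z i) x
  set Dj : ℝ → ℂ := fun x => Z j x - cE μ (cc p (n j)) (Z j) x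
  have hcb : ∀ (a b : ℕ) x, ‖cE μ (cc p (n a)) (Z b) x‖ ≤ 1 := fun a b x => cE_norm_le zero_le_one (hZ1 b) x
  have hDim : Measurable Di := (hZ i).sub (measurable_cE (cc_measurable _) _)
  have hDjm : Measurable Dj := (hZ j).sub (measurable_cE (cc_measurable _) _)
  have hDib : ∀ x, ‖Di x‖ ≤ 2 := fun x => (norm_sub_le _ _).trans (by linarith [hZ1 i x, hcb i i x])
  have hDjb : ∀ x, ‖Dj x‖ ≤ 2 := fun x => (norm_sub_le _ _).trans (by linarith [hZ1 j x, hcb j j x])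
  set k : ℝ → ℂ := cE μ (cc p (n j)) Di with hk
  have hkm : Measurable k := measurable_cE (cc_measurable _) _
  have hkb : ∀ x, ‖k x‖ ≤ 2 := cE_norm_le (by norm_num) hDib
  have hkc : ∀ x y, cc p (n j) x = cc p (n j) y → k x = k y := fun x y h => cE_congr h
  -- k is orthogonal to Dj
  have hstar : ∀ f : ℝ → ℂ, Measurable f → Measurable fun x => (starRingEnd ℂ) (f x) := fun f hf =>
    Complex.continuous_conj.measurable.comp hf
  have horth : ∫ x, k x * (starRingEnd ℂ) (Dj x) ∂μ = 0 := by
    have h1 := cE_orth (μ := μ) (cc_measurable (p := p) (n j)) (hZ j) zero_le_one (hZ1 j)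
      (k := fun x => (starRingEnd ℂ) (k x)) (fun x y h => by rw [hkc x y h]) (D := 2)
      (fun x => by rw [Complex.norm_conj]; exact hkb x)
    have hi1 : Integrable (fun x => (starRingEnd ℂ) (k x) * Z j x) μ :=
      integrable_bdd ((hstar k hkm).mul (hZ j)) (C := 2) fun x => by
        simp only [Pi.mul_apply, norm_mul, Complex.norm_conj]; nlinarith [hkb x, hZ1 j x, norm_nonneg (k x), norm_nonneg (Z j x)]
    have hi2 : Integrable (fun x => (starRingEnd ℂ) (k x) * cE μ (cc p (n j)) (Z j) x) μ :=
      integrable_bdd ((hstar k hkm).mul (measurable_cE (cc_measurable _) _)) (C := 2) fun x => by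
        simp only [Pi.mul_apply, norm_mul, Complex.norm_conj]
        nlinarith [hkb x, hcb j j x, norm_nonneg (k x), norm_nonneg (cE μ (cc p (n j)) (Z j) x)]
    have h2 : ∫ x, (starRingEnd ℂ) (k x) * Dj x ∂μ = 0 := by
      have : ∀ x, (starRingEnd ℂ) (k x) * Dj x = (starRingEnd ℂ) (k x) * Z j x
          - (starRingEnd ℂ) (k x) * cE μ (cc p (n j)) (Z j) x := fun x => by simp only [Dj]; ring
      simp only [this]
      rw [integral_sub hi1 hi2, h1, sub_self]
    have h3 := congrArg (starRingEnd ℂ) h2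
    rw [← integral_conj] at h3
    simpa using h3
  have hI1 : Integrable (fun x => Di x * (starRingEnd ℂ) (Dj x)) μ :=
    integrable_bdd (hDim.mul (hstar _ hDjm)) (C := 4) fun x => by
      simp only [Pi.mul_apply, norm_mul, Complex.norm_conj]; nlinarith [hDib x, hDjb x, norm_nonneg (Di x), norm_nonneg (Dj x)]
  have hI2 : Integrable (fun x => k x * (starRingEnd ℂ) (Dj x)) μ :=
    integrable_bdd (hkm.mul (hstar _ hDjm)) (C := 4) fun x => by
      simp only [Pi.mul_apply, norm_mul, Complex.norm_conj]; nlinarith [hkb x, hDjb x, norm_nonneg (k x), norm_nonneg (Dj x)]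
  have e : ∫ x, Di x * (starRingEnd ℂ) (Dj x) ∂μ = ∫ x, (Di x - k x) * (starRingEnd ℂ) (Dj x) ∂μ := by
    have : ∀ x, (Di x - k x) * (starRingEnd ℂ) (Dj x) = Di x * (starRingEnd ℂ) (Dj x) - k x * (starRingEnd ℂ) (Dj x) :=
      fun x => by ring
    simp only [this]
    rw [integral_sub hI1 hI2, horth, sub_zero]
  rw [e]
  refine (norm_integral_le_of_norm_le (integrable_const (2 * δ)) ?_).trans (by simp)
  filter_upwards [ae_cell_pos (μ := μ) (cc_measurable (p := p) (n j))] with x hx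
  have ho : ‖k x - Di x‖ ≤ δ := by
    apply cE_osc (cc_measurable _) (integrable_bdd hDim hDib) hx
    intro y hy
    have h1 : cE μ (cc p (n i)) (Z i) y = cE μ (cc p (n i)) (Z i) x := cE_congr (cc_split_of_le hp hn hy)
    have : Di y - Di x = Z i y - Z i x := by simp only [Di]; rw [h1]; ring
    rw [this]; exact hosc y x hy
  rw [norm_mul, Complex.norm_conj, norm_sub_rev]
  nlinarith [hDjb x, norm_nonneg (k x - Di x), norm_nonneg (Dj x)]

lemma geom_sum_half (N : ℕ) : ∑ i ∈ Finset.range N, ((1:ℝ)/2) ^ (N - i) ≤ 1 := by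
  have : ∑ i ∈ Finset.range N, ((1:ℝ)/2) ^ (N - i) = 1 - (1/2) ^ N := by
    induction N with
    | zero => simp
    | succ N ih =>
      rw [Finset.sum_range_succ]
      have : ∑ i ∈ Finset.range N, ((1:ℝ)/2) ^ (N + 1 - i) = (1/2) * ∑ i ∈ Finset.range N, ((1:ℝ)/2) ^ (N - i) := by
        rw [Finset.mul_sum]; apply Finset.sum_congr rfl; intro i hi
        rw [Nat.sub_add_comm (Finset.mem_range.1 hi).le, pow_succ]; ring
      rw [this, ih]
      simp; ring
  rw [this]; have : (0:ℝ) ≤ (1/2) ^ N := by positivity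
  linarith

lemma var_bound (hp : 2 ≤ p) {Z : ℕ → ℝ → ℂ} (hZ : ∀ i, Measurable (Z i)) (hZ1 : ∀ i x, ‖Z i x‖ ≤ 1)
    {n : ℕ → ℕ} (hn : Monotone n) {C0 : ℝ} (hC0 : 0 ≤ C0)
    (hosc : ∀ i j, i < j → ∀ x y, cc p (n j) x = cc p (n j) y → ‖Z i x - Z i y‖ ≤ C0 * (1/2) ^ (j - i)) (N : ℕ) :
    ∫ x, ‖∑ i ∈ Finset.range N, (Z i x - cE μ (cc p (n i)) (Z i) x)‖ ^ 2 ∂μ ≤ (4 * C0 + 4) * N := by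
  set D : ℕ → ℝ → ℂ := fun i x => Z i x - cE μ (cc p (n i)) (Z i) x
  have hDm : ∀ i, Measurable (D i) := fun i => (hZ i).sub (measurable_cE (cc_measurable _) _)
  have hDb : ∀ i x, ‖D i x‖ ≤ 2 := fun i x => (norm_sub_le _ _).trans
    (by linarith [hZ1 i x, cE_norm_le (μ := μ) (c := cc p (n i)) zero_le_one (hZ1 i) x])
  show ∫ x, ‖∑ i ∈ Finset.range N, D i x‖ ^ 2 ∂μ ≤ _
  have hXm : ∀ N, Measurable (fun x => ∑ i ∈ Finset.range N, D i x) := fun N =>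
    Finset.measurable_sum _ fun i _ => hDm i
  have hXb : ∀ (N : ℕ) x, ‖∑ i ∈ Finset.range N, D i x‖ ≤ 2 * N := fun N x => by
    refine (norm_sum_le _ _).trans ?_
    calc _ ≤ ∑ i ∈ Finset.range N, (2:ℝ) := Finset.sum_le_sum fun i _ => hDb i x
      _ = _ := by simp [mul_comm]
  have hXi : ∀ N : ℕ, Integrable (fun x => ‖∑ i ∈ Finset.range N, D i x‖ ^ 2) μ := fun N => by
    apply integrable_bddR ((hXm N).norm.pow_const 2) (C := (2 * N) ^ 2)
    intro x; rw [norm_pow, norm_norm]; gcongr; exact hXb N x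
  have hDi : ∀ N : ℕ, Integrable (fun x => ‖D N x‖ ^ 2) μ := fun N => by
    apply integrable_bddR ((hDm N).norm.pow_const 2) (C := 2 ^ 2)
    intro x; rw [norm_pow, norm_norm]; gcongr; exact hDb N x
  have hDD : ∀ i j, Integrable (fun x => D i x * (starRingEnd ℂ) (D j x)) μ := fun i j =>
    integrable_bdd ((hDm i).mul (Complex.continuous_conj.measurable.comp (hDm j))) (C := 4) fun x => by
      simp only [Pi.mul_apply, norm_mul, Function.comp_apply, Complex.norm_conj]
      nlinarith [hDb i x, hDb j x, norm_nonneg (D i x), norm_nonneg (D j x)]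
  induction N with
  | zero => simp
  | succ N ih =>
    have hsum : Integrable (fun x => ∑ i ∈ Finset.range N, D i x * (starRingEnd ℂ) (D N x)) μ :=
      integrable_finsetSum _ fun i _ => hDD i N
    have hre : Integrable (fun x => 2 * (∑ i ∈ Finset.range N, D i x * (starRingEnd ℂ) (D N x)).re) μ :=
      hsum.re.const_mul 2
    have e : ∀ x, ‖∑ i ∈ Finset.range (N+1), D i x‖ ^ 2 = ‖∑ i ∈ Finset.range N, D i x‖ ^ 2 +
        2 * (∑ i ∈ Finset.range N, D i x * (starRingEnd ℂ) (D N x)).re + ‖D N x‖ ^ 2 := by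
      intro x
      rw [Finset.sum_range_succ, ← Complex.normSq_eq_norm_sq, Complex.normSq_add, Complex.normSq_eq_norm_sq,
        Complex.normSq_eq_norm_sq, ← Finset.sum_mul]
      ring
    have h12 : Integrable (fun x => ‖∑ i ∈ Finset.range N, D i x‖ ^ 2 +
        2 * (∑ i ∈ Finset.range N, D i x * (starRingEnd ℂ) (D N x)).re) μ := (hXi N).add hre
    simp only [e]
    rw [integral_add h12 (hDi N), integral_add (hXi N) hre, integral_const_mul]
    have h1 : ∫ x, (∑ i ∈ Finset.range N, D i x * (starRingEnd ℂ) (D N x)).re ∂μ ≤ 2 * C0 := by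
      have h1 := integral_re hsum
      simp only [RCLike.re_eq_complex_re] at h1
      rw [h1]
      refine (Complex.re_le_norm _).trans ?_
      rw [integral_finsetSum _ fun i _ => hDD i N]
      refine (norm_sum_le _ _).trans ?_
      calc _ ≤ ∑ i ∈ Finset.range N, 2 * (C0 * (1/2) ^ (N - i)) := by
            apply Finset.sum_le_sum; intro i hi
            have hi' := Finset.mem_range.1 hi
            exact corr_bound hp hZ hZ1 (hn hi'.le) (by positivity) (hosc i N hi')
        _ = 2 * C0 * ∑ i ∈ Finset.range N, ((1:ℝ)/2) ^ (N - i) := by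
            rw [Finset.mul_sum]; apply Finset.sum_congr rfl; intros; ring
        _ ≤ 2 * C0 * 1 := by gcongr; exact geom_sum_half N
        _ = _ := mul_one _
    have h2 : ∫ x, ‖D N x‖ ^ 2 ∂μ ≤ 4 := by
      calc _ ≤ ∫ x, (4:ℝ) ∂μ := by
            apply integral_mono (hDi N) (integrable_const _)
            intro x
            show ‖D N x‖ ^ 2 ≤ 4
            nlinarith [hDb N x, norm_nonneg (D N x)]
        _ = 4 := by simp
    push_cast
    linarith

end stepA


section stepA
variable {p : ℕ} {μ : Measure ℝ} [IsProbabilityMeasure μ]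

/-- conditional energy at level `n` of the frequency `β` -/
noncomputable def vv (μ : Measure ℝ) (p n : ℕ) (β : ℝ) (x : ℝ) : ℝ :=
  ‖cE μ (cc p n) (fun y => ee (β * Int.fract y)) x‖ ^ 2

lemma vv_nonneg (n : ℕ) (β x : ℝ) : 0 ≤ vv μ p n β x := sq_nonneg _
lemma vv_le_one (n : ℕ) (β x : ℝ) : vv μ p n β x ≤ 1 :=
  pow_le_one₀ (norm_nonneg _) (cE_norm_le zero_le_one (fun y => (ee_norm _).le) x)
lemma vv_measurable (n : ℕ) (β : ℝ) : Measurable (vv μ p n β) :=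
  (measurable_cE (cc_measurable n) _).norm.pow_const 2
lemma vv_integrable (n : ℕ) (β : ℝ) : Integrable (vv μ p n β) μ :=
  integrable_bddR (vv_measurable n β) (C := 1) fun x => by
    rw [Real.norm_of_nonneg (vv_nonneg _ _ _)]; exact vv_le_one _ _ _

lemma vv_integral (hp : 2 ≤ p) (n : ℕ) (β : ℝ) :
    ∫ x, vv μ p n β x ∂μ = al μ p n (fun y => ee (β / (p:ℝ) ^ n * y)) := by
  unfold vv al
  simp only [phase hp n β]

lemma vv_shift (hp : 2 ≤ p) (K n : ℕ) (β x : ℝ) :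
    ‖cE μ (cc p (K + n)) (fun y => ee (β * tn p K y)) x‖ ^ 2 = vv μ p (K + n) (β * (p:ℝ) ^ K) x := by
  unfold vv
  have e : (fun y => ee (β * (p:ℝ) ^ K * Int.fract y)) = fun y => ee (β * cc p K y) * ee (β * tn p K y) := by
    funext y
    rw [← ee_add, mul_assoc, cc_add_tn, mul_add]
  rw [e, cE_pull (cc_measurable _) (k := fun y => ee (β * cc p K y))
    (fun x y h => by simp only [cc_split_of_le hp (by omega : K ≤ K + n) h]), norm_mul, ee_norm, one_mul]

lemma inv_pow_le_half (hp : 2 ≤ p) {a b : ℕ} (h : b ≤ a) : ((p:ℝ) ^ a)⁻¹ ≤ (1/2) ^ b := by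
  have hp2 : (2:ℝ) ≤ p := by exact_mod_cast hp
  rw [one_div, inv_pow]
  apply inv_anti₀ (by positivity)
  calc (2:ℝ) ^ b ≤ 2 ^ a := pow_le_pow_right₀ (by norm_num) h
    _ ≤ (p:ℝ) ^ a := pow_le_pow_left₀ (by norm_num) hp2 _

lemma stepA (hp : 2 ≤ p) (hT : ∀ n, MeasurePreserving (tn p n) μ μ) {ε η : ℝ} (hε : 0 < ε) (hη : 0 < η)
    (r : ℕ) {Lg : ℝ} (hLg : 0 ≤ Lg) : ∃ N00 : ℕ, ∀ N0 : ℕ, N00 ≤ N0 → ∀ (β : ℕ → ℝ) (n : ℕ → ℕ) (s R : ℕ) (ζ : ℕ → ℂ) (g : ℝ → ℂ),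
    (∀ i, 0 ≤ β i) → (∀ i, β i ≤ (p:ℝ) ^ (r+1) * (p:ℝ) ^ (n i)) → (∀ i, n i + 1 ≤ n (i+1)) →
    (∀ i, i + s + R ≤ n i) → Lg * ((p:ℝ) ^ R)⁻¹ ≤ ε → (∀ i, ‖ζ i‖ ≤ 1) → (∀ x, ‖g x‖ ≤ 1) →
    (∀ x y, ‖g x - g y‖ ≤ Lg * |x - y|) → Measurable g → ∀ K N1 : ℕ,
    μ.real {x | ∃ N, N0 ≤ N ∧ N ≤ N1 ∧ 4 * ε * N <
        ‖∑ i ∈ Finset.range N, ζ i * ee (β i * Int.fract x) * g (tn p (i + s) x)‖}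
      ≤ η + μ.real {x | ∃ N, N0 ≤ N ∧ N ≤ N1 ∧ 4 * ε ^ 2 * N ≤
        ∑ i ∈ Finset.range N, vv μ p (K + n i) (β i * (p:ℝ) ^ K) x} := by
  have hpi := Real.pi_pos
  have hp0 : (0:ℝ) < p := by positivity
  have hp1 : (1:ℝ) ≤ p := by exact_mod_cast (by omega : 1 ≤ p)
  set C0 : ℝ := 2 * Real.pi * (p:ℝ) ^ (r+1) + Lg with hC0
  have hC00 : 0 ≤ C0 := by positivity
  obtain ⟨N00, hN00⟩ := LLN_fin (μ := μ) (4 * C0 + 4) (by positivity) hε hη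
  refine ⟨N00, fun N0 hN0 β n s R ζ g hβ0 hβ hn hnR hR hζ hg1 hgL hgm K N1 => ?_⟩
  have hnmono : Monotone n := monotone_nat_of_le_succ fun i => by have := hn i; omega
  have hnj : ∀ i j, i ≤ j → n i + (j - i) ≤ n j := by
    intro i j hij
    obtain ⟨d, rfl⟩ := Nat.exists_eq_add_of_le hij
    induction d with
    | zero => simp
    | succ d ih => have h1 := ih (by omega); have h2 := hn (i + d); rw [← add_assoc]; omega
  set Z : ℕ → ℝ → ℂ := fun i x => ζ i * ee (β i * tn p K x) * g (tn p (K + (i + s)) x) with hZ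
  have hZm : ∀ i, Measurable (Z i) := fun i =>
    ((ee_measurable.comp ((tn_measurable K).const_mul _)).const_mul _).mul (hgm.comp (tn_measurable _))
  have hZ1 : ∀ i x, ‖Z i x‖ ≤ 1 := fun i x => by
    simp only [hZ, norm_mul, ee_norm, mul_one]
    nlinarith [hζ i, hg1 (tn p (K + (i + s)) x), norm_nonneg (ζ i), norm_nonneg (g (tn p (K + (i + s)) x))]
  have hgosc : ∀ i k, i + s + k ≤ n i + k → ∀ (N : ℕ), i + s ≤ N → ∀ x y, cc p (K + N) x = cc p (K + N) y →
      ‖g (tn p (K + (i + s)) x) - g (tn p (K + (i + s)) y)‖ ≤ Lg * ((p:ℝ) ^ (N - (i + s)))⁻¹ := by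
    intro i k _ N hN x y h
    refine (hgL _ _).trans ?_
    gcongr
    apply tn_close hp
    rw [show K + (i + s) + (N - (i + s)) = K + N by omega]; exact h
  have hosc : ∀ i j, i < j → ∀ x y, cc p (K + n j) x = cc p (K + n j) y →
      ‖Z i x - Z i y‖ ≤ C0 * (1/2) ^ (j - i) := by
    intro i j hij x y h
    have h1 : ‖ee (β i * tn p K x) - ee (β i * tn p K y)‖ ≤ 2 * Real.pi * (p:ℝ) ^ (r+1) * (1/2) ^ (j - i) := by
      refine (ee_lip _ _).trans ?_
      rw [← mul_sub, abs_mul, abs_of_nonneg (hβ0 i)]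
      have h2 : |tn p K x - tn p K y| ≤ ((p:ℝ) ^ (n j))⁻¹ := tn_close hp h
      have h3 : (p:ℝ) ^ n i * ((p:ℝ) ^ n j)⁻¹ ≤ (1/2) ^ (j - i) := by
        have e : (p:ℝ) ^ n i * ((p:ℝ) ^ n j)⁻¹ = ((p:ℝ) ^ (n j - n i))⁻¹ := by
          have : n j = n i + (n j - n i) := by have := hnj i j hij.le; omega
          rw [this, pow_add]; simp only [Nat.add_sub_cancel_left]; field_simp
        rw [e]; exact inv_pow_le_half hp (by have := hnj i j hij.le; omega)
      calc 2 * Real.pi * (β i * |tn p K x - tn p K y|)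
          ≤ 2 * Real.pi * ((p:ℝ) ^ (r+1) * (p:ℝ) ^ (n i) * ((p:ℝ) ^ (n j))⁻¹) := by
            gcongr; exact hβ i
        _ = 2 * Real.pi * (p:ℝ) ^ (r+1) * ((p:ℝ) ^ n i * ((p:ℝ) ^ n j)⁻¹) := by ring
        _ ≤ _ := by gcongr
    have h2 : ‖g (tn p (K + (i + s)) x) - g (tn p (K + (i + s)) y)‖ ≤ Lg * (1/2) ^ (j - i) := by
      have h4 := hnj i j hij.le
      have h5 := hnR i
      refine (hgosc i 0 (by omega) (n j) (by omega) x y h).trans ?_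
      gcongr
      exact inv_pow_le_half hp (by omega)
    have e : Z i x - Z i y = ζ i * ((ee (β i * tn p K x) - ee (β i * tn p K y)) * g (tn p (K + (i + s)) x)
        + ee (β i * tn p K y) * (g (tn p (K + (i + s)) x) - g (tn p (K + (i + s)) y))) := by
      simp only [hZ]; ring
    rw [e, norm_mul]
    have h3 : ‖(ee (β i * tn p K x) - ee (β i * tn p K y)) * g (tn p (K + (i + s)) x)
        + ee (β i * tn p K y) * (g (tn p (K + (i + s)) x) - g (tn p (K + (i + s)) y))‖ ≤ C0 * (1/2) ^ (j - i) := by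
      refine (norm_add_le _ _).trans ?_
      rw [norm_mul, norm_mul, ee_norm, one_mul, hC0, add_mul]
      have := mul_le_of_le_one_right (norm_nonneg (ee (β i * tn p K x) - ee (β i * tn p K y))) (hg1 (tn p (K + (i + s)) x))
      linarith
    calc _ ≤ 1 * (C0 * (1/2) ^ (j - i)) := by gcongr; exact hζ i
      _ = _ := one_mul _
  have hV := var_bound (μ := μ) hp hZm hZ1 (n := fun i => K + n i) (fun i j h => by
    have := hnmono h; simp only; omega) hC00 hosc
  set D : ℕ → ℝ → ℂ := fun i x => Z i x - cE μ (cc p (K + n i)) (Z i) x with hD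
  have hDm : ∀ i, Measurable (D i) := fun i => (hZm i).sub (measurable_cE (cc_measurable _) _)
  have hDb : ∀ i x, ‖D i x‖ ≤ 2 := fun i x => (norm_sub_le _ _).trans
    (by linarith [hZ1 i x, cE_norm_le (μ := μ) (c := cc p (K + n i)) zero_le_one (hZ1 i) x])
  have hLLN : μ.real {x | ∃ N, N0 ≤ N ∧ N ≤ N1 ∧ ε * N < ‖∑ i ∈ Finset.range N, D i x‖} ≤ η := by
    refine le_trans (measureReal_mono ?_ (measure_ne_top _ _)) (hN00 D hDm hDb hV N1)
    rintro x ⟨N, h1, h2, h3⟩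
    exact ⟨N, hN0.trans h1, h2, h3⟩
  -- conditional expectations
  have hcE : ∀ i x, 0 < μ.real (cc p (K + n i) ⁻¹' {cc p (K + n i) x}) →
      ‖cE μ (cc p (K + n i)) (Z i) x‖ ≤ 2 * ε + vv μ p (K + n i) (β i * (p:ℝ) ^ K) x / (4 * ε) := by
    intro i x hx
    set k : ℂ := ζ i * g (tn p (K + (i + s)) x) with hk
    have hkn : ‖k‖ ≤ 1 := by
      rw [hk, norm_mul]
      nlinarith [hζ i, hg1 (tn p (K + (i + s)) x), norm_nonneg (ζ i), norm_nonneg (g (tn p (K + (i + s)) x))]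
    have hem : Measurable fun y => ee (β i * tn p K y) := ee_measurable.comp ((tn_measurable K).const_mul _)
    have hZi : Integrable (Z i) μ := integrable_bdd (hZm i) (hZ1 i)
    have hZ'i : Integrable (fun y => k * ee (β i * tn p K y)) μ :=
      integrable_bdd (hem.const_mul k) (C := 1) fun y => by
        simp only [norm_mul, ee_norm, mul_one]; exact hkn
    have h1 : ‖cE μ (cc p (K + n i)) (fun y => Z i y - k * ee (β i * tn p K y)) x - 0‖ ≤ ε := by
      apply cE_osc (cc_measurable _) (hZi.sub hZ'i) hx
      intro y hy
      have e : Z i y - k * ee (β i * tn p K y) - 0 = ζ i * ee (β i * tn p K y) *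
          (g (tn p (K + (i + s)) y) - g (tn p (K + (i + s)) x)) := by
        simp only [hZ, hk]; ring
      show ‖Z i y - k * ee (β i * tn p K y) - 0‖ ≤ ε
      rw [e, norm_mul, norm_mul, ee_norm, mul_one]
      have h5 := hnR i
      have h2 := hgosc i 0 (by omega) (n i) (by omega) y x hy
      have h3 : Lg * ((p:ℝ) ^ (n i - (i + s)))⁻¹ ≤ Lg * ((p:ℝ) ^ R)⁻¹ := by
        gcongr
        · omega
      have h4 := h2.trans (h3.trans hR)
      nlinarith [hζ i, norm_nonneg (ζ i), norm_nonneg (g (tn p (K + (i + s)) y) - g (tn p (K + (i + s)) x))]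
    have h2 : cE μ (cc p (K + n i)) (fun y => Z i y - k * ee (β i * tn p K y)) x
        = cE μ (cc p (K + n i)) (Z i) x - k * cE μ (cc p (K + n i)) (fun y => ee (β i * tn p K y)) x := by
      rw [← cE_pull (cc_measurable _) (k := fun _ => k) (fun _ _ _ => rfl)]
      unfold cE
      rw [integral_sub hZi.integrableOn hZ'i.integrableOn, mul_sub]
    rw [sub_zero, h2] at h1
    set Q := cE μ (cc p (K + n i)) (fun y => ee (β i * tn p K y)) x with hQ
    have hQv : ‖Q‖ ^ 2 = vv μ p (K + n i) (β i * (p:ℝ) ^ K) x := vv_shift hp K (n i) (β i) x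
    have h3 : ‖cE μ (cc p (K + n i)) (Z i) x‖ ≤ ε + ‖k * Q‖ := by
      have := norm_add_le (cE μ (cc p (K + n i)) (Z i) x - k * Q) (k * Q)
      rw [sub_add_cancel] at this; linarith
    have h4 : ‖k * Q‖ ≤ ‖Q‖ := by rw [norm_mul]; exact mul_le_of_le_one_left (norm_nonneg _) hkn
    have h5 : ‖Q‖ ≤ ε + ‖Q‖ ^ 2 / (4 * ε) := by
      have : ε + ‖Q‖ ^ 2 / (4 * ε) - ‖Q‖ = (‖Q‖ - 2 * ε) ^ 2 / (4 * ε) := by field_simp; ring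
      have h2 : 0 ≤ (‖Q‖ - 2 * ε) ^ 2 / (4 * ε) := by positivity
      linarith
    rw [← hQv]; linarith
  -- event inclusion
  set S : ℕ → ℝ → ℂ := fun N x => ∑ i ∈ Finset.range N, ζ i * ee (β i * Int.fract x) * g (tn p (i + s) x) with hS
  have hSm : ∀ N, Measurable (S N) := fun N => Finset.measurable_sum _ fun i _ =>
    ((ee_measurable.comp (measurable_fract.const_mul _)).const_mul _).mul (hgm.comp (tn_measurable _))
  have hSZ : ∀ N x, S N (tn p K x) = ∑ i ∈ Finset.range N, Z i x := by
    intro N x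
    simp only [hS, hZ, fract_tn, tn_tn]
  set E1 := {x | ∃ N, N0 ≤ N ∧ N ≤ N1 ∧ 4 * ε * N < ‖S N x‖}
  have hE1m : MeasurableSet E1 := by
    have : E1 = ⋃ N ∈ Finset.Icc N0 N1, {x | 4 * ε * N < ‖S N x‖} := by
      ext x; simp only [E1, mem_ofPred_eq, mem_iUnion, Finset.mem_Icc, exists_prop, and_assoc]
    rw [this]
    exact Finset.measurableSet_biUnion _ fun N _ => measurableSet_lt measurable_const (hSm N).norm
  have hE1K : μ.real E1 = μ.real (tn p K ⁻¹' E1) := by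
    unfold Measure.real; rw [(hT K).measure_preimage hE1m.nullMeasurableSet]
  show μ.real E1 ≤ _
  rw [hE1K]
  refine le_trans ?_ (add_le_add hLLN le_rfl)
  refine le_trans ?_ (measureReal_union_le _ _)
  have hae : ∀ᵐ x ∂μ, ∀ i, 0 < μ.real (cc p (K + n i) ⁻¹' {cc p (K + n i) x}) :=
    ae_all_iff.2 fun i => ae_cell_pos (cc_measurable _)
  apply ENNReal.toReal_mono (measure_ne_top _ _)
  apply measure_mono_ae
  filter_upwards [hae] with x hx hxE
  obtain ⟨N, hNa, hNb, hN⟩ := hxE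
  rw [hSZ] at hN
  by_contra hcon
  have hcon' : ¬ (ε * N < ‖∑ i ∈ Finset.range N, D i x‖) ∧
      ¬ (4 * ε ^ 2 * N ≤ ∑ i ∈ Finset.range N, vv μ p (K + n i) (β i * (p:ℝ) ^ K) x) := by
    constructor
    · intro h; exact hcon (Or.inl ⟨N, hNa, hNb, h⟩)
    · intro h; exact hcon (Or.inr ⟨N, hNa, hNb, h⟩)
  obtain ⟨c1, c2⟩ := hcon'
  push Not at c1 c2
  have e : ∑ i ∈ Finset.range N, Z i x = ∑ i ∈ Finset.range N, D i x
      + ∑ i ∈ Finset.range N, cE μ (cc p (K + n i)) (Z i) x := by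
    rw [← Finset.sum_add_distrib]; apply Finset.sum_congr rfl; intro i _; simp only [hD]; ring
  have h1 : ‖∑ i ∈ Finset.range N, cE μ (cc p (K + n i)) (Z i) x‖ ≤ 2 * ε * N +
      (∑ i ∈ Finset.range N, vv μ p (K + n i) (β i * (p:ℝ) ^ K) x) / (4 * ε) := by
    refine (norm_sum_le _ _).trans ?_
    refine (Finset.sum_le_sum fun i _ => hcE i x (hx i)).trans (le_of_eq ?_)
    rw [Finset.sum_add_distrib, Finset.sum_div]; simp; ring
  have h2 : (∑ i ∈ Finset.range N, vv μ p (K + n i) (β i * (p:ℝ) ^ K) x) / (4 * ε) ≤ ε * N := by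
    rw [div_le_iff₀ (by positivity)]; nlinarith
  rw [e] at hN
  have := norm_add_le (∑ i ∈ Finset.range N, D i x) (∑ i ∈ Finset.range N, cE μ (cc p (K + n i)) (Z i) x)
  linarith

end stepA


/-- small positive fractional parts -/
lemma exists_small_fract {θ : ℝ} (hθ : Irrational θ) {δ : ℝ} (hδ : 0 < δ) :
    ∃ d : ℕ, 0 < Int.fract (d * θ) ∧ Int.fract (d * θ) < δ := by
  have hfpos : ∀ d : ℕ, 1 ≤ d → 0 < Int.fract (d * θ) := by
    intro d hd
    have h1 : Irrational (d * θ) := hθ.natCast_mul (by omega)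
    rcases (Int.fract_nonneg ((d:ℝ) * θ)).lt_or_eq with h | h
    · exact h
    · exfalso
      have := Int.floor_add_fract ((d:ℝ) * θ)
      rw [← h, add_zero] at this
      exact h1 ⟨⌊(d:ℝ) * θ⌋, by push_cast; exact this⟩
  obtain ⟨n, hn⟩ := exists_nat_gt (1 / δ)
  have hn0 : 0 < n := by
    have : (0:ℝ) < n := lt_trans (by positivity) hn
    exact_mod_cast this
  obtain ⟨d, hd0, hdn, hd⟩ := Real.exists_nat_abs_mul_sub_round_le θ hn0
  have hlt : (1:ℝ) / (n + 1) < δ := by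
    rw [div_lt_iff₀ (by positivity)]
    rw [div_lt_iff₀ hδ] at hn
    nlinarith
  set a := round ((d:ℝ) * θ) with ha
  have hd' := abs_le.1 hd
  have hn1 : (1:ℝ) / (n+1) < 1 := by
    rw [div_lt_one (by positivity)]; have : (0:ℝ) < n := by exact_mod_cast hn0
    linarith
  rcases le_or_gt (a:ℝ) (d * θ) with h | h
  · refine ⟨d, hfpos d hd0, ?_⟩
    have e : Int.fract ((d:ℝ) * θ) = d * θ - a := by
      rw [Int.fract_eq_iff]
      exact ⟨by linarith, by linarith, a, by ring⟩
    rw [e]; linarith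
  · set e := (a:ℝ) - d * θ with he
    have he0 : 0 < e := by linarith
    have heδ : e < δ := by linarith
    set k := ⌊1 / e⌋₊ with hk
    have he1 : e < 1 := by linarith
    have hk1 : 1 ≤ k := by
      rw [hk, Nat.one_le_floor_iff, le_div_iff₀ he0]; linarith
    have hke : (k:ℝ) * e ≤ 1 := by
      have := Nat.floor_le (show 0 ≤ 1 / e by positivity)
      rw [← hk, le_div_iff₀ he0] at this; exact this
    have hke2 : 1 < ((k:ℝ) + 1) * e := by
      have := Nat.lt_floor_add_one (1 / e)
      rw [← hk, div_lt_iff₀ he0] at this; exact this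
    refine ⟨k * d, hfpos _ (Nat.mul_pos hk1 hd0), ?_⟩
    have hkp : (0:ℝ) < k := by exact_mod_cast hk1
    have e2 : Int.fract (((k * d : ℕ) : ℝ) * θ) = 1 - k * e := by
      rw [Int.fract_eq_iff]
      refine ⟨by linarith, by nlinarith, k * a - 1, ?_⟩
      push_cast; rw [he]; ring
    rw [e2]; nlinarith

lemma recurrence {θ : ℝ} (hθ : Irrational θ) (hθ0 : 0 < θ) {δ : ℝ} (hδ : 0 < δ) (hδ1 : δ ≤ 1) :
    ∃ Q : ℕ, ∀ τ : ℝ, Q * θ ≤ τ → ∃ j l : ℕ, j ≤ Q ∧ (j:ℝ) * θ + l ≤ τ ∧ τ ≤ j * θ + l + δ := by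
  obtain ⟨d, hd0, hd1⟩ := exists_small_fract hθ hδ
  set e := Int.fract ((d:ℝ) * θ) with he
  set a := ⌊(d:ℝ) * θ⌋ with ha
  have hda : (d:ℝ) * θ = a + e := (Int.floor_add_fract _).symm
  refine ⟨⌊1 / e⌋₊ * d, fun τ hτ => ?_⟩
  set f := Int.fract τ with hf
  have hf0 : 0 ≤ f := Int.fract_nonneg _
  have hf1 : f < 1 := Int.fract_lt_one _
  set k := ⌊f / e⌋₊ with hk
  have hkQ : k ≤ ⌊1 / e⌋₊ := Nat.floor_mono (by gcongr)
  have hke : (k:ℝ) * e ≤ f := by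
    have := Nat.floor_le (show 0 ≤ f / e by positivity)
    rw [← hk, le_div_iff₀ hd0] at this; exact this
  have hke2 : f < ((k:ℝ) + 1) * e := by
    have := Nat.lt_floor_add_one (f / e)
    rw [← hk, div_lt_iff₀ hd0] at this; exact this
  have hjQ : k * d ≤ ⌊1 / e⌋₊ * d := Nat.mul_le_mul_right _ hkQ
  set l : ℤ := ⌊τ⌋ - k * a with hl
  have hτe : τ = ⌊τ⌋ + f := (Int.floor_add_fract _).symm
  have hmain : τ - ((k * d : ℕ) : ℝ) * θ = l + (f - k * e) := by
    rw [hl]; push_cast; rw [mul_assoc, hda]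
    nth_rw 1 [hτe]; ring
  have hl0 : 0 ≤ l := by
    have h1 : ((k * d : ℕ) : ℝ) * θ ≤ τ := by
      refine le_trans ?_ hτ
      have : ((k * d : ℕ) : ℝ) ≤ ((⌊1 / e⌋₊ * d : ℕ) : ℝ) := by exact_mod_cast hjQ
      gcongr
    have h2 : (-1:ℝ) < l := by nlinarith
    have h3 : (-1:ℤ) < l := by exact_mod_cast h2
    omega
  obtain ⟨l', hl'⟩ := Int.eq_ofNat_of_zero_le hl0
  have hlr : (l:ℝ) = l' := by rw [hl']; simp
  refine ⟨k * d, l', hjQ, ?_, ?_⟩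
  · rw [hlr] at hmain; linarith
  · rw [hlr] at hmain; nlinarith

section stepB
variable {p : ℕ} {μ : Measure ℝ} [IsProbabilityMeasure μ]

lemma vv_lip (hp : 2 ≤ p) (n : ℕ) (β β' x : ℝ) :
    vv μ p n β x ≤ vv μ p n β' x + 4 * Real.pi * (|β - β'| / (p:ℝ) ^ n) := by
  have hp0 : (0:ℝ) < p := by positivity
  have hpi := Real.pi_pos
  unfold vv
  rw [phase hp, phase hp n β']
  have hi : ∀ c : ℝ, Integrable (fun y => ee (c * tn p n y)) μ := fun c =>
    integrable_bdd (ee_measurable.comp ((tn_measurable n).const_mul _)) (C := 1) fun y => (ee_norm _).le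
  have h := cE_sub_norm_le (μ := μ) (c := cc p n) (hi (β / (p:ℝ) ^ n)) (hi (β' / (p:ℝ) ^ n))
    (δ := 2 * Real.pi * (|β - β'| / (p:ℝ) ^ n)) (by positivity) (fun y => by
      refine (ee_lip _ _).trans ?_
      rw [← sub_mul, ← sub_div, abs_mul, abs_div, abs_of_pos (by positivity : (0:ℝ) < (p:ℝ) ^ n)]
      have := tn_abs_le (p := p) n y
      have h2 : 0 ≤ |β - β'| / (p:ℝ) ^ n := by positivity
      nlinarith [mul_le_of_le_one_right h2 this]) x
  set a := cE μ (cc p n) (fun y => ee (β / (p:ℝ) ^ n * tn p n y)) x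
  set b := cE μ (cc p n) (fun y => ee (β' / (p:ℝ) ^ n * tn p n y)) x
  have ha : ‖a‖ ≤ 1 := cE_norm_le zero_le_one (fun y => (ee_norm _).le) x
  have hb : ‖b‖ ≤ 1 := cE_norm_le zero_le_one (fun y => (ee_norm _).le) x
  have hab : ‖a‖ - ‖b‖ ≤ ‖a - b‖ := norm_sub_norm_le a b
  have h1 := norm_nonneg a
  have h2 := norm_nonneg b
  have h3 := norm_nonneg (a - b)
  nlinarith

/-- energies along logarithmic frequency -/
noncomputable def wL (μ : Measure ℝ) (p r : ℕ) (L x : ℝ) : ℝ := vv μ p (⌊L⌋₊ - r) ((p:ℝ) ^ L) x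
noncomputable def wL2 (μ : Measure ℝ) (p r : ℕ) (L x : ℝ) : ℝ :=
  wL μ p r L x + vv μ p (⌊L⌋₊ - r - 1) ((p:ℝ) ^ L) x

lemma wL_le (hp : 2 ≤ p) (r : ℕ) {L L' δ : ℝ} (hL : (r:ℝ) ≤ L) (h1 : L ≤ L') (h2 : L' ≤ L + δ) (hδ : δ ≤ 1) (x : ℝ) :
    wL μ p r L x ≤ wL2 μ p r L' x + 4 * Real.pi * ((p:ℝ) ^ (r + 1) * ((p:ℝ) ^ δ - 1)) := by
  have hpi := Real.pi_pos
  have hp1 : (1:ℝ) < p := by exact_mod_cast (by omega : 1 < p)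
  have hp0 : (0:ℝ) < p := by linarith
  have hL0 : 0 ≤ L := le_trans (by positivity) hL
  set n := ⌊L⌋₊ - r with hn
  have hfl : r ≤ ⌊L⌋₊ := Nat.le_floor hL
  have hf1 : ⌊L⌋₊ ≤ ⌊L'⌋₊ := Nat.floor_mono h1
  have hf2 : ⌊L'⌋₊ ≤ ⌊L⌋₊ + 1 := by
    rw [← Nat.floor_add_one hL0]; exact Nat.floor_mono (by linarith)
  have hstep : vv μ p n ((p:ℝ) ^ L') x ≤ wL2 μ p r L' x := by
    unfold wL2 wL
    rcases (by omega : n = ⌊L'⌋₊ - r ∨ n = ⌊L'⌋₊ - r - 1) with h | h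
    · rw [← h]; linarith [vv_nonneg (μ := μ) (p := p) (n - 1) ((p:ℝ) ^ L') x]
    · rw [← h]; linarith [vv_nonneg (μ := μ) (p := p) (⌊L'⌋₊ - r) ((p:ℝ) ^ L') x]
  have hlip := vv_lip (μ := μ) hp n ((p:ℝ) ^ L) ((p:ℝ) ^ L') x
  have hb : |(p:ℝ) ^ L - (p:ℝ) ^ L'| / (p:ℝ) ^ n ≤ (p:ℝ) ^ (r + 1) * ((p:ℝ) ^ δ - 1) := by
    have hmono : (p:ℝ) ^ L ≤ (p:ℝ) ^ L' := Real.rpow_le_rpow_of_exponent_le hp1.le h1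
    rw [abs_sub_comm, abs_of_nonneg (by linarith)]
    have hu : (p:ℝ) ^ L' ≤ (p:ℝ) ^ L * (p:ℝ) ^ δ := by
      rw [← Real.rpow_add hp0]; exact Real.rpow_le_rpow_of_exponent_le hp1.le h2
    have hd1 : 1 ≤ (p:ℝ) ^ δ := Real.one_le_rpow hp1.le (by linarith)
    have hLn : (p:ℝ) ^ L ≤ (p:ℝ) ^ (r + 1) * (p:ℝ) ^ n := by
      rw [← pow_add, ← Real.rpow_natCast]
      apply Real.rpow_le_rpow_of_exponent_le hp1.le
      have := Nat.lt_floor_add_one L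
      have h5 : ((r + 1 + n : ℕ) : ℝ) = ⌊L⌋₊ + 1 := by
        rw [show r + 1 + n = ⌊L⌋₊ + 1 by omega]; push_cast; ring
      rw [h5]; exact this.le
    rw [div_le_iff₀ (by positivity)]
    calc (p:ℝ) ^ L' - (p:ℝ) ^ L ≤ (p:ℝ) ^ L * ((p:ℝ) ^ δ - 1) := by rw [mul_sub]; linarith
      _ ≤ (p:ℝ) ^ (r + 1) * (p:ℝ) ^ n * ((p:ℝ) ^ δ - 1) := by
          apply mul_le_mul_of_nonneg_right hLn; linarith
      _ = _ := by ring
  show vv μ p n ((p:ℝ) ^ L) x ≤ _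
  have := mul_le_mul_of_nonneg_left hb (show 0 ≤ 4 * Real.pi by positivity)
  linarith

lemma wL2_integral (hp : 2 ≤ p) (hT : ∀ n, MeasurePreserving (tn p n) μ μ) (r : ℕ) {L : ℝ} (hL : (r:ℝ) ≤ L)
    {n : ℕ} (hn : ⌊L⌋₊ - r ≤ n) :
    ∫ x, wL2 μ p r L x ∂μ ≤ 2 * al μ p n (fun y => ee ((p:ℝ) ^ ((r:ℝ) + Int.fract L) * y)) := by
  have hp1 : (1:ℝ) < p := by exact_mod_cast (by omega : 1 < p)
  have hp0 : (0:ℝ) < p := by linarith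
  have hL0 : 0 ≤ L := le_trans (by positivity) hL
  have hfl : r ≤ ⌊L⌋₊ := Nat.le_floor hL
  unfold wL2 wL
  rw [integral_add (vv_integrable _ _) (vv_integrable _ _)]
  have h1 : ∫ x, vv μ p (⌊L⌋₊ - r - 1) ((p:ℝ) ^ L) x ∂μ ≤ ∫ x, vv μ p (⌊L⌋₊ - r) ((p:ℝ) ^ L) x ∂μ :=
    cE_sq_mono (cc_measurable _) (cc_measurable _) (fun x y h => cc_split_of_le hp (by omega) h)
      (ee_measurable.comp (measurable_fract.const_mul _)) (fun y => (ee_norm _).le)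
  have h2 : ∫ x, vv μ p (⌊L⌋₊ - r) ((p:ℝ) ^ L) x ∂μ
      = al μ p (⌊L⌋₊ - r) (fun y => ee ((p:ℝ) ^ ((r:ℝ) + Int.fract L) * y)) := by
    rw [vv_integral hp]
    have : (p:ℝ) ^ L / (p:ℝ) ^ (⌊L⌋₊ - r) = (p:ℝ) ^ ((r:ℝ) + Int.fract L) := by
      rw [← Real.rpow_natCast, ← Real.rpow_sub hp0]
      congr 1
      rw [Nat.cast_sub hfl, natCast_floor_eq_intCast_floor hL0]
      have := Int.floor_add_fract L
      linarith
    rw [this]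
  have h3 : al μ p (⌊L⌋₊ - r) (fun y => ee ((p:ℝ) ^ ((r:ℝ) + Int.fract L) * y))
      ≤ al μ p n (fun y => ee ((p:ℝ) ^ ((r:ℝ) + Int.fract L) * y)) :=
    al_mono hp hT (ee_measurable.comp (measurable_id.const_mul _)) (fun y => (ee_norm _).le) hn
  linarith

lemma wL_measurable (r : ℕ) (L : ℝ) : Measurable (wL μ p r L) := vv_measurable _ _
lemma wL2_measurable (r : ℕ) (L : ℝ) : Measurable (wL2 μ p r L) := (vv_measurable _ _).add (vv_measurable _ _)
lemma wL_nonneg (r : ℕ) (L x : ℝ) : 0 ≤ wL μ p r L x := vv_nonneg _ _ _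
lemma wL2_nonneg (r : ℕ) (L x : ℝ) : 0 ≤ wL2 μ p r L x := add_nonneg (vv_nonneg _ _ _) (vv_nonneg _ _ _)
lemma wL2_integrable (r : ℕ) (L : ℝ) : Integrable (wL2 μ p r L) μ := (vv_integrable _ _).add (vv_integrable _ _)

/-- bad event -/
def evS (u : ℝ → ℝ → ℝ) (θ c : ℝ) (N0 N1 : ℕ) (L : ℝ) : Set ℝ :=
  {x | ∃ N, N0 ≤ N ∧ N ≤ N1 ∧ c * N ≤ ∑ i ∈ Finset.range N, u (L + i * θ) x}

lemma evS_measurable {u : ℝ → ℝ → ℝ} (hu : ∀ L, Measurable (u L)) (θ c : ℝ) (N0 N1 : ℕ) (L : ℝ) :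
    MeasurableSet (evS u θ c N0 N1 L) := by
  have : evS u θ c N0 N1 L = ⋃ N ∈ Finset.Icc N0 N1, {x | c * N ≤ ∑ i ∈ Finset.range N, u (L + i * θ) x} := by
    ext x; simp only [evS, mem_ofPred_eq, mem_iUnion, Finset.mem_Icc, exists_prop, and_assoc]
  rw [this]
  exact Finset.measurableSet_biUnion _ fun N _ => measurableSet_le measurable_const
    (Finset.measurable_sum _ fun i _ => hu _)

lemma stepB (hp : 2 ≤ p) (hT : ∀ n, MeasurePreserving (tn p n) μ μ) {θ : ℝ} (hθ : Irrational θ) (hθ0 : 0 < θ)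
    {κ c : ℝ} (hκ : 0 < κ) (hc : 0 < c) {r H : ℕ} (hH : 1 ≤ H)
    (hC : ∀ (n : ℕ) (s : ℝ), (1 / H : ℝ) * ∑ h ∈ Finset.range H,
      al μ p n (fun y => ee ((p:ℝ) ^ ((r:ℝ) + Int.fract (s + h / H)) * y)) ≤ κ) :
    ∃ Nst : ℕ, ∀ N0 ≥ Nst, ∀ (N1 : ℕ) (L0 : ℝ), (r:ℝ) ≤ L0 → ∃ K : ℕ,
      μ.real (evS (wL μ p r) θ c N0 N1 (L0 + K)) ≤ 17 * κ / c := by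
  have hpi := Real.pi_pos
  have hp1 : (1:ℝ) < p := by exact_mod_cast (by omega : 1 < p)
  have hp0 : (0:ℝ) < p := by linarith
  have hH0 : (0:ℝ) < H := by exact_mod_cast hH
  -- choice of δ
  obtain ⟨δ, hδ0, hδ1, hδ⟩ : ∃ δ : ℝ, 0 < δ ∧ δ ≤ 1 ∧
      4 * Real.pi * ((p:ℝ) ^ (r + 1) * ((p:ℝ) ^ δ - 1)) ≤ c / 4 := by
    have hcont : ContinuousAt (fun δ : ℝ => 4 * Real.pi * ((p:ℝ) ^ (r + 1) * ((p:ℝ) ^ δ - 1))) 0 := by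
      have : Continuous fun δ : ℝ => (p:ℝ) ^ δ := Real.continuous_const_rpow hp0.ne'
      fun_prop
    have ht : Tendsto (fun δ : ℝ => 4 * Real.pi * ((p:ℝ) ^ (r + 1) * ((p:ℝ) ^ δ - 1))) (𝓝[>] 0) (𝓝 0) := by
      have := hcont.tendsto
      simp only [Real.rpow_zero, sub_self, mul_zero] at this
      exact this.mono_left nhdsWithin_le_nhds
    have h1 := ht.eventually (ge_mem_nhds (show (0:ℝ) < c / 4 by positivity))
    have h2 : ∀ᶠ δ : ℝ in 𝓝[>] 0, δ ∈ Ioc (0:ℝ) 1 := Ioc_mem_nhdsGT zero_lt_one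
    obtain ⟨δ, h3, h4⟩ := (h1.and h2).exists
    exact ⟨δ, h4.1, h4.2, h3⟩
  obtain ⟨Q, hQ⟩ := recurrence hθ hθ0 hδ0 hδ1
  obtain ⟨Nst, hNst⟩ := exists_nat_gt (2 * Q / c + 1)
  refine ⟨Nst, fun N0 hN0 N1 L0 hL0 => ?_⟩
  by_contra hcon
  push Not at hcon
  set b := 17 * κ / c with hb
  have hb0 : 0 < b := by positivity
  have hN0r : 2 * Q / c + 1 < (N0:ℝ) := lt_of_lt_of_le hNst (by exact_mod_cast hN0)
  -- key: lower bound for every large level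
  have key : ∀ L' : ℝ, L0 + Q * θ ≤ L' → b < μ.real (evS (wL2 μ p r) θ (c/4) N0 N1 L') := by
    intro L' hL'
    obtain ⟨j, l, hj, h1, h2⟩ := hQ (L' - L0) (by linarith)
    refine lt_of_lt_of_le (hcon l) (measureReal_mono ?_ (measure_ne_top _ _))
    rintro x ⟨N, hNa, hNb, hN⟩
    refine ⟨N, hNa, hNb, ?_⟩
    have hQN : (j:ℝ) ≤ c / 2 * N := by
      have h3 : (N0:ℝ) ≤ N := by exact_mod_cast hNa
      have h4 : (j:ℝ) ≤ Q := by exact_mod_cast hj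
      have h5 : 2 * Q / c ≤ (N:ℝ) := by linarith
      rw [div_le_iff₀ hc] at h5
      linarith
    have s1 : ∑ i ∈ Finset.range N, wL μ p r (L0 + l + i * θ) x
        ≤ j + ∑ i ∈ Finset.range N, wL μ p r (L0 + l + (j + i : ℕ) * θ) x := by
      calc _ ≤ ∑ i ∈ Finset.range (j + N), wL μ p r (L0 + l + i * θ) x :=
            Finset.sum_le_sum_of_subset_of_nonneg (Finset.range_mono (by omega)) fun i _ _ => wL_nonneg _ _ _
        _ = ∑ i ∈ Finset.range j, wL μ p r (L0 + l + i * θ) x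
            + ∑ i ∈ Finset.range N, wL μ p r (L0 + l + (j + i : ℕ) * θ) x := Finset.sum_range_add _ _ _
        _ ≤ _ := by
            gcongr
            calc _ ≤ ∑ i ∈ Finset.range j, (1:ℝ) := Finset.sum_le_sum fun i _ => vv_le_one _ _ _
              _ = j := by simp
    have s2 : ∑ i ∈ Finset.range N, wL μ p r (L0 + l + (j + i : ℕ) * θ) x
        ≤ ∑ i ∈ Finset.range N, (wL2 μ p r (L' + i * θ) x + c / 4) := by
      apply Finset.sum_le_sum; intro i _
      have hj0 : 0 ≤ (j:ℝ) * θ := by positivity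
      have hi0 : 0 ≤ (i:ℝ) * θ := by positivity
      have hl0 : (0:ℝ) ≤ l := by positivity
      refine (wL_le hp r (L' := L' + i * θ) (δ := δ) ?_ ?_ ?_ hδ1 x).trans ?_
      · push_cast; linarith
      · push_cast; linarith
      · push_cast; linarith
      · linarith
    rw [Finset.sum_add_distrib] at s2
    simp only [Finset.sum_const, Finset.card_range, nsmul_eq_mul] at s2
    linarith
  set L1 := L0 + Q * θ with hL1
  have hL1r : (r:ℝ) ≤ L1 := by
    have : 0 ≤ (Q:ℝ) * θ := by positivity
    linarith
  have hN0p : 1 ≤ N0 := by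
    have : (0:ℝ) < N0 := lt_trans (by positivity) hN0r
    exact_mod_cast this
  set J := N1 + 1 with hJ
  -- covering for each base point
  have cov : ∀ L : ℝ, c / 4 * ∑ j ∈ Finset.range J, μ.real (evS (wL2 μ p r) θ (c/4) N0 N1 (L + j * θ))
      ≤ ∑ i ∈ Finset.range (J + N1), ∫ x, wL2 μ p r (L + i * θ) x ∂μ := by
    intro L
    set E : ℕ → Set ℝ := fun j => evS (wL2 μ p r) θ (c/4) N0 N1 (L + j * θ)
    have hEm : ∀ j, MeasurableSet (E j) := fun j => evS_measurable (wL2_measurable r) _ _ _ _ _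
    have hind : ∀ j, Integrable (fun x => (E j).indicator (fun _ => (1:ℝ)) x) μ := fun j =>
      (integrable_const _).indicator (hEm j)
    have hE : ∀ j, μ.real (E j) = ∫ x, (E j).indicator (fun _ => (1:ℝ)) x ∂μ := fun j => by
      rw [integral_indicator (hEm j)]; simp [Measure.real]
    show c / 4 * ∑ j ∈ Finset.range J, μ.real (E j) ≤ _
    simp only [hE]
    rw [← integral_finsetSum _ (fun j _ => hind j), ← integral_const_mul,
      ← integral_finsetSum _ (fun i _ => wL2_integrable r _)]
    apply integral_mono ((integrable_finsetSum _ fun j _ => hind j).const_mul _)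
      (integrable_finsetSum _ fun i _ => wL2_integrable r _)
    intro x
    show c / 4 * ∑ j ∈ Finset.range J, (E j).indicator (fun _ => (1:ℝ)) x ≤ ∑ i ∈ Finset.range (J + N1), wL2 μ p r (L + i * θ) x
    apply covering (fun i : ℕ => wL2 μ p r (L + i * θ) x) (fun j => (E j).indicator (fun _ => (1:ℝ)) x)
      (fun i => wL2_nonneg _ _ _) (fun j => indicator_le_self' (fun _ _ => zero_le_one) x |>.trans le_rfl) (by positivity) N1
    intro j
    by_cases hx : x ∈ E j
    · right
      obtain ⟨N, hNa, hNb, hN⟩ := hx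
      refine ⟨N, by omega, hNb, hN.trans (le_of_eq ?_)⟩
      apply Finset.sum_congr rfl; intro i _
      congr 1; push_cast; ring
    · left; rw [indicator_of_notMem hx]
  -- averaging
  have avg : ∀ i : ℕ, ∑ h ∈ Finset.range H, ∫ x, wL2 μ p r (L1 + h / H + i * θ) x ∂μ ≤ 2 * (H * κ) := by
    intro i
    have hC' := hC (⌊L1 + i * θ⌋₊ + 1) (L1 + i * θ)
    rw [one_div_mul_eq_div, div_le_iff₀ hH0] at hC'
    have hi0 : 0 ≤ (i:ℝ) * θ := by positivity
    have hL10 : 0 ≤ L1 := le_trans (by positivity) hL1r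
    calc ∑ h ∈ Finset.range H, ∫ x, wL2 μ p r (L1 + h / H + i * θ) x ∂μ
        ≤ ∑ h ∈ Finset.range H, 2 * al μ p (⌊L1 + i * θ⌋₊ + 1)
            (fun y => ee ((p:ℝ) ^ ((r:ℝ) + Int.fract (L1 + i * θ + h / H)) * y)) := by
          apply Finset.sum_le_sum; intro h hh
          have hh0 : 0 ≤ (h:ℝ) / H := by positivity
          have hh1 : (h:ℝ) / H ≤ 1 := by
            rw [div_le_one hH0]; exact_mod_cast (Finset.mem_range.1 hh).le
          rw [show L1 + (h:ℝ) / H + i * θ = L1 + i * θ + h / H by ring]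
          apply wL2_integral hp hT r (by linarith)
          have : ⌊L1 + i * θ + h / H⌋₊ ≤ ⌊L1 + i * θ⌋₊ + 1 := by
            rw [← Nat.floor_add_one (by linarith)]; exact Nat.floor_mono (by linarith)
          omega
      _ ≤ _ := by rw [← Finset.mul_sum]; linarith
  have tot1 : ∑ h ∈ Finset.range H, c / 4 * ∑ j ∈ Finset.range J, b
      ≤ ∑ h ∈ Finset.range H, ∑ i ∈ Finset.range (J + N1), ∫ x, wL2 μ p r (L1 + h / H + i * θ) x ∂μ := by
    apply Finset.sum_le_sum; intro h _
    refine le_trans ?_ (cov (L1 + h / H))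
    gcongr with j _
    apply (key _ _).le
    have : 0 ≤ (j:ℝ) * θ := by positivity
    have : 0 ≤ (h:ℝ) / H := by positivity
    linarith
  rw [Finset.sum_comm] at tot1
  have tot2 := tot1.trans (Finset.sum_le_sum fun i _ => avg i)
  simp only [Finset.sum_const, Finset.card_range, nsmul_eq_mul] at tot2
  have hJ0 : (0:ℝ) < J := by positivity
  have hJN : ((J + N1 : ℕ) : ℝ) ≤ 2 * J := by
    rw [hJ]; push_cast; linarith
  have h6 : ((J + N1 : ℕ) : ℝ) * (2 * (H * κ)) ≤ 2 * J * (2 * (H * κ)) := by gcongr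
  have h7 : (H:ℝ) * J * (c / 4 * b) ≤ H * J * (4 * κ) := by
    calc _ = (H:ℝ) * (c / 4 * (J * b)) := by ring
      _ ≤ _ := tot2
      _ ≤ _ := h6
      _ = _ := by ring
  have h8 : c / 4 * b ≤ 4 * κ := le_of_mul_le_mul_left h7 (by positivity)
  have h9 : c / 4 * b = 17 / 4 * κ := by rw [hb]; field_simp
  linarith

end stepB


section core
variable {p : ℕ} {μ : Measure ℝ} [IsProbabilityMeasure μ]

lemma core_fin (hp : 2 ≤ p) (hT : ∀ n, MeasurePreserving (tn p n) μ μ) (herg : Ergodic (Tmap p) μ)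
    (hfr : ∀ᵐ x ∂μ, Int.fract x = x) {η0 : ℝ} (hη0 : 0 < η0)
    (hJ : ∀ n, ∫ x, Jf μ p n x ∂μ ≤ 1 - 2 * η0) {m : ℕ} (hpm : p < m)
    (hind : Irrational (Real.log p / Real.log m)) {A : ℝ} (hA : 0 < A)
    {ζ : ℕ → ℂ} (hζ : ∀ i, ‖ζ i‖ ≤ 1) {g : ℝ → ℂ} (hg1 : ∀ x, ‖g x‖ ≤ 1) {Lg : ℝ} (hLg : 0 ≤ Lg)
    (hgL : ∀ x y, ‖g x - g y‖ ≤ Lg * |x - y|) (hgm : Measurable g) {ε η : ℝ} (hε : 0 < ε) (hη : 0 < η) :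
    ∃ s N0 : ℕ, ∀ N1 : ℕ, μ.real {x | ∃ N, N0 ≤ N ∧ N ≤ N1 ∧ 4 * ε * N <
      ‖∑ i ∈ Finset.range N, ζ (i + s) * ee (A * (m:ℝ) ^ (i + s) * Int.fract x) * g (tn p (i + s) x)‖} ≤ 2 * η := by
  have hp1 : (1:ℝ) < p := by exact_mod_cast (by omega : 1 < p)
  have hp0 : (0:ℝ) < p := by linarith
  have hpm' : (p:ℝ) < m := by exact_mod_cast hpm
  have hm0 : (0:ℝ) < m := by linarith
  have hlp : 0 < Real.log p := Real.log_pos hp1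
  have hlm : Real.log p < Real.log m := Real.log_lt_log hp0 hpm'
  set θ : ℝ := Real.logb p m with hθdef
  have hθeq : θ = (Real.log p / Real.log m)⁻¹ := by rw [inv_div]; rfl
  have hθ : Irrational θ := by rw [hθeq]; exact hind.inv
  have hθ1 : 1 < θ := by
    show 1 < Real.log m / Real.log p
    rw [lt_div_iff₀ hlp]; linarith
  have hpθ : (p:ℝ) ^ θ = m := Real.rpow_logb hp0 hp1.ne' hm0
  set c : ℝ := 4 * ε ^ 2 with hc
  have hc0 : 0 < c := by positivity
  set κ : ℝ := η * c / 17 with hκ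
  have hκ0 : 0 < κ := by positivity
  have hκc : 17 * κ / c = η := by rw [hκ]; field_simp
  obtain ⟨r, H, hr, hH, hC⟩ := stepC hp hT herg hfr hη0 hJ hκ0
  obtain ⟨Nst, hB⟩ := stepB hp hT hθ (by linarith) hκ0 hc0 hH hC
  obtain ⟨N00, hAA⟩ := stepA (μ := μ) hp hT hε hη r hLg
  obtain ⟨R, hR⟩ : ∃ R : ℕ, Lg * ((p:ℝ) ^ R)⁻¹ ≤ ε := by
    obtain ⟨R, hR⟩ := pow_unbounded_of_one_lt (Lg / ε) hp1
    refine ⟨R, ?_⟩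
    rw [← div_eq_mul_inv, div_le_iff₀ (by positivity)]
    rw [div_lt_iff₀ hε] at hR; linarith
  set LA : ℝ := Real.logb p A with hLA
  have hpA : (p:ℝ) ^ LA = A := Real.rpow_logb hp0 hp1.ne' hA
  obtain ⟨s, hs⟩ : ∃ s : ℕ, R + r - LA ≤ s * (θ - 1) := by
    obtain ⟨s, hs⟩ := exists_nat_gt ((R + r - LA) / (θ - 1))
    exact ⟨s, by rw [div_lt_iff₀ (by linarith)] at hs; exact hs.le⟩
  set L : ℕ → ℝ := fun i => LA + s * θ + i * θ with hL
  have hLbig : ∀ i : ℕ, ((i + s + R + r : ℕ):ℝ) ≤ L i := by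
    intro i
    have : 0 ≤ (i:ℝ) * (θ - 1) := mul_nonneg (Nat.cast_nonneg _) (by linarith)
    simp only [hL]; push_cast; nlinarith
  have hL0 : ∀ i, 0 ≤ L i := fun i => le_trans (Nat.cast_nonneg _) (hLbig i)
  have hfl : ∀ i, i + s + R + r ≤ ⌊L i⌋₊ := fun i => Nat.le_floor (hLbig i)
  have hβ : ∀ i : ℕ, A * (m:ℝ) ^ (i + s) = (p:ℝ) ^ (L i) := by
    intro i
    simp only [hL]
    rw [show LA + s * θ + i * θ = LA + θ * ((i + s : ℕ):ℝ) by push_cast; ring, Real.rpow_add hp0, hpA,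
      Real.rpow_mul hp0.le, hpθ, Real.rpow_natCast]
  refine ⟨s, max N00 Nst, fun N1 => ?_⟩
  obtain ⟨K, hK⟩ := hB (max N00 Nst) (le_max_right _ _) N1 (L 0) (by
    have := hLbig 0; push_cast at this
    have h1 : (0:ℝ) ≤ s := Nat.cast_nonneg _
    have h2 : (0:ℝ) ≤ R := Nat.cast_nonneg _
    push_cast; linarith)
  have hfin := hAA (max N00 Nst) (le_max_left _ _) (fun i => A * (m:ℝ) ^ (i + s)) (fun i => ⌊L i⌋₊ - r) s R
    (fun i => ζ (i + s)) g (fun i => by positivity) (fun i => by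
      show A * (m:ℝ) ^ (i + s) ≤ (p:ℝ) ^ (r+1) * (p:ℝ) ^ (⌊L i⌋₊ - r)
      rw [hβ, ← pow_add, ← Real.rpow_natCast]
      apply Real.rpow_le_rpow_of_exponent_le hp1.le
      have h1 := hfl i
      rw [show r + 1 + (⌊L i⌋₊ - r) = ⌊L i⌋₊ + 1 by omega]
      push_cast
      exact (Nat.lt_floor_add_one _).le) (fun i => by
      show ⌊L i⌋₊ - r + 1 ≤ ⌊L (i+1)⌋₊ - r
      have h1 := hfl i
      have h2 : ⌊L i⌋₊ + 1 ≤ ⌊L (i+1)⌋₊ := by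
        rw [← Nat.floor_add_one (hL0 i)]
        apply Nat.floor_mono
        simp only [hL]; push_cast; linarith
      omega) (fun i => by
      show i + s + R ≤ ⌊L i⌋₊ - r
      have h1 := hfl i; omega) hR (fun i => hζ _) hg1 hgL hgm K N1
  refine hfin.trans ?_
  rw [hκc] at hK
  have e : {x | ∃ N, max N00 Nst ≤ N ∧ N ≤ N1 ∧ 4 * ε ^ 2 * N ≤ ∑ i ∈ Finset.range N,
      vv μ p (K + (⌊L i⌋₊ - r)) (A * (m:ℝ) ^ (i + s) * (p:ℝ) ^ K) x}
      = evS (wL μ p r) θ c (max N00 Nst) N1 (L 0 + K) := by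
    unfold evS
    have : ∀ (i : ℕ) x, vv μ p (K + (⌊L i⌋₊ - r)) (A * (m:ℝ) ^ (i + s) * (p:ℝ) ^ K) x
        = wL μ p r (L 0 + K + i * θ) x := by
      intro i x
      unfold wL
      have e1 : L 0 + K + i * θ = L i + K := by simp only [hL]; push_cast; ring
      have h1 := hfl i
      rw [e1, Nat.floor_add_natCast (hL0 i), hβ, ← Real.rpow_add_natCast hp0.ne',
        show K + (⌊L i⌋₊ - r) = ⌊L i⌋₊ + K - r by omega]
    simp only [this, hc]
  have := hK
  rw [← e] at this
  show η + μ.real {x | ∃ N, max N00 Nst ≤ N ∧ N ≤ N1 ∧ 4 * ε ^ 2 * N ≤ ∑ i ∈ Finset.range N,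
      vv μ p (K + (⌊L i⌋₊ - r)) (A * (m:ℝ) ^ (i + s) * (p:ℝ) ^ K) x} ≤ 2 * η
  linarith

/-- a sequence of bounded terms whose shifted averages are eventually small -/
lemma shift_avg {z : ℕ → ℂ} (hz : ∀ i, ‖z i‖ ≤ 1) {ε : ℝ} (hε : 0 < ε) {s N0 : ℕ}
    (h : ∀ N, N0 ≤ N → ‖∑ i ∈ Finset.range N, z (i + s)‖ ≤ ε * N) :
    ∀ᶠ N : ℕ in atTop, ‖(1 / N : ℂ) * ∑ i ∈ Finset.range N, z i‖ ≤ 2 * ε := by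
  obtain ⟨M, hM⟩ := exists_nat_gt (s / ε)
  filter_upwards [eventually_ge_atTop (N0 + s + M + 1)] with N hN
  have hN0 : (0:ℝ) < N := by exact_mod_cast (by omega : 0 < N)
  rw [norm_mul, norm_div, norm_one, Complex.norm_natCast, one_div_mul_eq_div, div_le_iff₀ hN0]
  obtain ⟨d, rfl⟩ : ∃ d, N = s + d := ⟨N - s, by omega⟩
  rw [Finset.sum_range_add]
  refine (norm_add_le _ _).trans ?_
  have h1 : ‖∑ i ∈ Finset.range s, z i‖ ≤ s := by
    refine (norm_sum_le _ _).trans ?_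
    refine (Finset.sum_le_sum fun i _ => hz i).trans ?_
    simp
  have h2 := h d (by omega)
  have e : ∑ i ∈ Finset.range d, z (s + i) = ∑ i ∈ Finset.range d, z (i + s) :=
    Finset.sum_congr rfl fun i _ => by rw [add_comm]
  rw [e]
  have h3 : (s:ℝ) ≤ ε * M := by rw [div_lt_iff₀ hε] at hM; linarith
  have h4 : (M:ℝ) ≤ (s + d : ℕ) := by exact_mod_cast (by omega : M ≤ s + d)
  have h5 : (d:ℝ) ≤ (s + d : ℕ) := by push_cast; linarith [(Nat.cast_nonneg s : (0:ℝ) ≤ s)]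
  nlinarith

lemma core_pos (hp : 2 ≤ p) (hT : ∀ n, MeasurePreserving (tn p n) μ μ) (herg : Ergodic (Tmap p) μ)
    (hfr : ∀ᵐ x ∂μ, Int.fract x = x) {η0 : ℝ} (hη0 : 0 < η0)
    (hJ : ∀ n, ∫ x, Jf μ p n x ∂μ ≤ 1 - 2 * η0) {m : ℕ} (hpm : p < m)
    (hind : Irrational (Real.log p / Real.log m)) {A : ℝ} (hA : 0 < A)
    {ζ : ℕ → ℂ} (hζ : ∀ i, ‖ζ i‖ ≤ 1) {g : ℝ → ℂ} (hg1 : ∀ x, ‖g x‖ ≤ 1) {Lg : ℝ} (hLg : 0 ≤ Lg)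
    (hgL : ∀ x y, ‖g x - g y‖ ≤ Lg * |x - y|) (hgm : Measurable g) :
    ∀ᵐ x ∂μ, Tendsto (fun N : ℕ => (1 / N : ℂ) * ∑ i ∈ Finset.range N,
      ζ i * ee (A * (m:ℝ) ^ i * Int.fract x) * g (tn p i x)) atTop (𝓝 0) := by
  have key : ∀ k : ℕ, ∀ᵐ x ∂μ, ∀ᶠ N : ℕ in atTop, ‖(1 / N : ℂ) * ∑ i ∈ Finset.range N,
      ζ i * ee (A * (m:ℝ) ^ i * Int.fract x) * g (tn p i x)‖ ≤ 2 * (4 * (1 / ((k:ℝ) + 1))) := by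
    intro k
    set ε : ℝ := 1 / ((k:ℝ) + 1) with hεd
    have hε : 0 < ε := by positivity
    set G := {x | ∀ᶠ N : ℕ in atTop, ‖(1 / N : ℂ) * ∑ i ∈ Finset.range N,
      ζ i * ee (A * (m:ℝ) ^ i * Int.fract x) * g (tn p i x)‖ ≤ 2 * (4 * ε)} with hG
    have hsmall : ∀ η : ℝ, 0 < η → μ Gᶜ ≤ ENNReal.ofReal (2 * η) := by
      intro η hη
      obtain ⟨s, N0, h⟩ := core_fin hp hT herg hfr hη0 hJ hpm hind hA hζ hg1 hLg hgL hgm hε hη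
      set E : ℕ → Set ℝ := fun N1 => {x | ∃ N, N0 ≤ N ∧ N ≤ N1 ∧ 4 * ε * N <
        ‖∑ i ∈ Finset.range N, ζ (i + s) * ee (A * (m:ℝ) ^ (i + s) * Int.fract x) * g (tn p (i + s) x)‖}
      have hE : ∀ N1, μ (E N1) ≤ ENNReal.ofReal (2 * η) := by
        intro N1
        have := h N1
        rw [← ofReal_measureReal]
        exact ENNReal.ofReal_le_ofReal this
      have hEmono : Monotone E := by
        rintro a b hab x ⟨N, h1, h2, h3⟩
        exact ⟨N, h1, h2.trans hab, h3⟩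
      have hsub : Gᶜ ⊆ ⋃ N1, E N1 := by
        intro x hx
        by_contra hcon
        apply hx
        apply shift_avg (z := fun i => ζ i * ee (A * (m:ℝ) ^ i * Int.fract x) * g (tn p i x)) ?_
          (by positivity : 0 < 4 * ε) (s := s) (N0 := N0)
        · intro N hN
          by_contra hc
          push Not at hc
          exact hcon (mem_iUnion.2 ⟨N, N, hN, le_rfl, hc⟩)
        · intro i
          simp only [norm_mul, ee_norm, mul_one]
          exact mul_le_one₀ (hζ i) (norm_nonneg _) (hg1 _)
      refine (measure_mono hsub).trans ?_
      rw [hEmono.measure_iUnion]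
      exact iSup_le hE
    have hz : μ Gᶜ = 0 := by
      by_contra hne
      have hpos : 0 < (μ Gᶜ).toReal := ENNReal.toReal_pos hne (measure_ne_top _ _)
      have := hsmall ((μ Gᶜ).toReal / 4) (by positivity)
      have h2 := ENNReal.toReal_mono ENNReal.ofReal_ne_top this
      rw [ENNReal.toReal_ofReal (by positivity)] at h2
      linarith
    exact hz
  filter_upwards [ae_all_iff.2 key] with x hx
  rw [Metric.tendsto_atTop']
  intro δ hδ
  obtain ⟨k, hk⟩ := exists_nat_one_div_lt (show 0 < δ / 8 by positivity)
  obtain ⟨N, hN⟩ := eventually_atTop.1 (hx k)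
  refine ⟨N, fun n hn => ?_⟩
  rw [dist_zero_right]
  refine (hN n hn.le).trans_lt ?_
  linarith

lemma core (hp : 2 ≤ p) (hT : ∀ n, MeasurePreserving (tn p n) μ μ) (herg : Ergodic (Tmap p) μ)
    (hfr : ∀ᵐ x ∂μ, Int.fract x = x) {η0 : ℝ} (hη0 : 0 < η0)
    (hJ : ∀ n, ∫ x, Jf μ p n x ∂μ ≤ 1 - 2 * η0) {m : ℕ} (hpm : p < m)
    (hind : Irrational (Real.log p / Real.log m)) {A : ℝ} (hA : A ≠ 0)
    {ζ : ℕ → ℂ} (hζ : ∀ i, ‖ζ i‖ ≤ 1) {g : ℝ → ℂ} (hg1 : ∀ x, ‖g x‖ ≤ 1) {Lg : ℝ} (hLg : 0 ≤ Lg)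
    (hgL : ∀ x y, ‖g x - g y‖ ≤ Lg * |x - y|) (hgm : Measurable g) :
    ∀ᵐ x ∂μ, Tendsto (fun N : ℕ => (1 / N : ℂ) * ∑ i ∈ Finset.range N,
      ζ i * ee (A * (m:ℝ) ^ i * Int.fract x) * g (tn p i x)) atTop (𝓝 0) := by
  rcases lt_or_gt_of_ne hA with h | h
  · have := core_pos (μ := μ) hp hT herg hfr hη0 hJ hpm hind (A := -A) (by linarith)
      (ζ := fun i => (starRingEnd ℂ) (ζ i)) (fun i => by simpa using hζ i)
      (g := fun x => (starRingEnd ℂ) (g x)) (fun x => by simpa using hg1 x) hLg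
      (fun x y => by
        show ‖(starRingEnd ℂ) (g x) - (starRingEnd ℂ) (g y)‖ ≤ _
        rw [← map_sub, RCLike.norm_conj]; exact hgL x y)
      (RCLike.continuous_conj.measurable.comp hgm)
    filter_upwards [this] with x hx
    have h2 := (RCLike.continuous_conj.tendsto (0:ℂ)).comp hx
    rw [map_zero] at h2
    refine h2.congr fun N => ?_
    simp only [Function.comp, map_mul, map_sum, map_div₀, map_one, map_natCast, Complex.conj_conj]
    congr 1
    apply Finset.sum_congr rfl; intro i _
    rw [← ee_neg]
    congr 3; ring
  · exact core_pos hp hT herg hfr hη0 hJ hpm hind h hζ hg1 hLg hgL hgm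

end core


lemma integral_ee (k : ℤ) : ∫ s in Icc (0:ℝ) 1, ee (k * s) = if k = 0 then 1 else 0 := by
  split_ifs with h
  · subst h; simp [ee_zero, Measure.real]
  · rw [integral_Icc_eq_integral_Ioc, ← intervalIntegral.integral_of_le zero_le_one]
    have hk : (k:ℂ) ≠ 0 := by exact_mod_cast h
    have hc : (2 * Real.pi * k * Complex.I : ℂ) ≠ 0 := by
      simp [hk, Real.pi_ne_zero]
    have e : ∀ s : ℝ, ee (k * s) = Complex.exp ((2 * Real.pi * k * Complex.I) * s) := by
      intro s; unfold ee; congr 1; push_cast; ring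
    simp only [e]
    rw [integral_exp_mul_complex hc]
    have h1 : Complex.exp ((2 * Real.pi * k * Complex.I) * ((1:ℝ):ℂ)) = 1 := by
      rw [← e 1, mul_one, ee_int]
    rw [h1]; simp

lemma fourier_eq_ee (k : ℤ) (s : ℝ) : fourier k (s : AddCircle (1:ℝ)) = ee (k * s) := by
  rw [fourier_coe_apply]; unfold ee; congr 1; push_cast; ring

/-- approximating limits -/
lemma tendsto_of_approx {E : Type*} [NormedAddCommGroup E] {a : ℕ → E} {l : E}
    (h : ∀ ε : ℝ, 0 < ε → ∃ (b : ℕ → E) (l' : E), Tendsto b atTop (𝓝 l') ∧ (∀ᶠ N in atTop, ‖a N - b N‖ ≤ ε) ∧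
      ‖l - l'‖ ≤ ε) : Tendsto a atTop (𝓝 l) := by
  rw [Metric.tendsto_atTop']
  intro δ hδ
  obtain ⟨b, l', hb, h1, h2⟩ := h (δ / 4) (by positivity)
  have h3 := (Metric.tendsto_nhds.1 hb) (δ / 4) (by positivity)
  obtain ⟨N, hN⟩ := eventually_atTop.1 (h1.and h3)
  refine ⟨N, fun n hn => ?_⟩
  obtain ⟨h4, h5⟩ := hN n hn.le
  rw [dist_eq_norm] at h5 ⊢
  have e : a n - l = (a n - b n) + (b n - l') - (l - l') := by abel
  rw [e]
  have := norm_sub_le ((a n - b n) + (b n - l')) (l - l')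
  have := norm_add_le (a n - b n) (b n - l')
  linarith

lemma avg_norm_le {z : ℕ → ℂ} {C : ℝ} (hC : 0 ≤ C) (hz : ∀ i, ‖z i‖ ≤ C) (N : ℕ) :
    ‖(1 / N : ℂ) * ∑ i ∈ Finset.range N, z i‖ ≤ C := by
  rcases Nat.eq_zero_or_pos N with rfl | hN
  · simpa using hC
  have hN0 : (0:ℝ) < N := by exact_mod_cast hN
  rw [norm_mul, norm_div, norm_one, Complex.norm_natCast, one_div_mul_eq_div, div_le_iff₀ hN0]
  refine (norm_sum_le _ _).trans ((Finset.sum_le_sum fun i _ => hz i).trans ?_)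
  simp [mul_comm]

lemma continuous_circle_integrable (ψ : C(AddCircle (1:ℝ), ℂ)) :
    Integrable (fun s : ℝ => ψ (s : AddCircle (1:ℝ))) (volume.restrict (Icc (0:ℝ) 1)) := by
  have : Continuous fun s : ℝ => ψ (s : AddCircle (1:ℝ)) := ψ.continuous.comp continuous_quot_mk
  exact this.continuousOn.integrableOn_compact isCompact_Icc

lemma fourier_avg {u : ℕ → ℝ} {w : ℕ → ℂ} (hw : ∀ i, ‖w i‖ ≤ 1) {I : ℂ} (hI : ‖I‖ ≤ 1)
    (h : ∀ k : ℤ, Tendsto (fun N : ℕ => (1 / N : ℂ) * ∑ i ∈ Finset.range N, ee (k * u i) * w i) atTop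
      (𝓝 (if k = 0 then I else 0))) (ψ : C(AddCircle (1:ℝ), ℂ)) :
    Tendsto (fun N : ℕ => (1 / N : ℂ) * ∑ i ∈ Finset.range N, ψ (u i : AddCircle (1:ℝ)) * w i) atTop
      (𝓝 ((∫ s in Icc (0:ℝ) 1, ψ (s : AddCircle (1:ℝ))) * I)) := by
  have hspan : ∀ ψ ∈ Submodule.span ℂ (range (fourier (T := (1:ℝ)))),
      Tendsto (fun N : ℕ => (1 / N : ℂ) * ∑ i ∈ Finset.range N, ψ (u i : AddCircle (1:ℝ)) * w i) atTop
      (𝓝 ((∫ s in Icc (0:ℝ) 1, ψ (s : AddCircle (1:ℝ))) * I)) := by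
    intro ψ hψ
    induction hψ using Submodule.span_induction with
    | mem x hx =>
      obtain ⟨k, rfl⟩ := hx
      simp only [fourier_eq_ee, integral_ee]
      convert h k using 2
      split_ifs <;> simp
    | zero => simp
    | add x y _ _ hx hy =>
      have := hx.add hy
      rw [← add_mul, ← integral_add (continuous_circle_integrable x) (continuous_circle_integrable y)] at this
      refine this.congr fun N => ?_
      rw [← mul_add, ← Finset.sum_add_distrib]
      congr 1; apply Finset.sum_congr rfl; intro i _
      simp only [ContinuousMap.add_apply]; ring
    | smul c x _ hx =>
      have := hx.const_mul c
      rw [← mul_assoc, ← integral_const_mul] at this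
      refine this.congr fun N => ?_
      rw [mul_left_comm, Finset.mul_sum]
      congr 1; apply Finset.sum_congr rfl; intro i _
      simp only [ContinuousMap.smul_apply, smul_eq_mul]; ring
  apply tendsto_of_approx
  intro ε hε
  have hmem : ψ ∈ closure (Submodule.span ℂ (range (fourier (T := (1:ℝ)))) : Set C(AddCircle (1:ℝ), ℂ)) := by
    rw [← Submodule.topologicalClosure_coe, span_fourier_closure_eq_top]; trivial
  obtain ⟨φ, hφ, hd⟩ := Metric.mem_closure_iff.1 hmem ε hε
  rw [dist_eq_norm] at hd
  have hpt : ∀ y, ‖ψ y - φ y‖ ≤ ε := fun y => ((ψ - φ).norm_coe_le_norm y).trans hd.le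
  refine ⟨_, _, hspan φ hφ, Eventually.of_forall fun N => ?_, ?_⟩
  · rw [← mul_sub, ← Finset.sum_sub_distrib]
    apply avg_norm_le hε.le
    intro i
    rw [← sub_mul, norm_mul]
    calc _ ≤ ε * 1 := by gcongr; exacts [hpt _, hw i]
      _ = ε := mul_one _
  · rw [← sub_mul, ← integral_sub (continuous_circle_integrable ψ) (continuous_circle_integrable φ), norm_mul]
    have : ‖∫ s in Icc (0:ℝ) 1, (ψ (s : AddCircle (1:ℝ)) - φ (s : AddCircle (1:ℝ)))‖ ≤ ε := by
      refine (norm_integral_le_of_norm_le_const (C := ε) (Eventually.of_forall fun s => hpt _)).trans ?_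
      simp [Measure.real]
    calc _ ≤ ε * 1 := by gcongr
      _ = ε := mul_one _

/-- clamp -/
noncomputable def cl (y : ℝ) : ℝ := max 0 (min 1 y)
lemma cl_mono {x y : ℝ} (h : x ≤ y) : cl x ≤ cl y := max_le_max le_rfl (min_le_min le_rfl h)
lemma cl_nonneg (y : ℝ) : 0 ≤ cl y := le_max_left _ _
lemma cl_le_one (y : ℝ) : cl y ≤ 1 := max_le zero_le_one (min_le_left _ _)
lemma cl_one {y : ℝ} (h : 1 ≤ y) : cl y = 1 := by unfold cl; rw [min_eq_left h]; simp
lemma cl_zero {y : ℝ} (h : y ≤ 0) : cl y = 0 := by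
  unfold cl; exact max_eq_left ((min_le_right _ _).trans h)
lemma cl_continuous : Continuous cl := by unfold cl; fun_prop
lemma cl_lip (x y : ℝ) : |cl x - cl y| ≤ |x - y| := by
  have h : LipschitzWith 1 cl := (LipschitzWith.id.const_min 1).const_max 0
  have := h.dist_le_mul x y
  simpa [Real.dist_eq] using this

/-- tent functions -/
noncomputable def tent (H h : ℕ) (t : ℝ) : ℝ := cl (H * t - h + 1) - cl (H * t - h)
lemma tent_nonneg (H h : ℕ) (t : ℝ) : 0 ≤ tent H h t := sub_nonneg.2 (cl_mono (by linarith))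
lemma tent_le_one (H h : ℕ) (t : ℝ) : tent H h t ≤ 1 := by
  unfold tent; linarith [cl_le_one (H * t - h + 1), cl_nonneg (H * t - h)]
lemma tent_continuous (H h : ℕ) : Continuous (tent H h) := by
  unfold tent
  exact (cl_continuous.comp (by fun_prop)).sub (cl_continuous.comp (by fun_prop))
lemma tent_lip (H h : ℕ) (x y : ℝ) : |tent H h x - tent H h y| ≤ (2 * H) * |x - y| := by
  unfold tent
  have h1 := cl_lip (H * x - h + 1) (H * y - h + 1)
  have h2 := cl_lip (H * x - h) (H * y - h)
  rw [show (H:ℝ) * x - h + 1 - (H * y - h + 1) = H * (x - y) by ring, abs_mul, Nat.abs_cast] at h1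
  rw [show (H:ℝ) * x - h - (H * y - h) = H * (x - y) by ring, abs_mul, Nat.abs_cast] at h2
  have h3 := abs_sub (cl (H * x - h + 1) - cl (H * y - h + 1)) (cl (H * x - h) - cl (H * y - h))
  rw [show cl (H * x - h + 1) - cl (H * x - h) - (cl (H * y - h + 1) - cl (H * y - h))
    = cl (H * x - h + 1) - cl (H * y - h + 1) - (cl (H * x - h) - cl (H * y - h)) by ring]
  linarith
lemma tent_sum (H : ℕ) {t : ℝ} (h0 : 0 ≤ t) (h1 : t ≤ 1) : ∑ h ∈ Finset.range (H + 1), tent H h t = 1 := by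
  have hH : (0:ℝ) ≤ H := Nat.cast_nonneg _
  have e := Finset.sum_range_sub' (fun h : ℕ => cl (H * t - h + 1)) (H + 1)
  have e2 : ∀ h : ℕ, tent H h t = cl (H * t - h + 1) - cl (H * t - (h + 1 : ℕ) + 1) := by
    intro h; unfold tent; congr 2; push_cast; ring
  simp only [e2]
  rw [e, cl_one (by push_cast; nlinarith), cl_zero (by push_cast; nlinarith)]; simp
lemma tent_eq_zero {H h : ℕ} {t : ℝ} (hh : 1 < |H * t - h|) : tent H h t = 0 := by
  unfold tent
  rcases lt_abs.1 hh with h1 | h1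
  · rw [cl_one (by linarith), cl_one h1.le]; simp
  · rw [cl_zero (by linarith), cl_zero (by linarith)]; simp


section det
variable {μ : Measure ℝ} [IsProbabilityMeasure μ]

instance instProbIcc : IsProbabilityMeasure (volume.restrict (Icc (0:ℝ) 1)) := ⟨by simp⟩

/-- the averages of `φ` along `(u, v)` converge to the integral -/
def GoodF (μ : Measure ℝ) (u v : ℕ → ℝ) (φ : ℝ × ℝ → ℝ) : Prop :=
  Integrable φ ((volume.restrict (Icc (0:ℝ) 1)).prod μ) ∧
  Tendsto (fun N : ℕ => (1 / N : ℝ) * ∑ i ∈ Finset.range N, φ (u i, v i)) atTop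
    (𝓝 (∫ q, φ q ∂((volume.restrict (Icc (0:ℝ) 1)).prod μ)))

lemma GoodF.sum {u v : ℕ → ℝ} {φ : ℕ → ℝ × ℝ → ℝ} (M : ℕ) (h : ∀ j, GoodF μ u v (φ j)) :
    GoodF μ u v (fun q => ∑ j ∈ Finset.range M, φ j q) := by
  refine ⟨integrable_finsetSum _ fun j _ => (h j).1, ?_⟩
  rw [integral_finsetSum _ fun j _ => (h j).1]
  refine (tendsto_finsetSum _ fun j _ => (h j).2).congr fun N => ?_
  rw [← Finset.mul_sum, Finset.sum_comm]

lemma good_basic {u v : ℕ → ℝ} (hu : ∀ i, u i ∈ Icc (0:ℝ) 1)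
    (h : ∀ (k : ℤ) (H h : ℕ), Tendsto (fun N : ℕ => (1 / N : ℂ) * ∑ i ∈ Finset.range N,
      ee (k * u i) * ((tent H h (v i) : ℝ) : ℂ)) atTop (𝓝 (if k = 0 then ((∫ t, tent H h t ∂μ : ℝ) : ℂ) else 0)))
    {ψ : ℝ → ℝ} (hψ : Continuous ψ) (h0 : ψ 0 = ψ 1) (H j : ℕ) :
    GoodF μ u v (fun q => ψ q.1 * tent H j q.2) := by
  have hti : Integrable (tent H j) μ := integrable_bddR (tent_continuous H j).measurable (C := 1) fun x => by
    rw [Real.norm_of_nonneg (tent_nonneg _ _ _)]; exact tent_le_one _ _ _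
  have hψi : Integrable ψ (volume.restrict (Icc (0:ℝ) 1)) := hψ.continuousOn.integrableOn_compact isCompact_Icc
  refine ⟨hψi.mul_prod hti, ?_⟩
  have hprod : ∫ q, ψ q.1 * tent H j q.2 ∂((volume.restrict (Icc (0:ℝ) 1)).prod μ)
      = (∫ s in Icc (0:ℝ) 1, ψ s) * ∫ t, tent H j t ∂μ := integral_prod_mul _ _
  rw [hprod]
  set ψc : ℝ → ℂ := fun s => (ψ s : ℂ) with hψc
  let Ψ : C(AddCircle (1:ℝ), ℂ) := ⟨AddCircle.liftIco 1 0 ψc, AddCircle.liftIco_zero_continuous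
    (by simp [hψc, h0]) (Complex.continuous_ofReal.comp hψ).continuousOn⟩
  have hΨ : ∀ s ∈ Icc (0:ℝ) 1, Ψ (s : AddCircle (1:ℝ)) = (ψ s : ℂ) := by
    intro s hs
    rcases eq_or_lt_of_le hs.2 with rfl | h1
    · have e : ((1:ℝ) : AddCircle (1:ℝ)) = ((0:ℝ) : AddCircle (1:ℝ)) := by
        rw [AddCircle.coe_period]; simp
      rw [e, ← h0]
      exact AddCircle.liftIco_zero_coe_apply (f := ψc) ⟨le_rfl, zero_lt_one⟩
    · exact AddCircle.liftIco_zero_coe_apply (f := ψc) ⟨hs.1, h1⟩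
  have hI0 : 0 ≤ ∫ t, tent H j t ∂μ := integral_nonneg fun t => tent_nonneg _ _ _
  have hI1 : ∫ t, tent H j t ∂μ ≤ 1 := by
    have := integral_mono hti (integrable_const (1:ℝ)) (fun t => tent_le_one H j t)
    simpa using this
  have key := fourier_avg (u := u) (w := fun i => ((tent H j (v i) : ℝ) : ℂ)) (fun i => by
    rw [Complex.norm_real, Real.norm_of_nonneg (tent_nonneg _ _ _)]; exact tent_le_one _ _ _)
    (I := ((∫ t, tent H j t ∂μ : ℝ) : ℂ)) (by
      rw [Complex.norm_real, Real.norm_of_nonneg hI0]; exact hI1) (fun k => h k H j) Ψ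
  have e1 : ∫ s in Icc (0:ℝ) 1, Ψ (s : AddCircle (1:ℝ)) = ((∫ s in Icc (0:ℝ) 1, ψ s : ℝ) : ℂ) := by
    rw [setIntegral_congr_fun measurableSet_Icc hΨ, integral_complex_ofReal]
  rw [e1] at key
  have h2 := (Complex.continuous_re.tendsto _).comp key
  rw [← Complex.ofReal_mul, Complex.ofReal_re] at h2
  refine h2.congr fun N => ?_
  have e3 : (1 / N : ℂ) * ∑ i ∈ Finset.range N, Ψ (u i : AddCircle (1:ℝ)) * ((tent H j (v i) : ℝ) : ℂ)
      = (((1 / N : ℝ) * ∑ i ∈ Finset.range N, ψ (u i) * tent H j (v i) : ℝ) : ℂ) := by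
    push_cast
    congr 1; apply Finset.sum_congr rfl; intro i _
    rw [hΨ _ (hu i)]
  show ((1 / N : ℂ) * ∑ i ∈ Finset.range N, Ψ (u i : AddCircle (1:ℝ)) * ((tent H j (v i) : ℝ) : ℂ)).re = _
  rw [e3, Complex.ofReal_re]

/-- cutoff -/
noncomputable def chi (n : ℕ) (s : ℝ) : ℝ := 1 - (2 * s - 1) ^ (2 * n)
lemma chi_continuous (n : ℕ) : Continuous (chi n) := by unfold chi; fun_prop
lemma chi_nonneg (n : ℕ) {s : ℝ} (hs : s ∈ Icc (0:ℝ) 1) : 0 ≤ chi n s := by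
  unfold chi
  have : |2 * s - 1| ≤ 1 := abs_le.2 ⟨by linarith [hs.1], by linarith [hs.2]⟩
  rw [← (even_two_mul n).pow_abs]
  linarith [pow_le_one₀ (n := 2 * n) (abs_nonneg _) this]
lemma chi_le_one (n : ℕ) (s : ℝ) : chi n s ≤ 1 := by
  unfold chi; linarith [(even_two_mul n).pow_nonneg (2 * s - 1)]
lemma chi_zero {n : ℕ} (hn : n ≠ 0) : chi n 0 = 0 := by
  unfold chi; simp [pow_mul]
lemma chi_one (n : ℕ) : chi n 1 = 0 := by unfold chi; norm_num
lemma chi_integral (n : ℕ) : ∫ s in Icc (0:ℝ) 1, (1 - chi n s) = 1 / (2 * n + 1) := by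
  unfold chi
  rw [integral_Icc_eq_integral_Ioc, ← intervalIntegral.integral_of_le zero_le_one]
  simp only [sub_sub_cancel]
  rw [intervalIntegral.integral_comp_mul_sub (fun x => x ^ (2 * n)) two_ne_zero, integral_pow]
  have : (-1:ℝ) ^ (2 * n + 1) = -1 := by rw [pow_succ, pow_mul]; simp
  norm_num [this]
  ring

lemma avg_le_avg {a b : ℕ → ℝ} (h : ∀ i, a i ≤ b i) (N : ℕ) :
    (1 / N : ℝ) * ∑ i ∈ Finset.range N, a i ≤ (1 / N : ℝ) * ∑ i ∈ Finset.range N, b i :=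
  mul_le_mul_of_nonneg_left (Finset.sum_le_sum fun i _ => h i) (by positivity)

lemma det_limit (hsupp : μ (Icc (0:ℝ) 1)ᶜ = 0) {u v : ℕ → ℝ} (hu : ∀ i, u i ∈ Icc (0:ℝ) 1)
    (hv : ∀ i, v i ∈ Icc (0:ℝ) 1)
    (h : ∀ (k : ℤ) (H h : ℕ), Tendsto (fun N : ℕ => (1 / N : ℂ) * ∑ i ∈ Finset.range N,
      ee (k * u i) * ((tent H h (v i) : ℝ) : ℂ)) atTop (𝓝 (if k = 0 then ((∫ t, tent H h t ∂μ : ℝ) : ℂ) else 0)))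
    (F : BoundedContinuousFunction (ℝ × ℝ) ℝ) :
    Tendsto (fun N : ℕ => (1 / N : ℝ) * ∑ i ∈ Finset.range N, F (u i, v i)) atTop
      (𝓝 (∫ q, F q ∂((volume.restrict (Icc (0:ℝ) 1)).prod μ))) := by
  set P := (volume.restrict (Icc (0:ℝ) 1)).prod μ with hP
  apply tendsto_of_approx
  intro ε hε
  set C : ℝ := ‖F‖ with hC
  have hC0 : 0 ≤ C := norm_nonneg _
  have hFC : ∀ q, |F q| ≤ C := fun q => F.norm_coe_le_norm q
  -- parameters
  obtain ⟨n, hn⟩ := exists_nat_gt (C / (ε / 4))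
  have hCn : C * (1 / (2 * (n:ℝ) + 1)) ≤ ε / 4 := by
    rw [div_lt_iff₀ (by positivity)] at hn
    have : (0:ℝ) ≤ n := Nat.cast_nonneg _
    rw [mul_one_div, div_le_iff₀ (by positivity)]; nlinarith
  have huc : UniformContinuousOn F (Icc (0:ℝ) 1 ×ˢ Icc (0:ℝ) 1) :=
    (isCompact_Icc.prod isCompact_Icc).uniformContinuousOn_of_continuous F.continuous.continuousOn
  rw [Metric.uniformContinuousOn_iff] at huc
  obtain ⟨δ, hδ, hF⟩ := huc (ε / 4) (by positivity)
  obtain ⟨H0, hH0⟩ := exists_nat_one_div_lt hδ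
  set H : ℕ := H0 + 1 with hH
  have hHpos : (0:ℝ) < H := by rw [hH]; positivity
  have hHδ : 1 / (H:ℝ) < δ := by rw [hH]; push_cast; exact hH0
  -- the approximant
  have hnn : n + 1 ≠ 0 := by omega
  set n' := n + 1 with hn'
  set G : ℝ × ℝ → ℝ := fun q => ∑ j ∈ Finset.range (H + 1), (F (q.1, (j:ℝ) / H) * chi n' q.1) * tent H j q.2 with hG
  have hGgood : GoodF μ u v G := GoodF.sum (H + 1) fun j => good_basic hu h
    (ψ := fun s => F (s, (j:ℝ) / H) * chi n' s)
    ((F.continuous.comp (by fun_prop)).mul (chi_continuous _)) (by simp [chi_zero hnn, chi_one]) H j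
  set X : ℝ × ℝ → ℝ := fun q => ∑ j ∈ Finset.range (H + 1), chi n' q.1 * tent H j q.2 with hX
  have hXgood : GoodF μ u v X := GoodF.sum (H + 1) fun j => good_basic hu h
    (ψ := chi n') (chi_continuous _) (by rw [chi_zero hnn, chi_one]) H j
  have hXq : ∀ q ∈ Icc (0:ℝ) 1 ×ˢ Icc (0:ℝ) 1, X q = chi n' q.1 := by
    intro q hq
    simp only [hX]
    rw [← Finset.mul_sum, tent_sum H hq.2.1 hq.2.2, mul_one]
  have hpt : ∀ q ∈ Icc (0:ℝ) 1 ×ˢ Icc (0:ℝ) 1, |F q - G q| ≤ C * (1 - X q) + ε / 4 := by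
    intro q hq
    have hχ0 := chi_nonneg n' hq.1
    have hχ1 := chi_le_one n' q.1
    have hts := tent_sum H hq.2.1 hq.2.2
    rw [hXq q hq]
    have e : F q - G q = F q * (1 - chi n' q.1) + chi n' q.1 * ∑ j ∈ Finset.range (H + 1),
        (F q - F (q.1, (j:ℝ) / H)) * tent H j q.2 := by
      have e1 : ∑ j ∈ Finset.range (H + 1), (F q - F (q.1, (j:ℝ) / H)) * tent H j q.2
          = F q - ∑ j ∈ Finset.range (H + 1), F (q.1, (j:ℝ) / H) * tent H j q.2 := by
        simp only [sub_mul]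
        rw [Finset.sum_sub_distrib, ← Finset.mul_sum, hts, mul_one]
      have e2 : G q = chi n' q.1 * ∑ j ∈ Finset.range (H + 1), F (q.1, (j:ℝ) / H) * tent H j q.2 := by
        simp only [hG]
        rw [Finset.mul_sum]; apply Finset.sum_congr rfl; intro j _; ring
      rw [e1, e2]; ring
    have hb : |∑ j ∈ Finset.range (H + 1), (F q - F (q.1, (j:ℝ) / H)) * tent H j q.2| ≤ ε / 4 := by
      refine (Finset.abs_sum_le_sum_abs _ _).trans ?_
      calc _ ≤ ∑ j ∈ Finset.range (H + 1), ε / 4 * tent H j q.2 := by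
            apply Finset.sum_le_sum
            intro j hj
            rw [abs_mul, abs_of_nonneg (tent_nonneg H j q.2)]
            by_cases hfar : 1 < |H * q.2 - j|
            · rw [tent_eq_zero hfar]; simp
            · push Not at hfar
              apply mul_le_mul_of_nonneg_right _ (tent_nonneg _ _ _)
              have hj1 : (j:ℝ) ≤ H := by exact_mod_cast Nat.lt_succ_iff.1 (Finset.mem_range.1 hj)
              have hmem : (q.1, (j:ℝ) / H) ∈ Icc (0:ℝ) 1 ×ˢ Icc (0:ℝ) 1 :=
                ⟨hq.1, by show 0 ≤ (j:ℝ) / H; positivity, by show (j:ℝ) / H ≤ 1; rw [div_le_one hHpos]; exact hj1⟩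
              have hd : dist q (q.1, (j:ℝ) / H) < δ := by
                rw [Prod.dist_eq]
                simp only [dist_self, Real.dist_eq]
                rw [max_eq_right (abs_nonneg _)]
                refine lt_of_le_of_lt ?_ hHδ
                rw [show q.2 - (j:ℝ) / H = (H * q.2 - j) / H by field_simp, abs_div, abs_of_pos hHpos]
                gcongr
              have := hF q hq _ hmem hd
              rw [Real.dist_eq] at this
              exact this.le
        _ = ε / 4 := by rw [← Finset.mul_sum, hts, mul_one]
    rw [e]
    refine (abs_add_le _ _).trans ?_
    rw [abs_mul, abs_mul, abs_of_nonneg (by linarith : 0 ≤ 1 - chi n' q.1), abs_of_nonneg hχ0]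
    have h1 := mul_le_mul_of_nonneg_right (hFC q) (by linarith : 0 ≤ 1 - chi n' q.1)
    have h2 := abs_nonneg (∑ j ∈ Finset.range (H + 1), (F q - F (q.1, (j:ℝ) / H)) * tent H j q.2)
    nlinarith
  have hae : ∀ᵐ q ∂P, q ∈ Icc (0:ℝ) 1 ×ˢ Icc (0:ℝ) 1 := by
    have h1 : ∀ᵐ s ∂(volume.restrict (Icc (0:ℝ) 1)), s ∈ Icc (0:ℝ) 1 := ae_restrict_mem measurableSet_Icc
    have h2 : ∀ᵐ t ∂μ, t ∈ Icc (0:ℝ) 1 := hsupp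
    have h1' := Measure.quasiMeasurePreserving_fst (μ := volume.restrict (Icc (0:ℝ) 1)) (ν := μ) |>.ae h1
    have h2' := Measure.quasiMeasurePreserving_snd (μ := volume.restrict (Icc (0:ℝ) 1)) (ν := μ) |>.ae h2
    filter_upwards [h1', h2'] with q a b using ⟨a, b⟩
  have hFi : Integrable F P := F.integrable _
  have hX1 : C * (1 - ∫ q, X q ∂P) ≤ ε / 4 := by
    have e : ∫ q, X q ∂P = ∫ s in Icc (0:ℝ) 1, chi n' s := by
      rw [integral_congr_ae (hae.mono fun q hq => hXq q hq)]
      have := integral_prod_mul (μ := volume.restrict (Icc (0:ℝ) 1)) (ν := μ) (chi n') (fun _ => (1:ℝ))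
      simpa using this
    have e2 : 1 - ∫ q, X q ∂P = 1 / (2 * (n':ℝ) + 1) := by
      rw [← chi_integral n', integral_sub (integrable_const _)
        ((chi_continuous n').continuousOn.integrableOn_compact isCompact_Icc), e]
      simp [Measure.real]
    rw [e2]
    refine le_trans ?_ hCn
    apply mul_le_mul_of_nonneg_left _ hC0
    apply one_div_le_one_div_of_le (by positivity)
    rw [hn']; push_cast; linarith
  refine ⟨_, _, hGgood.2, ?_, ?_⟩
  · have hlim := ((tendsto_const_nhds (x := (1:ℝ))).sub hXgood.2).const_mul C
    have hev := (tendsto_order.1 hlim).2 (ε / 2) (by linarith)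
    filter_upwards [hev, eventually_gt_atTop 0] with N hN hNpos
    have hN0 : (0:ℝ) < N := by exact_mod_cast hNpos
    rw [← mul_sub, ← Finset.sum_sub_distrib, Real.norm_eq_abs, abs_mul, abs_of_nonneg (by positivity : (0:ℝ) ≤ 1 / N)]
    have hb : (1 / N : ℝ) * |∑ i ∈ Finset.range N, (F (u i, v i) - G (u i, v i))|
        ≤ (1 / N : ℝ) * ∑ i ∈ Finset.range N, (C * (1 - X (u i, v i)) + ε / 4) := by
      apply mul_le_mul_of_nonneg_left _ (by positivity)
      refine (Finset.abs_sum_le_sum_abs _ _).trans (Finset.sum_le_sum fun i _ => hpt _ ⟨hu i, hv i⟩)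
    refine hb.trans ?_
    have e : (1 / N : ℝ) * ∑ i ∈ Finset.range N, (C * (1 - X (u i, v i)) + ε / 4)
        = C * (1 - (1 / N : ℝ) * ∑ i ∈ Finset.range N, X (u i, v i)) + ε / 4 := by
      rw [Finset.sum_add_distrib, ← Finset.mul_sum, Finset.sum_sub_distrib]
      simp only [Finset.sum_const, Finset.card_range, nsmul_eq_mul, mul_one]
      field_simp
    rw [e]; linarith
  · rw [← integral_sub hFi hGgood.1]
    refine (norm_integral_le_integral_norm _).trans ?_
    have hb : ∫ q, ‖F q - G q‖ ∂P ≤ ∫ q, (C * (1 - X q) + ε / 4) ∂P := by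
      apply integral_mono_ae (hFi.sub hGgood.1).norm
        ((((integrable_const (1:ℝ)).sub hXgood.1).const_mul C).add (integrable_const _))
      filter_upwards [hae] with q hq using hpt q hq
    refine hb.trans ?_
    have i1 : Integrable (fun q => C * (1 - X q)) P := ((integrable_const (1:ℝ)).sub hXgood.1).const_mul C
    have i2 : Integrable (fun _ : ℝ × ℝ => ε / 4) P := integrable_const _
    rw [integral_add i1 i2, integral_const_mul, integral_sub (integrable_const _) hXgood.1]
    simp only [integral_const, Measure.real, measure_univ, ENNReal.toReal_one, smul_eq_mul, one_mul]
    linarith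

end det


section final
variable {p : ℕ} {μ : Measure ℝ} [IsProbabilityMeasure μ]

lemma supp_Ico (herg : Ergodic (Tmap p) μ) : μ (Ico (0:ℝ) 1)ᶜ = 0 := by
  have h := herg.toMeasurePreserving.measure_preimage (s := (Ico (0:ℝ) 1)ᶜ) measurableSet_Ico.compl.nullMeasurableSet
  rw [← h]
  have : Tmap p ⁻¹' (Ico (0:ℝ) 1)ᶜ = ∅ := by
    ext x
    simp only [mem_preimage, mem_compl_iff, mem_empty_iff_false, iff_false, not_not]
    exact ⟨Int.fract_nonneg _, Int.fract_lt_one _⟩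
  rw [this]; simp

lemma ae_fract (herg : Ergodic (Tmap p) μ) : ∀ᵐ x ∂μ, Int.fract x = x := by
  have : ∀ᵐ x ∂μ, x ∈ Ico (0:ℝ) 1 := supp_Ico herg
  filter_upwards [this] with x hx using Int.fract_eq_self.2 hx

lemma mp_tn (herg : Ergodic (Tmap p) μ) (n : ℕ) : MeasurePreserving (tn p n) μ μ := by
  cases n with
  | zero =>
    refine (MeasurePreserving.id μ).congr (tn_measurable 0) ?_
    filter_upwards [ae_fract herg] with x hx
    rw [tn_zero, hx]; rfl
  | succ n =>
    have e : tn p (n+1) = (Tmap p)^[n+1] := by funext x; rw [Tmap_iter_succ]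
    rw [e]; exact herg.toMeasurePreserving.iterate (n+1)

lemma ee_iter (m i : ℕ) (k : ℤ) (y : ℝ) : ee (k * (Tmap m)^[i] y) = ee (k * ((m:ℝ) ^ i * y)) := by
  cases i with
  | zero => simp
  | succ i =>
    rw [Tmap_iter_succ]
    have e : (k:ℝ) * ((m:ℝ) ^ (i+1) * y) = k * tn m (i+1) y + ((k * ⌊(m:ℝ) ^ (i+1) * y⌋ : ℤ) : ℝ) := by
      unfold tn; push_cast
      rw [← mul_add, Int.fract_add_floor]
    rw [e, ee_add, ee_int, mul_one]

lemma Tmap_iter_mem (m i : ℕ) {y : ℝ} (hy : y ∈ Icc (0:ℝ) 1) : (Tmap m)^[i] y ∈ Icc (0:ℝ) 1 := by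
  cases i with
  | zero => simpa using hy
  | succ i => rw [Tmap_iter_succ]; exact ⟨tn_nonneg _ _, (tn_lt_one _ _).le⟩

end final

/-- Let `μ` be a `T_p`-invariant ergodic probability measure on `[0,1]`
(viewed on the circle) of positive dimension, `m > p` with `m ≁ p`, and `f(x) = a x + b`
a non-singular affine map with `f([0,1]) ⊆ [0,1]`.  Then for `μ`-a.e. `x` the empirical
measures of the orbit of `(f(x), x)` under `T_m × T_p` converge weak-* to `λ × μ`. -/
theorem simultaneous_equidistribution_perturbed_times_m_times_p
    (p m : ℕ) (hp : 2 ≤ p) (hpm : p < m)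
    (hind : Irrational (Real.log p / Real.log m))
    (μ : Measure ℝ) [IsProbabilityMeasure μ] (hμsupp : μ (Set.Icc (0:ℝ) 1)ᶜ = 0)
    (herg : Ergodic (Tmap p) μ) (hdim : 0 < measureDim μ)
    (a b : ℝ) (ha : a ≠ 0) (f : ℝ → ℝ) (hf : f = fun x => a * x + b)
    (hfim : f '' Set.Icc 0 1 ⊆ Set.Icc 0 1) :
    ∀ᵐ x ∂μ, ∀ F : BoundedContinuousFunction (ℝ × ℝ) ℝ,
      Tendsto (fun N : ℕ => (1 / N : ℝ) * ∑ i ∈ Finset.range N,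
          F ((Tmap m)^[i] (f x), (Tmap p)^[i] x)) atTop
        (𝓝 (∫ q, F q ∂((volume.restrict (Set.Icc (0:ℝ) 1)).prod μ))) := by
  have hfr := ae_fract herg
  have hT := mp_tn herg
  obtain ⟨η0, hη0, hJ⟩ := stepD hp hT (supp_Ico herg) hdim
  have key : ∀ (k : ℤ) (H h : ℕ), ∀ᵐ x ∂μ, Tendsto (fun N : ℕ => (1 / N : ℂ) * ∑ i ∈ Finset.range N,
      ee (k * (Tmap m)^[i] (f x)) * ((tent H h ((Tmap p)^[i] x) : ℝ) : ℂ)) atTop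
      (𝓝 (if k = 0 then ((∫ t, tent H h t ∂μ : ℝ) : ℂ) else 0)) := by
    intro k H h
    split_ifs with hk
    · subst hk
      have := birkhoff01 herg (tent_continuous H h).measurable (tent_nonneg H h) (tent_le_one H h)
      filter_upwards [this] with x hx
      have h2 := (Complex.continuous_ofReal.tendsto _).comp hx
      refine h2.congr fun N => ?_
      simp [ee_zero]
    · have hk' : (k:ℝ) ≠ 0 := by exact_mod_cast hk
      have := core (μ := μ) hp hT herg hfr hη0 hJ hpm hind (A := k * a) (mul_ne_zero hk' ha)
        (ζ := fun i => ee (k * ((m:ℝ) ^ i * b))) (fun i => (ee_norm _).le)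
        (g := fun t => ((tent H h t : ℝ) : ℂ)) (fun t => by
          rw [Complex.norm_real, Real.norm_of_nonneg (tent_nonneg _ _ _)]; exact tent_le_one _ _ _)
        (Lg := 2 * H) (by positivity) (fun s t => by
          rw [← Complex.ofReal_sub, Complex.norm_real]; exact tent_lip H h s t)
        (Complex.continuous_ofReal.measurable.comp (tent_continuous H h).measurable)
      filter_upwards [this, hfr] with x hx hxf
      refine hx.congr fun N => ?_
      congr 1
      apply Finset.sum_congr rfl; intro i _
      rw [ee_iter, Tmap_iter i hxf, hxf, hf, ← ee_add]
      congr 2; ring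
  have key' : ∀ᵐ x ∂μ, ∀ (k : ℤ) (H h : ℕ), Tendsto (fun N : ℕ => (1 / N : ℂ) * ∑ i ∈ Finset.range N,
      ee (k * (Tmap m)^[i] (f x)) * ((tent H h ((Tmap p)^[i] x) : ℝ) : ℂ)) atTop
      (𝓝 (if k = 0 then ((∫ t, tent H h t ∂μ : ℝ) : ℂ) else 0)) :=
    ae_all_iff.2 fun k => ae_all_iff.2 fun H => ae_all_iff.2 fun h => key k H h
  have hmem : ∀ᵐ x ∂μ, x ∈ Icc (0:ℝ) 1 := hμsupp
  filter_upwards [key', hmem] with x hx hx01 F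
  exact det_limit hμsupp (fun i => Tmap_iter_mem m i (hfim ⟨x, hx01, rfl⟩))
    (fun i => Tmap_iter_mem p i hx01) hx F
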